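/- Let m ∈ ℝ. (a) If m ≤ 0.547 or m ≥ 0.6, then Bacciotti's system X_m has no periodic orbit. (b) If 0.547 < m < 0.6, then any two periodic orbits of X_m have the same image (so there is at most one limit cycle), a periodic orbit and a heteroclinic connection cannot both exist, and every periodic orbit γ of minimal period T satisfies ∫₀ᵀ div X_m(γ(t)) dt > 0 (so it is hyperbolic and unstable). -/

import Mathlib

open Real Filter Set

noncomputable section

/-- Bacciotti's system `X_m(x,y) = (y³ − x³, −x + m·y⁵)`. -/
def bacciotti (m : ℝ) (p : ℝ × ℝ) : ℝ × ℝ :=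
  (p.2 ^ 3 - p.1 ^ 3, -p.1 + m * p.2 ^ 5)

/-- A (global) solution of Bacciotti's system. -/
def IsSolution (m : ℝ) (γ : ℝ → ℝ × ℝ) : Prop :=
  ∀ t : ℝ, HasDerivAt γ (bacciotti m (γ t)) t

/-- A periodic orbit: a nonconstant `T`-periodic solution with `T > 0`. -/
def IsPeriodicOrbit (m : ℝ) (γ : ℝ → ℝ × ℝ) (T : ℝ) : Prop :=
  IsSolution m γ ∧ (¬ ∃ c : ℝ × ℝ, ∀ t, γ t = c) ∧ 0 < T ∧ Function.Periodic γ T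

/-- The saddle point `p_m^+ = (m^{−1/4}, m^{−1/4})`. -/
def pPlus (m : ℝ) : ℝ × ℝ := (m ^ (-(1 : ℝ) / 4), m ^ (-(1 : ℝ) / 4))

/-- The saddle point `p_m^− = (−m^{−1/4}, −m^{−1/4})`. -/
def pMinus (m : ℝ) : ℝ × ℝ := (-(m ^ (-(1 : ℝ) / 4)), -(m ^ (-(1 : ℝ) / 4)))

/-- A heteroclinic connection from `p_m^−` to `p_m^+`. -/
def IsHeteroclinic (m : ℝ) (γ : ℝ → ℝ × ℝ) : Prop :=
  IsSolution m γ ∧ Tendsto γ atBot (nhds (pMinus m)) ∧ Tendsto γ atTop (nhds (pPlus m))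

/-- The divergence of Bacciotti's system: `div X_m(x,y) = −3x² + 5m·y⁴`. -/
def divBacciotti (m : ℝ) (p : ℝ × ℝ) : ℝ :=
  -3 * p.1 ^ 2 + 5 * m * p.2 ^ 4

/-- `T` is the minimal period of `γ`. -/
def IsMinimalPeriod (γ : ℝ → ℝ × ℝ) (T : ℝ) : Prop :=
  0 < T ∧ Function.Periodic γ T ∧ ∀ T' : ℝ, 0 < T' → Function.Periodic γ T' → T ≤ T'

/-- The form `∑ cᵢ uⁱ vⁿ⁻ⁱ` with coefficient list `[c₀, …, cₙ]`. -/
def homEval : List ℤ → ℝ → ℝ → ℝ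
  | [], _, _ => 0
  | c :: l, u, v => c * v ^ l.length + u * homEval l u v

/-- The coefficients of `(a u + b v) · p`. -/
def mulLin (a b : ℤ) (l : List ℤ) : List ℤ :=
  List.zipWith (fun x y => a * x + b * y) (0 :: l) (l ++ [0])

/-- The coefficients of `(a u + b v) ^ n`. -/
def linPow (a b : ℤ) : ℕ → List ℤ
  | 0 => [1]
  | n + 1 => mulLin a b (linPow a b n)

/-- The coefficients of `p (a u + b v) (c u + d v)`. -/
def linSubst (a b c d : ℤ) : List ℤ → List ℤ
  | [] => []
  | x :: l => List.zipWith (fun y z => x * y + z) (linPow c d l.length)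
      (mulLin a b (linSubst a b c d l))

@[simp] lemma length_mulLin (a b : ℤ) (l : List ℤ) : (mulLin a b l).length = l.length + 1 := by
  simp [mulLin]

@[simp] lemma length_linPow (a b : ℤ) (n : ℕ) : (linPow a b n).length = n + 1 := by
  induction n with
  | zero => rfl
  | succ n ih => simp [linPow, ih]

@[simp] lemma length_linSubst (a b c d : ℤ) (l : List ℤ) :
    (linSubst a b c d l).length = l.length := by
  induction l with
  | nil => rfl
  | cons x l ih => simp [linSubst, ih]

lemma homEval_zipWith (a b : ℤ) (u v : ℝ) :
    ∀ l l' : List ℤ, l.length = l'.length →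
      homEval (List.zipWith (fun x y => a * x + b * y) l l') u v
        = a * homEval l u v + b * homEval l' u v
  | [], [], _ => by simp [homEval]
  | [], _ :: _, h => by simp at h
  | _ :: _, [], h => by simp at h
  | x :: l, y :: l', h => by
    have h' : l.length = l'.length := by simpa using h
    simp only [List.zipWith_cons_cons, homEval, homEval_zipWith a b u v l l' h',
      List.length_zipWith, ← h', min_self]
    push_cast
    ring

lemma homEval_concat (c : ℤ) (u v : ℝ) (l : List ℤ) :
    homEval (l ++ [c]) u v = v * homEval l u v + c * u ^ l.length := by
  induction l with
  | nil => simp [homEval]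
  | cons x l ih =>
    simp only [List.cons_append, homEval, ih, List.length_append, List.length_cons,
      List.length_nil]
    ring

lemma homEval_mulLin (a b : ℤ) (u v : ℝ) (l : List ℤ) :
    homEval (mulLin a b l) u v = (a * u + b * v) * homEval l u v := by
  rw [mulLin, homEval_zipWith _ _ _ _ _ _ (by simp), homEval_concat]
  simp only [homEval]
  push_cast
  ring

lemma homEval_linPow (a b : ℤ) (u v : ℝ) (n : ℕ) :
    homEval (linPow a b n) u v = (a * u + b * v) ^ n := by
  induction n with
  | zero => simp [linPow, homEval]
  | succ n ih => rw [linPow, homEval_mulLin, ih, pow_succ']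

lemma homEval_linSubst (a b c d : ℤ) (u v : ℝ) (l : List ℤ) :
    homEval (linSubst a b c d l) u v = homEval l (a * u + b * v) (c * u + d * v) := by
  induction l with
  | nil => rfl
  | cons x l ih =>
    have h := homEval_zipWith x 1 u v (linPow c d l.length) (mulLin a b (linSubst a b c d l))
      (by simp)
    simp only [one_mul] at h
    rw [linSubst, h, homEval_linPow, homEval_mulLin, ih, homEval]
    push_cast
    ring

/-- Addition of integers, in a form that the kernel evaluates quickly. -/
def fastAdd (a : ℤ) : ℤ → ℤ :=
  Int.rec (motive := fun _ => ℤ → ℤ)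
    (fun m => Int.rec (motive := fun _ => ℤ) (fun n => .ofNat (Nat.add m n))
      (fun n => Bool.rec (motive := fun _ => ℤ) (.ofNat (Nat.sub m (Nat.succ n)))
        (.negSucc (Nat.sub n m)) (Nat.ble m n)))
    (fun n => Int.rec (motive := fun _ => ℤ)
      (fun m => Bool.rec (motive := fun _ => ℤ) (.ofNat (Nat.sub m (Nat.succ n)))
        (.negSucc (Nat.sub n m)) (Nat.ble m n))
      (fun m => .negSucc (Nat.succ (Nat.add m n)))) a

lemma fastAdd_eq (a b : ℤ) : fastAdd a b = a + b := by
  have h : ∀ m n : ℕ, ((Nat.ble m n).rec (.ofNat (Nat.sub m (Nat.succ n)))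
      (.negSucc (Nat.sub n m)) : ℤ) = m + Int.negSucc n := by
    intro m n
    cases h : Nat.ble m n
    · have : n < m := by
        by_contra hc
        rw [Nat.ble_eq_true_of_le (not_lt.1 hc)] at h
        exact absurd h (by simp)
      simp only [Int.ofNat_eq_natCast, Nat.sub_eq, Int.negSucc_eq]
      omega
    · have : m ≤ n := Nat.le_of_ble_eq_true h
      simp only [Nat.sub_eq, Int.negSucc_eq]
      omega
  cases a <;> cases b
  · rfl
  · exact h _ _
  · exact (h _ _).trans (add_comm _ _)
  · change Int.negSucc _ = _
    simp only [Int.negSucc_eq, Nat.succ_eq_add_one, Nat.add_eq]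
    omega

/-- The coefficients of `x vⁿ + (u + v) · r`, where `r` has degree `n - 1`. -/
def shiftStep (x : ℤ) (r : List ℤ) : List ℤ :=
  List.rec (motive := fun _ => ℤ → List ℤ) (fun x => [x])
    (fun y _ ih x => fastAdd x y :: ih y) r x

/-- The coefficients of `p (u + v) v`. -/
def shift (l : List ℤ) : List ℤ :=
  List.rec (motive := fun _ => List ℤ) [] (fun x _ ih => shiftStep x ih) l

lemma shiftStep_cons (x y : ℤ) (r : List ℤ) :
    shiftStep x (y :: r) = fastAdd x y :: shiftStep y r := rfl

lemma shift_cons (x : ℤ) (l : List ℤ) : shift (x :: l) = shiftStep x (shift l) := rfl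

/-- Multiplies the `i`-th coefficient by `a 2ⁱ`. -/
def scaleTwo (a : ℤ) (l : List ℤ) : List ℤ :=
  List.rec (motive := fun _ => ℤ → List ℤ) (fun _ => [])
    (fun x _ ih a => a * x :: ih (fastAdd a a)) l a

lemma scaleTwo_cons (a x : ℤ) (l : List ℤ) :
    scaleTwo a (x :: l) = a * x :: scaleTwo (fastAdd a a) l := rfl

lemma length_shiftStep (x : ℤ) (r : List ℤ) : (shiftStep x r).length = r.length + 1 := by
  induction r generalizing x with
  | nil => rfl
  | cons y r ih => simp [shiftStep_cons, ih]

lemma length_shift (l : List ℤ) : (shift l).length = l.length := by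
  induction l with
  | nil => rfl
  | cons x l ih => simp [shift_cons, length_shiftStep, ih]

lemma homEval_shiftStep (u v : ℝ) (x : ℤ) (r : List ℤ) :
    homEval (shiftStep x r) u v = x * v ^ r.length + (u + v) * homEval r u v := by
  induction r generalizing x with
  | nil => simp [shiftStep, homEval]
  | cons y r ih =>
    simp only [shiftStep_cons, fastAdd_eq, homEval, ih, length_shiftStep, List.length_cons]
    push_cast
    ring

lemma homEval_shift (u v : ℝ) (l : List ℤ) : homEval (shift l) u v = homEval l (u + v) v := by
  induction l with
  | nil => rfl
  | cons x l ih => rw [shift_cons, homEval_shiftStep, length_shift, ih, homEval]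

lemma length_scaleTwo (a : ℤ) (l : List ℤ) : (scaleTwo a l).length = l.length := by
  induction l generalizing a with
  | nil => rfl
  | cons x l ih => simp [scaleTwo_cons, ih]

lemma homEval_scaleTwo (u v : ℝ) (a : ℤ) (l : List ℤ) :
    homEval (scaleTwo a l) u v = a * homEval l (2 * u) v := by
  induction l generalizing a with
  | nil => simp [scaleTwo, homEval]
  | cons x l ih =>
    simp only [scaleTwo_cons, fastAdd_eq, homEval, ih, length_scaleTwo]
    push_cast
    ring

lemma homEval_reverse (u v : ℝ) (l : List ℤ) : homEval l.reverse u v = homEval l v u := by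
  induction l with
  | nil => rfl
  | cons x l ih => rw [List.reverse_cons, homEval_concat, ih, List.length_reverse, homEval]; ring

/-- The coefficients of `p (2 u + v) v`. -/
def splitUpper (l : List ℤ) : List ℤ := scaleTwo 1 (shift l)

/-- The coefficients of `p u (u + 2 v)`. -/
def splitLower (l : List ℤ) : List ℤ := (splitUpper l.reverse).reverse

lemma homEval_splitUpper (u v : ℝ) (l : List ℤ) :
    homEval (splitUpper l) u v = homEval l (2 * u + v) v := by
  rw [splitUpper, homEval_scaleTwo, homEval_shift, Int.cast_one, one_mul]

lemma homEval_splitLower (u v : ℝ) (l : List ℤ) :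
    homEval (splitLower l) u v = homEval l u (2 * v + u) := by
  rw [splitLower, homEval_reverse, homEval_splitUpper, homEval_reverse]

@[simp] lemma length_splitUpper (l : List ℤ) : (splitUpper l).length = l.length := by
  simp [splitUpper, length_scaleTwo, length_shift]

@[simp] lemma length_splitLower (l : List ℤ) : (splitLower l).length = l.length := by
  simp [splitLower]

/-- The bihomogeneous form with rows of coefficients `P`. -/
def biEval : List (List ℤ) → ℝ → ℝ → ℝ → ℝ → ℝ
  | [], _, _, _, _ => 0
  | r :: P, u, v, s, t => homEval r s t * v ^ P.length + u * biEval P u v s t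

/-- The transpose of a list of rows of length `m`. -/
def transp (m : ℕ) : List (List ℤ) → List (List ℤ)
  | [] => List.replicate m []
  | r :: P => List.zipWith List.cons r (transp m P)

lemma length_of_mem_zipWith_cons (n : ℕ) :
    ∀ (r : List ℤ) (Q : List (List ℤ)), (∀ q ∈ Q, q.length = n) →
      ∀ p ∈ List.zipWith List.cons r Q, p.length = n + 1
  | [], _, _, _, hp => by simp at hp
  | _ :: _, [], _, _, hp => by simp at hp
  | c :: r, q :: Q, hQ, p, hp => by
    rw [List.zipWith_cons_cons, List.mem_cons] at hp
    rcases hp with rfl | hp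
    · simp [hQ q List.mem_cons_self]
    · exact length_of_mem_zipWith_cons n r Q (fun q hq => hQ q (List.mem_cons_of_mem _ hq)) p hp

lemma length_transp (m : ℕ) : ∀ P : List (List ℤ), (∀ r ∈ P, r.length = m) →
    (transp m P).length = m ∧ ∀ r ∈ transp m P, r.length = P.length
  | [], _ => by simp [transp]
  | r :: P, h => by
    obtain ⟨h₁, h₂⟩ := length_transp m P fun r hr => h r (List.mem_cons_of_mem _ hr)
    have hr := h r List.mem_cons_self
    exact ⟨by simp [transp, h₁, hr], length_of_mem_zipWith_cons _ _ _ h₂⟩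

lemma biEval_zipWith_cons (u v s t : ℝ) (n : ℕ) :
    ∀ (r : List ℤ) (Q : List (List ℤ)), r.length = Q.length → (∀ q ∈ Q, q.length = n) →
      biEval (List.zipWith List.cons r Q) s t u v
        = homEval r s t * v ^ n + u * biEval Q s t u v
  | [], [], _, _ => by simp [homEval, biEval]
  | [], _ :: _, h, _ => by simp at h
  | _ :: _, [], h, _ => by simp at h
  | c :: r, q :: Q, h, hQ => by
    have h' : r.length = Q.length := by simpa using h
    have hq := hQ q List.mem_cons_self
    simp only [List.zipWith_cons_cons, biEval, homEval, List.length_zipWith, ← h', min_self,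
      biEval_zipWith_cons u v s t n r Q h' fun q hq => hQ q (List.mem_cons_of_mem _ hq), hq]
    ring

lemma biEval_replicate_nil (u v s t : ℝ) (m : ℕ) :
    biEval (List.replicate m []) u v s t = 0 := by
  induction m with
  | zero => rfl
  | succ m ih => simp [List.replicate_succ, biEval, homEval, ih]

lemma biEval_transp (m : ℕ) (u v s t : ℝ) : ∀ P : List (List ℤ), (∀ r ∈ P, r.length = m) →
    biEval (transp m P) s t u v = biEval P u v s t
  | [], _ => by simp [transp, biEval_replicate_nil, biEval]
  | r :: P, h => by
    have hP : ∀ r ∈ P, r.length = m := fun r hr => h r (List.mem_cons_of_mem _ hr)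
    obtain ⟨h₁, h₂⟩ := length_transp m P hP
    rw [transp, biEval_zipWith_cons u v s t P.length r _
      (by rw [h₁, h r List.mem_cons_self]) h₂, biEval_transp m u v s t P hP, biEval]

lemma biEval_map (f : List ℤ → List ℤ) (u v : ℝ) {s t s' t' : ℝ}
    (hf : ∀ r, homEval (f r) s t = homEval r s' t') (P : List (List ℤ)) :
    biEval (P.map f) u v s t = biEval P u v s' t' := by
  induction P with
  | nil => rfl
  | cons r P ih => simp [biEval, hf, ih]

/-- Subdivision trees for Bernstein positivity certificates. -/
inductive Cert
  | leaf
  | swap (T : Cert)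
  | split (L R : Cert)

def posInt (c : ℤ) : Bool :=
  Int.rec (motive := fun _ => Bool) (fun n => Nat.ble 1 n) (fun _ => false) c

lemma pos_of_posInt {c : ℤ} (h : posInt c = true) : 0 < c := by
  cases c with
  | ofNat n => exact Int.natCast_pos.2 (Nat.le_of_ble_eq_true h)
  | negSucc n => exact absurd h (by simp [posInt])

def allPosInt (l : List ℤ) : Bool :=
  List.rec (motive := fun _ => Bool) true (fun c _ ih => posInt c && ih) l

lemma pos_of_allPosInt {l : List ℤ} (h : allPosInt l = true) : ∀ c ∈ l, 0 < c := by
  induction l with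
  | nil => simp
  | cons c l ih =>
    have h : (posInt c && allPosInt l) = true := h
    rw [Bool.and_eq_true] at h
    exact List.forall_mem_cons.2 ⟨pos_of_posInt h.1, ih h.2⟩

def allPos (l : List ℤ) : Bool := !l.isEmpty && allPosInt l

def posButLast : List ℤ → Bool
  | [] => false
  | [_] => false
  | [c, d] => decide (0 < c) && decide (0 ≤ d)
  | c :: l => decide (0 < c) && posButLast l

def rowsPos (P : List (List ℤ)) : Bool := !P.isEmpty && P.all allPos

def rowsPosButLast : List (List ℤ) → Bool
  | [] => false
  | [_] => false
  | [r, q] => allPos r && posButLast q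
  | r :: P => allPos r && rowsPosButLast P

/-- Positivity check; with `corner = true` a zero at `v = t = 0` is tolerated. -/
def Cert.check : Cert → Bool → List (List ℤ) → Bool
  | leaf, false, P => rowsPos P
  | leaf, true, P => rowsPosButLast P
  | swap T, f, P =>
    let m := P.headI.length
    P.all (fun r => r.length == m) && T.check f (transp m P)
  | split L R, f, P =>
    L.check false (P.map splitLower) && R.check f (P.map splitUpper)

lemma homEval_nonneg {l : List ℤ} (h : ∀ c ∈ l, 0 < c) {u v : ℝ} (hu : 0 ≤ u) (hv : 0 ≤ v) :
    0 ≤ homEval l u v := by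
  induction l with
  | nil => simp [homEval]
  | cons c l ih =>
    have hc : (0 : ℝ) < c := by exact_mod_cast h c List.mem_cons_self
    have := ih fun c hc => h c (List.mem_cons_of_mem _ hc)
    rw [homEval]
    positivity

lemma homEval_pos {l : List ℤ} (h : allPos l = true) {u v : ℝ} (hu : 0 ≤ u) (hv : 0 ≤ v)
    (huv : 0 < u + v) : 0 < homEval l u v := by
  simp only [allPos, Bool.and_eq_true] at h
  obtain ⟨h₀, h⟩ := h
  replace h := pos_of_allPosInt h
  induction l with
  | nil => simp at h₀
  | cons c l ih =>
    have hc : (0 : ℝ) < c := by exact_mod_cast h c List.mem_cons_self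
    have hl : ∀ c ∈ l, 0 < c := fun c hc => h c (List.mem_cons_of_mem _ hc)
    have hn := homEval_nonneg hl hu hv
    rw [homEval]
    rcases hv.eq_or_lt with rfl | hv
    · have hu' : 0 < u := by linarith
      cases l with
      | nil => simp [homEval, hc]
      | cons d l => have := ih (by simp) hl; positivity
    · positivity

lemma homEval_posButLast {u v : ℝ} (hu : 0 ≤ u) (hv : 0 ≤ v) :
    ∀ {l : List ℤ}, posButLast l = true → 0 ≤ homEval l u v ∧ (0 < v → 0 < homEval l u v)
  | [], h => by simp [posButLast] at h
  | [_], h => by simp [posButLast] at h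
  | [c, d], h => by
    simp only [posButLast, Bool.and_eq_true, decide_eq_true_eq] at h
    have hc : (0 : ℝ) < c := by exact_mod_cast h.1
    have hd : (0 : ℝ) ≤ d := by exact_mod_cast h.2
    simp only [homEval, List.length_cons, List.length_nil]
    exact ⟨by positivity, fun _ => by positivity⟩
  | c :: d :: e :: l, h => by
    simp only [posButLast, Bool.and_eq_true, decide_eq_true_eq] at h
    have hc : (0 : ℝ) < c := by exact_mod_cast h.1
    have := (homEval_posButLast hu hv (l := d :: e :: l) (by simpa [posButLast] using h.2)).1
    rw [homEval]
    exact ⟨by positivity, fun _ => by positivity⟩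

lemma biEval_pos {P : List (List ℤ)} (h : rowsPos P = true) {u v s t : ℝ} (hu : 0 ≤ u)
    (hv : 0 ≤ v) (huv : 0 < u + v) (hs : 0 ≤ s) (ht : 0 ≤ t) (hst : 0 < s + t) :
    0 < biEval P u v s t := by
  simp only [rowsPos, Bool.and_eq_true, List.all_eq_true] at h
  obtain ⟨h₀, h⟩ := h
  induction P with
  | nil => simp at h₀
  | cons r P ih =>
    have hr := homEval_pos (h r List.mem_cons_self) hs ht hst
    have hP : ∀ r ∈ P, allPos r = true := fun r hr => h r (List.mem_cons_of_mem _ hr)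
    rw [biEval]
    cases P with
    | nil => simpa [biEval] using hr
    | cons q P =>
      have := ih (by simp) hP
      rcases hv.eq_or_lt with rfl | hv
      · have hu' : 0 < u := by linarith
        positivity
      · positivity

lemma biEval_posButLast {u v s t : ℝ} (hu : 0 ≤ u) (hv : 0 ≤ v) (huv : 0 < u + v)
    (hs : 0 ≤ s) (ht : 0 ≤ t) (hst : 0 < s + t) (hvt : 0 < v ∨ 0 < t) :
    ∀ {P : List (List ℤ)}, rowsPosButLast P = true → 0 < biEval P u v s t
  | [], h => by simp [rowsPosButLast] at h
  | [_], h => by simp [rowsPosButLast] at h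
  | [r, q], h => by
    simp only [rowsPosButLast, Bool.and_eq_true] at h
    have hr := homEval_pos h.1 hs ht hst
    obtain ⟨hq, hq'⟩ := homEval_posButLast hs ht h.2
    simp only [biEval, List.length_cons, List.length_nil]
    rcases hv.eq_or_lt with rfl | hv
    · have hu' : 0 < u := by linarith
      have := hq' (hvt.resolve_left (lt_irrefl _))
      positivity
    · positivity
  | r :: q :: p :: P, h => by
    simp only [rowsPosButLast, Bool.and_eq_true] at h
    have hr := homEval_pos h.1 hs ht hst
    have := biEval_posButLast hu hv huv hs ht hst hvt (P := q :: p :: P)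
      (by simpa [rowsPosButLast] using h.2)
    rw [biEval]
    rcases hv.eq_or_lt with rfl | hv
    · have hu' : 0 < u := by linarith
      positivity
    · positivity

lemma Cert.pos_of_check : ∀ (T : Cert) (f : Bool) {P : List (List ℤ)}, T.check f P = true →
    ∀ {u v s t : ℝ}, 0 ≤ u → 0 ≤ v → 0 < u + v → 0 ≤ s → 0 ≤ t → 0 < s + t →
      (f = true → 0 < v ∨ 0 < t) → 0 < biEval P u v s t
  | leaf, false, _, h, _, _, _, _, hu, hv, huv, hs, ht, hst, _ => biEval_pos h hu hv huv hs ht hst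
  | leaf, true, _, h, _, _, _, _, hu, hv, huv, hs, ht, hst, hf =>
    biEval_posButLast hu hv huv hs ht hst (hf rfl) h
  | swap T, f, P, h, u, v, s, t, hu, hv, huv, hs, ht, hst, hf => by
    simp only [check, Bool.and_eq_true, List.all_eq_true, beq_iff_eq] at h
    rw [← biEval_transp P.headI.length u v s t P h.1]
    exact pos_of_check T f h.2 hs ht hst hu hv huv fun h => (hf h).symm
  | split L R, f, P, h, u, v, s, t, hu, hv, huv, hs, ht, hst, hf => by
    simp only [check, Bool.and_eq_true] at h
    rcases le_total s t with hle | hle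
    · have := pos_of_check L false h.1 hu hv huv hs (t := (t - s) / 2) (by linarith) (by linarith)
        (by simp)
      rw [biEval_map _ _ _ (homEval_splitLower _ _)] at this
      convert this using 1
      congr 1
      ring
    · have := pos_of_check R f h.2 hu hv huv (s := (s - t) / 2) (by linarith) ht (by linarith) hf
      rw [biEval_map _ _ _ (homEval_splitUpper _ _)] at this
      convert this using 1
      congr 1
      ring

/-- Adds `c Xⁱ` to a coefficient list. -/
def addCoef (c : ℤ) : ℕ → List ℤ → List ℤ
  | 0, [] => [c]
  | 0, x :: l => (x + c) :: l
  | i + 1, [] => 0 :: addCoef c i []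
  | i + 1, x :: l => x :: addCoef c i l

/-- Adds `c Xⁱ Yʲ` to a list of rows. -/
def addMono (c : ℤ) (j : ℕ) : ℕ → List (List ℤ) → List (List ℤ)
  | 0, [] => [addCoef c j []]
  | 0, r :: P => addCoef c j r :: P
  | i + 1, [] => [] :: addMono c j i []
  | i + 1, r :: P => r :: addMono c j i P

lemma homEval_addCoef (c : ℤ) (u : ℝ) : ∀ (i : ℕ) (l : List ℤ),
    homEval (addCoef c i l) u 1 = homEval l u 1 + c * u ^ i
  | 0, [] => by simp [addCoef, homEval]
  | 0, x :: l => by simp [addCoef, homEval]; ring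
  | i + 1, [] => by simp [addCoef, homEval, homEval_addCoef c u i []]; ring
  | i + 1, x :: l => by simp [addCoef, homEval, homEval_addCoef c u i l]; ring

lemma biEval_addMono (c : ℤ) (j : ℕ) (u s : ℝ) : ∀ (i : ℕ) (P : List (List ℤ)),
    biEval (addMono c j i P) u 1 s 1 = biEval P u 1 s 1 + c * u ^ i * s ^ j
  | 0, [] => by simp [addMono, biEval, homEval_addCoef, homEval]
  | 0, r :: P => by simp [addMono, biEval, homEval_addCoef]; ring
  | i + 1, [] => by simp [addMono, biEval, biEval_addMono c j u s i [], homEval]; ring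
  | i + 1, r :: P => by simp [addMono, biEval, biEval_addMono c j u s i P]; ring

def padTo (m : ℕ) (l : List ℤ) : List ℤ := l ++ List.replicate (m - l.length) 0

lemma homEval_padTo (m : ℕ) (l : List ℤ) (u : ℝ) : homEval (padTo m l) u 1 = homEval l u 1 := by
  unfold padTo
  generalize m - l.length = k
  induction l with
  | nil =>
    induction k with
    | zero => rfl
    | succ k ih => simpa [List.replicate_succ, homEval] using Or.inr ih
  | cons x l ih => simp [homEval, ih]

lemma biEval_map_padTo (m : ℕ) (P : List (List ℤ)) (u s : ℝ) :
    biEval (P.map (padTo m)) u 1 s 1 = biEval P u 1 s 1 := by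
  induction P with
  | nil => rfl
  | cons r P ih => simp [biEval, homEval_padTo, ih]

/-- The value of a sparse polynomial whose monomials are given by `φ`. -/
def spEval {α : Type} (φ : α → ℝ) : List (ℤ × α) → ℝ
  | [] => 0
  | m :: p => m.1 * φ m.2 + spEval φ p

/-- Adds a term to a sparse polynomial, merging equal monomials. -/
def spInsert {α : Type} [DecidableEq α] (m : ℤ × α) : List (ℤ × α) → List (ℤ × α)
  | [] => [m]
  | n :: p => if m.2 = n.2 then (m.1 + n.1, n.2) :: p else n :: spInsert m p

/-- Collects equal monomials and drops zero coefficients. -/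
def spNorm {α : Type} [DecidableEq α] (p : List (ℤ × α)) : List (ℤ × α) :=
  (p.foldr spInsert []).filter fun m => !decide (m.1 = 0)

section
variable {α : Type} (φ : α → ℝ)

lemma spEval_append (p q : List (ℤ × α)) : spEval φ (p ++ q) = spEval φ p + spEval φ q := by
  induction p with
  | nil => simp [spEval]
  | cons m p ih => simp [spEval, ih, add_assoc]

lemma spEval_insert [DecidableEq α] (m : ℤ × α) (p : List (ℤ × α)) :
    spEval φ (spInsert m p) = m.1 * φ m.2 + spEval φ p := by
  induction p with
  | nil => rfl
  | cons n p ih =>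
    rw [spInsert]
    split_ifs with h
    · simp only [spEval, h]; push_cast; ring
    · simp only [spEval, ih]; ring

lemma spEval_norm [DecidableEq α] (p : List (ℤ × α)) : spEval φ (spNorm p) = spEval φ p := by
  have h₁ : ∀ q : List (ℤ × α),
      spEval φ (q.filter fun m => !decide (m.1 = 0)) = spEval φ q := by
    intro q
    induction q with
    | nil => rfl
    | cons m q ih =>
      by_cases h : m.1 = 0 <;> simp [spEval, h, ih]
  rw [spNorm, h₁]
  induction p with
  | nil => rfl
  | cons m p ih => rw [List.foldr_cons, spEval_insert, ih, spEval]

/-- A change of monomials multiplies a sparse polynomial by a common factor. -/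
lemma spEval_map {β : Type} (ψ : β → ℝ) (κ : ℝ) (g : ℤ × α → ℤ × β) (p : List (ℤ × α))
    (h : ∀ m ∈ p, (m.1 : ℝ) * φ m.2 = κ * ((g m).1 * ψ (g m).2)) :
    spEval φ p = κ * spEval ψ (p.map g) := by
  induction p with
  | nil => simp [spEval]
  | cons m p ih =>
    rw [List.map_cons, spEval, spEval, h m List.mem_cons_self,
      ih fun m hm => h m (List.mem_cons_of_mem _ hm)]
    ring

end

/-- Bivariate sparse polynomials, as lists of `(c, i, j)` standing for `c xⁱ yʲ`. -/
abbrev Poly2 := List (ℤ × ℕ × ℕ)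

def mono2 (x y : ℝ) (e : ℕ × ℕ) : ℝ := x ^ e.1 * y ^ e.2

def Poly2.dense (p : Poly2) : List (List ℤ) :=
  let P := p.foldr (fun m P => addMono m.1 m.2.2 m.2.1 P) []
  P.map (padTo (P.foldr (fun r n => max r.length n) 0))

lemma Poly2.biEval_dense (p : Poly2) (x y : ℝ) :
    biEval p.dense x 1 y 1 = spEval (mono2 x y) p := by
  rw [dense, biEval_map_padTo]
  induction p with
  | nil => rfl
  | cons m p ih =>
    rw [List.foldr_cons, biEval_addMono, ih, spEval, mono2]
    ring

/-- Checks positivity for `x ∈ [0, 1]` and `y ∈ [-1, 1]` (`y ∈ [0, 1]` if `b = 0`). -/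
def Poly2.boxCheck (T : Cert) (f : Bool) (b : ℕ) (p : Poly2) : Bool :=
  let P := p.dense.map (linSubst 1 (-b) 1 1)
  let m := P.headI.length
  P.all (fun r => r.length == m) && T.check f ((transp m P).map (linSubst 1 0 1 1))

lemma Poly2.pos_of_boxCheck {T : Cert} {f : Bool} {b : ℕ} {p : Poly2}
    (h : p.boxCheck T f b = true) {x y : ℝ} (hx₀ : 0 ≤ x) (hx₁ : x ≤ 1) (hy₀ : -b ≤ y)
    (hy₁ : y ≤ 1) (hf : f = true → x < 1 ∨ y < 1) : 0 < spEval (mono2 x y) p := by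
  simp only [boxCheck, Bool.and_eq_true, List.all_eq_true, beq_iff_eq] at h
  have hb : (0 : ℝ) < b + 1 := by positivity
  have key := T.pos_of_check f h.2 (u := (y + b) / (b + 1)) (v := (1 - y) / (b + 1))
    (s := x) (t := 1 - x) (div_nonneg (by linarith) hb.le) (div_nonneg (by linarith) hb.le)
    (by rw [← add_div]; exact div_pos (by linarith) hb)
    hx₀ (by linarith) (by linarith)
    (fun hf' => (hf hf').symm.imp (fun h => div_pos (by linarith) hb) fun h => by linarith)
  rw [biEval_map _ _ _ (homEval_linSubst _ _ _ _ _ _), biEval_transp _ _ _ _ _ _ h.1,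
    biEval_map _ _ _ (homEval_linSubst _ _ _ _ _ _)] at key
  rw [← biEval_dense]
  convert key using 1
  push_cast
  congr 1
  · ring
  · ring
  · field_simp; ring
  · field_simp; ring

/-- Positivity check on `[-1, 1]² ∖ {0}` by blow-up with weights `(2, 1)`. -/
def Poly2.checkA (T₁ T₂ : Cert) (f : Bool) (k : ℕ) (p : Poly2) : Bool :=
  let q := spNorm p
  q.all (fun m => (m.2.1 + m.2.2) % 2 == 0 && Nat.ble k (2 * m.2.1 + m.2.2)) &&
    (boxCheck T₁ f 1 (q.map fun m => (m.1, 2 * m.2.1 + m.2.2 - k, m.2.1)) &&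
      boxCheck T₂ f 1 (q.map fun m => (m.1, 2 * m.2.1 + m.2.2 - k, m.2.2)))

/-- Positivity check on `[-1, 1]² ∖ {0}` for polynomials whose Newton polygon has slopes
of weights `(2, 1)` and `(1, 1)`. -/
def Poly2.checkD (T₁ T₂ T₃ T₄ : Cert) (k h : ℕ) (p : Poly2) : Bool :=
  let q := spNorm p
  q.all (fun m => (m.2.1 + m.2.2) % 2 == 0 && (Nat.ble k (2 * m.2.1 + m.2.2) &&
      Nat.ble h (m.2.1 + m.2.2))) &&
    ((boxCheck T₁ false 1 (q.map fun m => (m.1, 2 * m.2.1 + m.2.2 - k, m.2.1)) &&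
      boxCheck T₂ false 1 (q.map fun m => (m.1, m.2.1 + m.2.2 - h, m.2.2))) &&
      (boxCheck T₃ false 0 (q.map fun m => (m.1, 2 * m.2.1 + m.2.2 - k, m.2.1 + m.2.2 - h)) &&
      boxCheck T₄ false 0 (q.map fun m =>
        ((-1) ^ m.2.2 * m.1, 2 * m.2.1 + m.2.2 - k, m.2.1 + m.2.2 - h))))

lemma spEval_mono2_neg {q : Poly2} (h : ∀ m ∈ q, (m.2.1 + m.2.2) % 2 = 0) (x y : ℝ) :
    spEval (mono2 (-x) (-y)) q = spEval (mono2 x y) q := by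
  rw [spEval_map (mono2 (-x) (-y)) (mono2 x y) 1 id q, List.map_id, one_mul]
  intro m hm
  have : Even (m.2.1 + m.2.2) := Nat.even_iff.2 (h m hm)
  simp only [mono2, id, one_mul, neg_pow x, neg_pow y]
  rw [show (-1 : ℝ) ^ m.2.1 * x ^ m.2.1 * ((-1) ^ m.2.2 * y ^ m.2.2)
    = (-1) ^ (m.2.1 + m.2.2) * (x ^ m.2.1 * y ^ m.2.2) by ring, this.neg_one_pow, one_mul]

section
variable {q : Poly2} {k h : ℕ} {f : Bool} {T : Cert}

lemma pos_of_abs_le_sq (hk : ∀ m ∈ q, k ≤ 2 * m.2.1 + m.2.2)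
    (hT : Poly2.boxCheck T f 1 (q.map fun m => (m.1, 2 * m.2.1 + m.2.2 - k, m.2.1)) = true)
    {x y : ℝ} (hy : 0 < y) (hy₁ : y ≤ 1) (hxy : |x| ≤ y ^ 2) (hf : f = true → y < 1 ∨ x < 1) :
    0 < spEval (mono2 x y) q := by
  have hy2 : 0 < y ^ 2 := by positivity
  rw [spEval_map (mono2 x y) (mono2 y (x / y ^ 2)) (y ^ k) _ q _]
  · refine mul_pos (by positivity) (Poly2.pos_of_boxCheck hT hy.le hy₁ ?_ ?_ ?_)
    · rw [Nat.cast_one, le_div_iff₀ hy2]; linarith [(abs_le.1 hxy).1]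
    · rw [div_le_one hy2]; exact (abs_le.1 hxy).2
    · intro h'
      rcases hy₁.lt_or_eq with h₁ | rfl
      · exact Or.inl h₁
      · simpa using hf h'
  · intro m hm
    obtain ⟨c, hc⟩ := Nat.exists_eq_add_of_le (hk m hm)
    simp only [mono2, hc, Nat.add_sub_cancel_left]
    rw [div_pow, ← pow_mul]
    field_simp
    have e : y ^ (2 * m.2.1 + m.2.2) = y ^ k * y ^ c := by rw [hc, pow_add]
    linear_combination (m.1 : ℝ) * x ^ m.2.1 * e

lemma pos_of_sq_le_abs (hk : ∀ m ∈ q, k ≤ 2 * m.2.1 + m.2.2)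
    (hT : Poly2.boxCheck T f 1 (q.map fun m => (m.1, 2 * m.2.1 + m.2.2 - k, m.2.2)) = true)
    {x y : ℝ} (hx : 0 < x) (hx₁ : x ≤ 1) (hxy : y ^ 2 ≤ x) (hf : f = true → x < 1 ∨ y < 1) :
    0 < spEval (mono2 x y) q := by
  obtain ⟨w, hw, rfl⟩ : ∃ w : ℝ, 0 < w ∧ w ^ 2 = x := ⟨√x, by positivity, Real.sq_sqrt hx.le⟩
  have hw₁ : w ≤ 1 := by nlinarith
  have hyw := abs_le.1 (abs_le_of_sq_le_sq hxy hw.le)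
  rw [spEval_map (mono2 (w ^ 2) y) (mono2 w (y / w)) (w ^ k) _ q _]
  · refine mul_pos (by positivity) (Poly2.pos_of_boxCheck hT hw.le hw₁ ?_ ?_ ?_)
    · rw [Nat.cast_one, le_div_iff₀ hw]; linarith
    · rw [div_le_one hw]; exact hyw.2
    · intro h'
      rcases hw₁.lt_or_eq with h₁ | rfl
      · exact Or.inl h₁
      · simpa using hf h'
  · intro m hm
    obtain ⟨c, hc⟩ := Nat.exists_eq_add_of_le (hk m hm)
    simp only [mono2, hc, Nat.add_sub_cancel_left]
    rw [div_pow, ← pow_mul]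
    field_simp
    have e : w ^ (2 * m.2.1 + m.2.2) = w ^ k * w ^ c := by rw [hc, pow_add]
    linear_combination (m.1 : ℝ) * y ^ m.2.2 * e

end

lemma Poly2.pos_of_checkA {T₁ T₂ : Cert} {f : Bool} {k : ℕ} {p : Poly2}
    (hp : p.checkA T₁ T₂ f k = true) {x y : ℝ} (hx : |x| ≤ 1) (hy : |y| ≤ 1)
    (h₀ : x ≠ 0 ∨ y ≠ 0) (hf : f = true → |x| < 1 ∨ |y| < 1) : 0 < spEval (mono2 x y) p := by
  simp only [checkA, Bool.and_eq_true, List.all_eq_true, beq_iff_eq, Nat.ble_eq] at hp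
  obtain ⟨hm, h₁, h₂⟩ := hp
  rw [← spEval_norm]
  rcases le_total (|x|) (y ^ 2) with h | h
  · have hy₀ : y ≠ 0 := by
      rintro rfl
      have : |x| ≤ 0 := by simpa using h
      simp_all
    rcases hy₀.lt_or_gt with hy₀ | hy₀
    · rw [← spEval_mono2_neg fun m h => (hm m h).1]
      refine pos_of_abs_le_sq (fun m h => (hm m h).2) h₁ (by linarith) (by linarith [abs_le.1 hy])
        (by simpa using h) fun h' => ?_
      exact (hf h').symm.imp (fun h => by linarith [abs_lt.1 h]) fun h => by linarith [abs_lt.1 h]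
    · exact pos_of_abs_le_sq (fun m h => (hm m h).2) h₁ hy₀ (by linarith [abs_le.1 hy])
        h fun h' => (hf h').symm.imp (fun h => by linarith [abs_lt.1 h])
          fun h => by linarith [abs_lt.1 h]
  · have hx₀ : x ≠ 0 := by
      rintro rfl
      have : y ^ 2 ≤ 0 := by simpa using h
      have : y = 0 := by nlinarith
      simp_all
    rcases hx₀.lt_or_gt with hx₀ | hx₀
    · rw [← spEval_mono2_neg fun m h => (hm m h).1]
      rw [abs_of_neg hx₀] at h
      refine pos_of_sq_le_abs (fun m h => (hm m h).2) h₂ (by linarith) (by linarith [abs_le.1 hx])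
        (by simpa using h) fun h' => ?_
      exact (hf h').imp (fun h => by linarith [abs_lt.1 h]) fun h => by linarith [abs_lt.1 h]
    · rw [abs_of_pos hx₀] at h
      exact pos_of_sq_le_abs (fun m h => (hm m h).2) h₂ hx₀ (by linarith [abs_le.1 hx])
        h fun h' => (hf h').imp (fun h => by linarith [abs_lt.1 h])
          fun h => by linarith [abs_lt.1 h]

lemma pos_of_abs_le_abs {T : Cert} {q : Poly2} {h : ℕ} (hk : ∀ m ∈ q, h ≤ m.2.1 + m.2.2)
    (hT : Poly2.boxCheck T false 1 (q.map fun m => (m.1, m.2.1 + m.2.2 - h, m.2.2)) = true)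
    {x y : ℝ} (hx : 0 < x) (hx₁ : x ≤ 1) (hxy : |y| ≤ x) :
    0 < spEval (mono2 x y) q := by
  have hyw := abs_le.1 hxy
  rw [spEval_map (mono2 x y) (mono2 x (y / x)) (x ^ h) _ q _]
  · refine mul_pos (by positivity) (Poly2.pos_of_boxCheck hT hx.le hx₁ ?_ ?_ (by simp))
    · rw [Nat.cast_one, le_div_iff₀ hx]; linarith
    · rw [div_le_one hx]; exact hyw.2
  · intro m hm
    obtain ⟨c, hc⟩ := Nat.exists_eq_add_of_le (hk m hm)
    simp only [mono2, hc, Nat.add_sub_cancel_left]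
    rw [div_pow]
    field_simp
    have e : x ^ (m.2.1 + m.2.2) = x ^ h * x ^ c := by rw [hc, pow_add]
    linear_combination (m.1 : ℝ) * y ^ m.2.2 * e

lemma pos_of_sq_le_of_le_abs {T₃ T₄ : Cert} {q : Poly2} {k h : ℕ}
    (hk : ∀ m ∈ q, k ≤ 2 * m.2.1 + m.2.2) (hh : ∀ m ∈ q, h ≤ m.2.1 + m.2.2)
    (h₃ : Poly2.boxCheck T₃ false 0
      (q.map fun m => (m.1, 2 * m.2.1 + m.2.2 - k, m.2.1 + m.2.2 - h)) = true)
    (h₄ : Poly2.boxCheck T₄ false 0 (q.map fun m =>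
      ((-1) ^ m.2.2 * m.1, 2 * m.2.1 + m.2.2 - k, m.2.1 + m.2.2 - h)) = true)
    {x y : ℝ} (hx : 0 < x) (hxy : y ^ 2 ≤ x) (hxy' : x ≤ |y|) :
    0 < spEval (mono2 x y) q := by
  have hy : 0 < |y| := hx.trans_le hxy'
  have hτ₀ : 0 < x / |y| := by positivity
  have hτ₁ : x / |y| ≤ 1 := (div_le_one hy).2 hxy'
  have hκ₀ : 0 < y ^ 2 / x := by rw [← sq_abs]; positivity
  have hκ₁ : y ^ 2 / x ≤ 1 := (div_le_one hx).2 hxy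
  have hx' : x = (x / |y|) ^ 2 * (y ^ 2 / x) := by rw [← sq_abs y]; field_simp
  have hy' : |y| = x / |y| * (y ^ 2 / x) := by rw [← sq_abs y]; field_simp
  generalize x / |y| = τ at *
  generalize y ^ 2 / x = κ at *
  have key : ∀ m ∈ q, (τ ^ 2 * κ) ^ m.2.1 * (τ * κ) ^ m.2.2 =
      τ ^ k * κ ^ h * (τ ^ (2 * m.2.1 + m.2.2 - k) * κ ^ (m.2.1 + m.2.2 - h)) := by
    intro m hm
    obtain ⟨c, hc⟩ := Nat.exists_eq_add_of_le (hk m hm)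
    obtain ⟨d, hd⟩ := Nat.exists_eq_add_of_le (hh m hm)
    rw [show (τ ^ 2 * κ) ^ m.2.1 * (τ * κ) ^ m.2.2
      = τ ^ (2 * m.2.1 + m.2.2) * κ ^ (m.2.1 + m.2.2) by ring, hc, hd,
      Nat.add_sub_cancel_left, Nat.add_sub_cancel_left]
    ring
  rcases abs_cases y with ⟨ha, -⟩ | ⟨ha, -⟩ <;> rw [ha] at hy'
  · rw [spEval_map (mono2 x y) (mono2 τ κ) (τ ^ k * κ ^ h) _ q _]
    · exact mul_pos (by positivity)
        (Poly2.pos_of_boxCheck h₃ hτ₀.le hτ₁ (by simpa using hκ₀.le) hκ₁ (by simp))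
    · intro m hm
      simp only [mono2]
      rw [hy', hx', key m hm]
      ring
  · rw [spEval_map (mono2 x y) (mono2 τ κ) (τ ^ k * κ ^ h) _ q _]
    · exact mul_pos (by positivity)
        (Poly2.pos_of_boxCheck h₄ hτ₀.le hτ₁ (by simpa using hκ₀.le) hκ₁ (by simp))
    · intro m hm
      simp only [mono2]
      rw [show y = -1 * (τ * κ) by linarith, hx', mul_pow (-1 : ℝ)]
      have := key m hm
      push_cast
      linear_combination (m.1 : ℝ) * (-1) ^ m.2.2 * this

lemma Poly2.pos_of_checkD {T₁ T₂ T₃ T₄ : Cert} {k h : ℕ} {p : Poly2}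
    (hp : p.checkD T₁ T₂ T₃ T₄ k h = true) {x y : ℝ} (hx : |x| ≤ 1) (hy : |y| ≤ 1)
    (h₀ : x ≠ 0 ∨ y ≠ 0) : 0 < spEval (mono2 x y) p := by
  simp only [checkD, Bool.and_eq_true, List.all_eq_true, beq_iff_eq, Nat.ble_eq] at hp
  obtain ⟨hm, ⟨h₁, h₂⟩, h₃, h₄⟩ := hp
  rw [← spEval_norm]
  rcases le_total (|x|) (y ^ 2) with h | h
  · have hy₀ : y ≠ 0 := by
      rintro rfl
      have : |x| ≤ 0 := by simpa using h
      simp_all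
    rcases hy₀.lt_or_gt with hy₀ | hy₀
    · rw [← spEval_mono2_neg fun m h => (hm m h).1]
      exact pos_of_abs_le_sq (fun m h => (hm m h).2.1) h₁ (by linarith)
        (by linarith [abs_le.1 hy]) (by simpa using h) (by simp)
    · exact pos_of_abs_le_sq (fun m h => (hm m h).2.1) h₁ hy₀ (by linarith [abs_le.1 hy])
        h (by simp)
  · have hx₀ : x ≠ 0 := by
      rintro rfl
      have : y ^ 2 ≤ 0 := by simpa using h
      have : y = 0 := by nlinarith
      simp_all
    have main : ∀ x y : ℝ, |x| ≤ 1 → y ^ 2 ≤ |x| → 0 < x →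
        0 < spEval (mono2 x y) (spNorm p) := by
      intro x y hx h hx₀
      rw [abs_of_pos hx₀] at h hx
      rcases le_total (|y|) x with h' | h'
      · exact pos_of_abs_le_abs (fun m h => (hm m h).2.2) h₂ hx₀ hx h'
      · exact pos_of_sq_le_of_le_abs (fun m h => (hm m h).2.1) (fun m h => (hm m h).2.2)
          h₃ h₄ hx₀ h h'
    rcases hx₀.lt_or_gt with hx₀ | hx₀
    · rw [← spEval_mono2_neg fun m h => (hm m h).1]
      exact main _ _ (by simpa using hx) (by simpa using h) (by linarith)
    · exact main _ _ hx h hx₀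

/-- Trivariate sparse polynomials, as lists of `(c, i, j, k)` standing for `c xⁱ yʲ qᵏ`. -/
abbrev Poly3 := List (ℤ × ℕ × ℕ × ℕ)

namespace Poly3

def mono (x y q : ℝ) (e : ℕ × ℕ × ℕ) : ℝ := x ^ e.1 * y ^ e.2.1 * q ^ e.2.2

def eval (p : Poly3) (x y q : ℝ) : ℝ := spEval (mono x y q) p

def mul (p r : Poly3) : Poly3 :=
  p.flatMap fun m => r.map fun n =>
    (m.1 * n.1, m.2.1 + n.2.1, m.2.2.1 + n.2.2.1, m.2.2.2 + n.2.2.2)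

def smul (a : ℤ) (p : Poly3) : Poly3 := p.map fun m => (a * m.1, m.2)

def dx (p : Poly3) : Poly3 := p.map fun m => (m.1 * m.2.1, m.2.1 - 1, m.2.2)

def dy (p : Poly3) : Poly3 := p.map fun m => (m.1 * m.2.2.1, m.2.1, m.2.2.1 - 1, m.2.2.2)

/-- The derivative of `V` along the vector field `(F, G)`. -/
def lie (V F G : Poly3) : Poly3 := V.dx.mul F ++ V.dy.mul G

/-- `V · div (F, G) + a · V̇`. -/
def divOp (a : ℤ) (V F G : Poly3) : Poly3 := V.mul (F.dx ++ G.dy) ++ (V.lie F G).smul a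

section
variable (x y q : ℝ)

lemma eval_nil : eval [] x y q = 0 := rfl

lemma eval_cons (m : ℤ × ℕ × ℕ × ℕ) (p : Poly3) :
    eval (m :: p) x y q = m.1 * (x ^ m.2.1 * y ^ m.2.2.1 * q ^ m.2.2.2) + eval p x y q := rfl

lemma eval_append (p r : Poly3) : eval (p ++ r) x y q = eval p x y q + eval r x y q :=
  spEval_append _ p r

lemma eval_smul (a : ℤ) (p : Poly3) : eval (p.smul a) x y q = a * eval p x y q := by
  induction p with
  | nil => simp [smul, eval_nil]
  | cons m p ih =>
    rw [smul] at ih ⊢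
    rw [List.map_cons, eval_cons, eval_cons, ih]
    push_cast
    ring

lemma eval_mul (p r : Poly3) : eval (p.mul r) x y q = eval p x y q * eval r x y q := by
  have h : ∀ m : ℤ × ℕ × ℕ × ℕ, eval (r.map fun n =>
      (m.1 * n.1, m.2.1 + n.2.1, m.2.2.1 + n.2.2.1, m.2.2.2 + n.2.2.2)) x y q
      = m.1 * (x ^ m.2.1 * y ^ m.2.2.1 * q ^ m.2.2.2) * eval r x y q := by
    intro m
    induction r with
    | nil => simp [eval_nil]
    | cons n r ih =>
      rw [List.map_cons, eval_cons, eval_cons, ih]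
      push_cast
      ring
  induction p with
  | nil => simp [mul, eval_nil]
  | cons m p ih =>
    rw [mul, List.flatMap_cons, eval_append, h, eval_cons, ← mul, ih]
    ring

lemma eval_lie (V F G : Poly3) : eval (lie V F G) x y q
    = eval V.dx x y q * eval F x y q + eval V.dy x y q * eval G x y q := by
  simp only [lie, eval_append, eval_mul]

lemma eval_divOp (a : ℤ) (V F G : Poly3) : eval (divOp a V F G) x y q
    = eval V x y q * (eval F.dx x y q + eval G.dy x y q) + a * eval (lie V F G) x y q := by
  simp only [divOp, eval_append, eval_mul, eval_smul]

end

lemma hasFDerivAt_eval (p : Poly3) (q : ℝ) (v : ℝ × ℝ) :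
    HasFDerivAt (fun v : ℝ × ℝ => eval p v.1 v.2 q)
      (eval p.dx v.1 v.2 q • ContinuousLinearMap.fst ℝ ℝ ℝ
        + eval p.dy v.1 v.2 q • ContinuousLinearMap.snd ℝ ℝ ℝ) v := by
  induction p with
  | nil => simpa [dx, dy, eval_nil] using hasFDerivAt_const (0 : ℝ) v
  | cons m p ih =>
    have h₁ : HasFDerivAt (fun v : ℝ × ℝ => v.1 ^ m.2.1)
        ((m.2.1 * v.1 ^ (m.2.1 - 1)) • ContinuousLinearMap.fst ℝ ℝ ℝ) v := by
      exact (hasDerivAt_pow m.2.1 v.1).comp_hasFDerivAt v hasFDerivAt_fst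
    have h₂ : HasFDerivAt (fun v : ℝ × ℝ => v.2 ^ m.2.2.1)
        ((m.2.2.1 * v.2 ^ (m.2.2.1 - 1)) • ContinuousLinearMap.snd ℝ ℝ ℝ) v := by
      exact (hasDerivAt_pow m.2.2.1 v.2).comp_hasFDerivAt v hasFDerivAt_snd
    refine ((((h₁.mul h₂).mul_const (q ^ m.2.2.2)).const_mul (m.1 : ℝ)).add ih).congr_fderiv ?_
    ext <;> simp [dx, dy, eval_cons] <;> ring

lemma continuous_eval (p : Poly3) (q : ℝ) : Continuous fun v : ℝ × ℝ => eval p v.1 v.2 q :=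
  continuous_iff_continuousAt.2 fun v => (hasFDerivAt_eval p q v).continuousAt

lemma eval_neg_of_even {p : Poly3} (h : p.all (fun m => (m.2.1 + m.2.2.1) % 2 == 0) = true)
    (x y q : ℝ) : eval p (-x) (-y) q = eval p x y q := by
  simp only [List.all_eq_true, beq_iff_eq] at h
  rw [eval, spEval_map (mono (-x) (-y) q) (mono x y q) 1 id p, List.map_id, one_mul, eval]
  intro m hm
  have : Even (m.2.1 + m.2.2.1) := Nat.even_iff.2 (h m hm)
  simp only [mono, id, one_mul, neg_pow x, neg_pow y]
  rw [show (-1 : ℝ) ^ m.2.1 * x ^ m.2.1 * ((-1) ^ m.2.2.1 * y ^ m.2.2.1) * q ^ m.2.2.2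
    = (-1) ^ (m.2.1 + m.2.2.1) * (x ^ m.2.1 * y ^ m.2.2.1 * q ^ m.2.2.2) by ring,
    this.neg_one_pow, one_mul]

/-- The quotient by `q`. -/
def divQ (p : Poly3) : Poly3 := (spNorm p).map fun m => (m.1, m.2.1, m.2.2.1, m.2.2.2 - 1)

lemma eval_divQ {p : Poly3} (h : (spNorm p).all (fun m => Nat.ble 1 m.2.2.2) = true)
    (x y q : ℝ) : eval p x y q = q * eval p.divQ x y q := by
  simp only [List.all_eq_true, Nat.ble_eq] at h
  rw [eval, ← spEval_norm, spEval_map _ (mono x y q) q _ _, eval, divQ]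
  intro m hm
  obtain ⟨c, hc⟩ := Nat.exists_eq_add_of_le (h m hm)
  simp only [mono, hc, Nat.add_sub_cancel_left]
  ring

/-- The coefficients of the expansion of a polynomial of degree at most two in `q` in
`(1 - q)²`, `q (1 - q)`, `q²`. -/
def bern (w₀ w₁ w₂ : ℤ) (p : Poly3) : Poly2 := p.map fun m =>
  (m.1 * (match m.2.2.2 with
    | 0 => w₀
    | 1 => w₁
    | _ => w₂), m.2.1, m.2.2.1)

lemma eval_eq_bern {p : Poly3} (h : p.all (fun m => Nat.ble m.2.2.2 2) = true) (x y q : ℝ) :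
    eval p x y q = (1 - q) ^ 2 * spEval (mono2 x y) (p.bern 1 0 0)
      + q * (1 - q) * spEval (mono2 x y) (p.bern 2 1 0)
      + q ^ 2 * spEval (mono2 x y) (p.bern 1 1 1) := by
  induction p with
  | nil => simp [eval, bern, spEval]
  | cons m p ih =>
    obtain ⟨c, i, j, k⟩ := m
    rw [List.all_cons, Bool.and_eq_true, Nat.ble_eq] at h
    have ih := ih h.2
    simp only [bern] at ih
    simp only [eval_cons, bern, List.map_cons, spEval, ih, mono2]
    have hk : k ≤ 2 := h.1
    interval_cases k <;> (push_cast; ring)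

lemma pos_of_bern {p : Poly3} (h : p.all (fun m => Nat.ble m.2.2.2 2) = true) {x y q : ℝ}
    (hq₀ : 0 ≤ q) (hq₁ : q ≤ 1) (h₀ : 0 < spEval (mono2 x y) (p.bern 1 0 0))
    (h₁ : 0 < spEval (mono2 x y) (p.bern 2 1 0)) (h₂ : 0 < spEval (mono2 x y) (p.bern 1 1 1)) :
    0 < eval p x y q := by
  rw [eval_eq_bern h]
  have : 0 ≤ 1 - q := by linarith
  rcases hq₀.eq_or_lt with rfl | hq
  · simpa using h₀
  · positivity

/-- Positivity check on `([-1, 1]² ∖ {0}) × [0, 1]`. -/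
def checkA (T₁ T₂ T₃ T₄ T₅ T₆ : Cert) (f : Bool) (k : ℕ) (p : Poly3) : Bool :=
  let r : Poly3 := spNorm p
  r.all (fun m => Nat.ble m.2.2.2 2) && ((r.bern 1 0 0).checkA T₁ T₂ f k &&
    ((r.bern 2 1 0).checkA T₃ T₄ f k && (r.bern 1 1 1).checkA T₅ T₆ f k))

/-- Positivity check on `([-1, 1]² ∖ {0}) × [0, 1]`, with degeneration at `q = 0`. -/
def checkD (T₁ T₂ T₃ T₄ : Cert) (k h : ℕ) (S₁ S₂ S₃ S₄ : Cert) (k' : ℕ) (p : Poly3) : Bool :=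
  let r : Poly3 := spNorm p
  r.all (fun m => Nat.ble m.2.2.2 2) && ((r.bern 1 0 0).checkD T₁ T₂ T₃ T₄ k h &&
    ((r.bern 2 1 0).checkA S₁ S₂ false k' && (r.bern 1 1 1).checkA S₃ S₄ false k'))

variable {p : Poly3} {x y q : ℝ} {k h k' : ℕ} {f : Bool}
  {T₁ T₂ T₃ T₄ T₅ T₆ S₁ S₂ S₃ S₄ : Cert}

lemma pos_of_checkA (hp : p.checkA T₁ T₂ T₃ T₄ T₅ T₆ f k = true)
    (hx : |x| ≤ 1) (hy : |y| ≤ 1) (h₀ : x ≠ 0 ∨ y ≠ 0) (hf : f = true → |x| < 1 ∨ |y| < 1)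
    (hq₀ : 0 ≤ q) (hq₁ : q ≤ 1) : 0 < eval p x y q := by
  simp only [checkA, Bool.and_eq_true] at hp
  rw [eval, ← spEval_norm]
  exact pos_of_bern hp.1 hq₀ hq₁ (Poly2.pos_of_checkA hp.2.1 hx hy h₀ hf)
    (Poly2.pos_of_checkA hp.2.2.1 hx hy h₀ hf) (Poly2.pos_of_checkA hp.2.2.2 hx hy h₀ hf)

lemma pos_of_checkD (hp : p.checkD T₁ T₂ T₃ T₄ k h S₁ S₂ S₃ S₄ k' = true)
    (hx : |x| ≤ 1) (hy : |y| ≤ 1) (h₀ : x ≠ 0 ∨ y ≠ 0)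
    (hq₀ : 0 ≤ q) (hq₁ : q ≤ 1) : 0 < eval p x y q := by
  simp only [checkD, Bool.and_eq_true] at hp
  rw [eval, ← spEval_norm]
  exact pos_of_bern hp.1 hq₀ hq₁ (Poly2.pos_of_checkD hp.2.1 hx hy h₀)
    (Poly2.pos_of_checkA hp.2.2.1 hx hy h₀ (by simp))
    (Poly2.pos_of_checkA hp.2.2.2 hx hy h₀ (by simp))

end Poly3

/-- A homogeneous-type Dulac function `1 / V²` for `m ∈ [2/5, 3/5]`, in coordinates
scaled by `8/5`. -/
def midV : Poly3 :=
  [(31250000, 0, 4, 0), (1299200, 0, 8, 0), (1324800, 0, 8, 1), (-2560000, 0, 10, 0), (829440, 0,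
  12, 0), (-45000000, 1, 5, 0), (12732000, 1, 5, 1), (-6859776, 1, 9, 0), (4505600, 1, 11, 0),
  (39062500, 2, 0, 0), (3248000, 2, 4, 0), (-5888000, 2, 4, 1), (46000000, 2, 6, 0), (3110400, 2,
  8, 0), (-5242880, 2, 10, 0), (-31250000, 3, 1, 0), (2345000, 3, 1, 1), (-15070720, 3, 5, 0),
  (-42291200, 3, 7, 0), (2030000, 4, 0, 0), (-1840000, 4, 0, 1), (37500000, 4, 2, 0), (3888000, 4,
  4, 0), (40755200, 4, 6, 0), (-8120000, 5, 1, 0), (-41184000, 5, 3, 0), (1620000, 6, 0, 0),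
  (12256000, 6, 2, 0)]

def midF : Poly3 := [(200, 0, 3, 0), (-200, 3, 0, 0)]

def midG : Poly3 := [(192, 0, 5, 0), (-64, 0, 5, 1), (-125, 1, 0, 0)]

lemma midV_check :
    Poly3.checkA .leaf .leaf .leaf .leaf .leaf .leaf false 4 midV = true := by
  decide +kernel

lemma midM_check :
    Poly3.checkD (.swap (.split (.split .leaf .leaf) .leaf)) (.swap (.split .leaf .leaf)) .leaf
    .leaf 14 8 (.swap (.split .leaf (.swap (.split .leaf .leaf)))) (.swap (.split .leaf (.swap
    (.split .leaf .leaf)))) (.swap (.split (.swap (.split .leaf .leaf)) (.swap (.split .leaf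
    (.swap (.split .leaf .leaf)))))) (.swap (.split .leaf (.swap (.split .leaf (.swap (.split
    .leaf (.swap (.split .leaf .leaf)))))))) 8 (Poly3.divOp (-2) midV midF midG) = true := by
  decide +kernel

/-- A Dulac function for `m ∈ [3/5, 6]`, in coordinates scaled by `13/10`. -/
def bigB : Poly3 :=
  [(1000000000, 0, 0, 0), (784041700, 0, 4, 0), (439400000, 0, 6, 0), (549656445, 0, 8, 0),
  (557682086, 0, 10, 0), (-3900000000, 1, 1, 0), (-68796000, 1, 1, 1), (-5503972734, 1, 5, 0),
  (-2621328580, 1, 7, 0), (-10370584783, 1, 9, 0), (1206218000, 2, 0, 0), (10140000000, 2, 2, 0),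
  (1691250600, 2, 4, 0), (17099185090, 2, 6, 0), (51818393666, 2, 8, 0), (-7840417000, 3, 1, 0),
  (-22925255600, 3, 3, 0), (-26291257330, 3, 5, 0), (-124474121785, 3, 7, 0), (1300962000, 4, 0,
  0), (33908717700, 4, 2, 0), (77513982780, 4, 4, 0), (125410894024, 4, 6, 0), (-15785445000, 5,
  1, 0), (-102063019110, 5, 3, 0), (-42753646364, 5, 5, 0), (1734751200, 6, 0, 0), (17022927220,
  6, 2, 0), (-2710067607, 6, 4, 0), (44719671360, 7, 1, 0), (-19567141100, 8, 0, 0)]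

def bigF : Poly3 := [(1300, 0, 3, 0), (-1300, 3, 0, 0)]

def bigG : Poly3 := [(1014, 0, 5, 0), (9126, 0, 5, 1), (-1000, 1, 0, 0)]

lemma bigB_check :
    Poly3.checkD (.swap (.split (.swap (.split (.split (.split .leaf (.swap (.split (.swap (.split
    .leaf .leaf)) .leaf))) (.swap (.split .leaf (.split (.split .leaf .leaf) .leaf)))) (.swap
    (.split .leaf (.split (.swap (.split (.split (.split .leaf .leaf) .leaf) .leaf)) (.swap
    (.split .leaf .leaf))))))) (.split (.swap (.split .leaf (.swap (.split .leaf (.swap (.split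
    .leaf .leaf)))))) (.swap (.split .leaf (.split .leaf (.split (.swap (.split .leaf .leaf))
    (.swap (.split .leaf .leaf))))))))) (.split (.split .leaf (.swap (.split (.swap (.split (.swap
    (.split .leaf (.swap (.split .leaf (.split .leaf .leaf))))) (.swap (.split (.split .leaf
    .leaf) .leaf)))) (.split (.swap (.split .leaf .leaf)) .leaf)))) (.swap (.split (.split (.split
    (.split (.swap (.split (.split .leaf .leaf) .leaf)) (.swap (.split (.split (.swap (.split
    (.swap (.split .leaf (.swap (.split .leaf .leaf)))) .leaf)) (.swap (.split .leaf .leaf)))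
    .leaf))) .leaf) .leaf) (.split .leaf (.split (.swap (.split (.split .leaf .leaf) .leaf))
    (.swap (.split .leaf .leaf))))))) (.split .leaf (.split .leaf (.swap (.split .leaf (.split
    .leaf .leaf))))) (.split (.split (.split .leaf .leaf) .leaf) (.swap (.split .leaf .leaf))) 10
    6 (.swap (.split .leaf .leaf)) (.swap (.split (.swap (.split .leaf .leaf)) (.swap (.split
    .leaf (.swap (.split .leaf .leaf)))))) (.swap (.split .leaf (.swap (.split .leaf (.swap
    (.split .leaf .leaf)))))) (.swap (.split (.swap (.split .leaf .leaf)) (.swap (.split .leaf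
    (.swap (.split .leaf .leaf)))))) 4 (Poly3.divOp 1 bigB bigF bigG) = true := by
  decide +kernel

/-- A Lyapunov function for `m ∈ (0, 2/5]`. -/
def smallW : Poly3 :=
  [(256000000, 0, 4, 0), (390561000, 0, 8, 1), (-260796000, 0, 10, 1), (-976086000, 1, 5, 1),
  (262050606, 1, 5, 2), (-772893000, 1, 7, 1), (324096000, 1, 9, 1), (324096000, 2, 0, 1),
  (596286000, 2, 4, 1), (-308129841, 2, 4, 2), (2639610000, 2, 6, 1), (-781122000, 2, 8, 1),
  (-1581867000, 3, 1, 1), (668349252, 3, 1, 2), (-520326000, 3, 3, 1), (-2468067000, 3, 5, 1),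
  (777957000, 3, 7, 1), (517161000, 4, 0, 1), (-363424923, 4, 0, 2), (2481993000, 4, 2, 1),
  (-261429000, 4, 4, 1), (-1208397000, 5, 1, 1), (176607000, 5, 3, 1), (201294000, 6, 0, 1)]

def smallF : Poly3 := [(1000, 0, 3, 0), (-1000, 3, 0, 0)]

def smallG : Poly3 := [(633, 0, 5, 1), (-633, 1, 0, 1)]

lemma smallW_divQ : (spNorm ((smallW.lie smallF smallG).smul (-1))).all
    (fun m => Nat.ble 1 m.2.2.2) = true := by
  decide +kernel

lemma smallW_check :
    Poly3.checkA (.swap (.split .leaf (.split .leaf .leaf))) .leaf (.swap (.split .leaf .leaf))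
    (.swap (.split .leaf (.swap (.split .leaf (.swap (.split .leaf .leaf)))))) (.swap (.split
    (.swap (.split .leaf (.swap (.split .leaf (.swap (.split .leaf .leaf)))))) (.swap (.split
    .leaf (.split .leaf .leaf))))) (.swap (.split (.swap (.split .leaf .leaf)) (.swap (.split
    .leaf (.swap (.split .leaf .leaf)))))) true 8 ((smallW.lie smallF smallG).smul (-1)).divQ =
    true := by
  decide +kernel

/-- A Lyapunov function for `m ≥ 6`. -/
def largeW : Poly3 :=
  [(656, 0, 4, 1), (-656, 1, 5, 1), (3200, 2, 0, 0), (1968, 2, 4, 1), (-6232, 3, 1, 1), (-4059, 3,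
  3, 1), (1886, 4, 0, 1), (4674, 4, 2, 1)]

def largeF : Poly3 := [(41, 0, 3, 1), (-41, 3, 0, 1)]

def largeG : Poly3 := [(100, 0, 5, 0), (-100, 1, 0, 0)]

lemma largeW_divQ : (spNorm (largeW.lie largeF largeG)).all
    (fun m => Nat.ble 1 m.2.2.2) = true := by
  decide +kernel

lemma largeW_check :
    Poly3.checkA (.swap (.split .leaf .leaf)) (.swap (.split .leaf .leaf)) (.swap (.split .leaf
    .leaf)) (.swap (.split .leaf .leaf)) (.swap (.split .leaf (.split .leaf .leaf))) (.swap
    (.split .leaf .leaf)) true 8 (largeW.lie largeF largeG).divQ = true := by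
  decide +kernel

/-- The angular speed, up to sign. -/
def angN : Poly3 :=
  [(2, 0, 4, 0), (6, 0, 4, 1), (-5, 1, 5, 0), (5, 2, 0, 0), (-2, 3, 1, 0), (-6, 3, 1, 1)]

lemma angN_check :
    Poly3.checkA (.swap (.split .leaf .leaf)) (.swap (.split .leaf .leaf)) (.swap (.split .leaf
    .leaf)) (.swap (.split .leaf .leaf)) (.swap (.split .leaf .leaf)) (.swap (.split .leaf .leaf))
    true 4 angN = true := by
  decide +kernel

/-- The normal form of the field, with saddles at `±(1, 1)`. -/
def normalField (l : ℝ) (z : ℝ × ℝ) : ℝ × ℝ := (l * (z.2 ^ 3 - z.1 ^ 3), z.2 ^ 5 - z.1)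

def normalDiv (l : ℝ) (z : ℝ × ℝ) : ℝ := -3 * l * z.1 ^ 2 + 5 * z.2 ^ 4

/-- The closed square `[-1, 1]²` without its centre. -/
def puncturedSquare : Set (ℝ × ℝ) := {z | |z.1| ≤ 1 ∧ |z.2| ≤ 1 ∧ z ≠ 0}

/-- An even continuously differentiable function. -/
structure EvenC1 where
  toFun : ℝ × ℝ → ℝ
  deriv : ℝ × ℝ → ℝ × ℝ →L[ℝ] ℝ
  hasFDerivAt : ∀ z, HasFDerivAt toFun (deriv z) z
  continuous_deriv : Continuous deriv
  neg : ∀ z, toFun (-z) = toFun z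

/-- A polynomial in scaled coordinates. -/
def Poly3.toEvenC1 (p : Poly3) (h : p.all (fun m => (m.2.1 + m.2.2.1) % 2 == 0) = true)
    (s q : ℝ) : EvenC1 where
  toFun z := p.eval (s * z.1) (s * z.2) q
  deriv z := s • (p.dx.eval (s * z.1) (s * z.2) q • ContinuousLinearMap.fst ℝ ℝ ℝ
    + p.dy.eval (s * z.1) (s * z.2) q • ContinuousLinearMap.snd ℝ ℝ ℝ)
  hasFDerivAt z := by
    have h₁ : HasFDerivAt (fun z : ℝ × ℝ => s • z) (s • ContinuousLinearMap.id ℝ (ℝ × ℝ)) z :=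
      (hasFDerivAt_id z).const_smul s
    refine ((Poly3.hasFDerivAt_eval p q (s • z)).comp z h₁).congr_fderiv ?_
    ext <;> simp [mul_comm]
  continuous_deriv := by
    have h : ∀ r : Poly3, Continuous fun z : ℝ × ℝ => r.eval (s * z.1) (s * z.2) q := fun r =>
      (Poly3.continuous_eval r q).comp (continuous_const_smul (T := ℝ × ℝ) s)
    exact (((h _).smul continuous_const).add ((h _).smul continuous_const)).const_smul s
  neg z := by
    have := Poly3.eval_neg_of_even h (s * z.1) (s * z.2) q
    simpa using this

section
variable {l s q D : ℝ} {p F G : Poly3} {z : ℝ × ℝ}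
  {hp : p.all (fun m => (m.2.1 + m.2.2.1) % 2 == 0) = true}

lemma deriv_toEvenC1 (hF : F.eval (s * z.1) (s * z.2) q = D * s * (normalField l z).1)
    (hG : G.eval (s * z.1) (s * z.2) q = D * s * (normalField l z).2) :
    D * (p.toEvenC1 hp s q).deriv z (normalField l z)
      = (p.lie F G).eval (s * z.1) (s * z.2) q := by
  rw [Poly3.eval_lie, hF, hG]
  simp [Poly3.toEvenC1]
  ring

lemma divOp_toEvenC1 (a : ℤ) (hF : F.eval (s * z.1) (s * z.2) q = D * s * (normalField l z).1)
    (hG : G.eval (s * z.1) (s * z.2) q = D * s * (normalField l z).2)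
    (h : F.dx.eval (s * z.1) (s * z.2) q + G.dy.eval (s * z.1) (s * z.2) q = D * normalDiv l z) :
    D * ((p.toEvenC1 hp s q).toFun z * normalDiv l z
      + a * (p.toEvenC1 hp s q).deriv z (normalField l z))
      = (p.divOp a F G).eval (s * z.1) (s * z.2) q := by
  rw [Poly3.eval_divOp, ← deriv_toEvenC1 (hp := hp) hF hG, h]
  simp only [Poly3.toEvenC1]
  ring

lemma abs_mul_le_one (hs₀ : 0 ≤ s) (hs₁ : s ≤ 1) {x : ℝ} (hx : |x| ≤ 1) : |s * x| ≤ 1 := by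
  rw [abs_mul, abs_of_nonneg hs₀]
  exact mul_le_one₀ hs₁ (abs_nonneg _) hx

lemma fst_ne_or_snd_ne (hz : z ≠ 0) : z.1 ≠ 0 ∨ z.2 ≠ 0 := by
  by_contra! h
  exact hz (Prod.ext h.1 h.2)

lemma mul_ne_or_mul_ne (hs : 0 < s) (hz : z ≠ 0) : s * z.1 ≠ 0 ∨ s * z.2 ≠ 0 :=
  (fst_ne_or_snd_ne hz).imp (mul_ne_zero hs.ne') (mul_ne_zero hs.ne')

end

lemma exists_dulac_sq {l m : ℝ} (hl : 0 < l) (hlm : l ^ 2 * m = 1) (h₀ : 0.4 ≤ m)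
    (h₁ : m ≤ 0.6) : ∃ V : EvenC1, ∀ z ∈ puncturedSquare, 0 < V.toFun z ∧
      0 < V.toFun z * normalDiv l z - 2 * V.deriv z (normalField l z) := by
  obtain ⟨s, hs₀, hs⟩ : ∃ s : ℝ, 0 < s ∧ s ^ 2 = 5 / 8 * l :=
    ⟨√(5 / 8 * l), by positivity, Real.sq_sqrt (by positivity)⟩
  have hs4 : s ^ 4 * (320 * m) = 125 := by
    rw [show s ^ 4 = (s ^ 2) ^ 2 by ring, hs]; linear_combination 125 * hlm
  have hs₁ : s ≤ 1 := by
    by_contra! h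
    have : 1 < s ^ 4 := one_lt_pow₀ h (by norm_num)
    nlinarith
  have hp : midV.all (fun m => (m.2.1 + m.2.2.1) % 2 == 0) = true := by decide +kernel
  refine ⟨midV.toEvenC1 hp s (3 - 5 * m), fun z ⟨hx, hy, hz⟩ => ⟨?_, ?_⟩⟩
  · exact Poly3.pos_of_checkA midV_check (abs_mul_le_one hs₀.le hs₁ hx)
      (abs_mul_le_one hs₀.le hs₁ hy) (mul_ne_or_mul_ne hs₀ hz) (by simp) (by linarith)
      (by linarith)
  · have key := Poly3.pos_of_checkD midM_check (abs_mul_le_one hs₀.le hs₁ hx)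
      (abs_mul_le_one hs₀.le hs₁ hy) (mul_ne_or_mul_ne hs₀ hz) (q := 3 - 5 * m) (by linarith)
      (by linarith)
    rw [← divOp_toEvenC1 (l := l) (D := 125) (hp := hp)] at key
    · push_cast at key
      linarith
    · simp only [midF, Poly3.eval_cons, Poly3.eval_nil, normalField]
      push_cast
      linear_combination 200 * s * (z.2 ^ 3 - z.1 ^ 3) * hs
    · simp only [midG, Poly3.eval_cons, Poly3.eval_nil, normalField]
      push_cast
      linear_combination s * z.2 ^ 5 * hs4
    · simp only [midF, midG, Poly3.dx, Poly3.dy, List.map, Poly3.eval_cons, Poly3.eval_nil,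
        normalDiv]
      push_cast
      linear_combination 5 * z.2 ^ 4 * hs4 - 600 * z.1 ^ 2 * hs

lemma exists_dulac {l m : ℝ} (hl : 0 < l) (hlm : l ^ 2 * m = 1) (h₀ : 0.6 ≤ m)
    (h₁ : m ≤ 6) : ∃ B : EvenC1, ∀ z ∈ puncturedSquare,
      0 < B.toFun z * normalDiv l z + B.deriv z (normalField l z) := by
  obtain ⟨s, hs₀, hs⟩ : ∃ s : ℝ, 0 < s ∧ s ^ 2 = 10 / 13 * l :=
    ⟨√(10 / 13 * l), by positivity, Real.sq_sqrt (by positivity)⟩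
  have hs4 : s ^ 4 * (1690 * m) = 1000 := by
    rw [show s ^ 4 = (s ^ 2) ^ 2 by ring, hs]; linear_combination 1000 * hlm
  have hs₁ : s ≤ 1 := by
    by_contra! h
    have : 1 < s ^ 4 := one_lt_pow₀ h (by norm_num)
    nlinarith
  have hp : bigB.all (fun m => (m.2.1 + m.2.2.1) % 2 == 0) = true := by decide +kernel
  refine ⟨bigB.toEvenC1 hp s ((5 * m - 3) / 27), fun z ⟨hx, hy, hz⟩ => ?_⟩
  have key := Poly3.pos_of_checkD bigB_check (abs_mul_le_one hs₀.le hs₁ hx)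
    (abs_mul_le_one hs₀.le hs₁ hy) (mul_ne_or_mul_ne hs₀ hz) (q := (5 * m - 3) / 27)
    (by linarith) (by linarith)
  rw [← divOp_toEvenC1 (l := l) (D := 1000) (hp := hp)] at key
  · push_cast at key
    linarith
  · simp only [bigF, Poly3.eval_cons, Poly3.eval_nil, normalField]
    push_cast
    linear_combination 1300 * s * (z.2 ^ 3 - z.1 ^ 3) * hs
  · simp only [bigG, Poly3.eval_cons, Poly3.eval_nil, normalField]
    push_cast
    linear_combination s * z.2 ^ 5 * hs4
  · simp only [bigF, bigG, Poly3.dx, Poly3.dy, List.map, Poly3.eval_cons, Poly3.eval_nil,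
      normalDiv]
    push_cast
    linear_combination 5 * z.2 ^ 4 * hs4 - 3900 * z.1 ^ 2 * hs

lemma exists_lyapunov_of_ge {l : ℝ} (hl : 1.58 ≤ l) : ∃ W : EvenC1, ∀ z : ℝ × ℝ,
    |z.1| < 1 → |z.2| < 1 → z ≠ 0 → W.deriv z (normalField l z) < 0 := by
  have hp : smallW.all (fun m => (m.2.1 + m.2.2.1) % 2 == 0) = true := by decide +kernel
  have hl₀ : 0 < l := by linarith
  have hq₀ : 0 < 1000 / 633 / l := by positivity
  refine ⟨smallW.toEvenC1 hp 1 (1000 / 633 / l), fun z hx hy hz => ?_⟩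
  have key := Poly3.pos_of_checkA smallW_check hx.le hy.le (fst_ne_or_snd_ne hz)
    (fun _ => Or.inl hx) hq₀.le (by rw [div_le_one hl₀]; linarith)
  have e := Poly3.eval_divQ smallW_divQ z.1 z.2 (1000 / 633 / l)
  rw [Poly3.eval_smul] at e
  have d := deriv_toEvenC1 (p := smallW) (F := smallF) (G := smallG) (l := l) (D := 1000 / l)
    (s := 1) (q := 1000 / 633 / l) (z := z) (hp := hp) (by
      simp only [smallF, one_mul, Poly3.eval_cons, Poly3.eval_nil, normalField]
      push_cast
      field_simp
      ring) (by
      simp only [smallG, one_mul, Poly3.eval_cons, Poly3.eval_nil, normalField]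
      push_cast
      field_simp
      ring)
  simp only [one_mul] at d
  rw [← d] at e
  have h := mul_pos hq₀ key
  rw [← e] at h
  push_cast at h
  have hD : 0 < 1000 / l := by positivity
  by_contra! hc
  have := mul_nonneg hD.le hc
  linarith

lemma exists_lyapunov_of_le {l : ℝ} (hl₀ : 0 < l) (hl : l ≤ 0.41) : ∃ W : EvenC1,
    ∀ z : ℝ × ℝ, |z.1| < 1 → |z.2| < 1 → z ≠ 0 → 0 < W.deriv z (normalField l z) := by
  have hp : largeW.all (fun m => (m.2.1 + m.2.2.1) % 2 == 0) = true := by decide +kernel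
  have hq₀ : 0 < 100 / 41 * l := by positivity
  refine ⟨largeW.toEvenC1 hp 1 (100 / 41 * l), fun z hx hy hz => ?_⟩
  have key := Poly3.pos_of_checkA largeW_check hx.le hy.le (fst_ne_or_snd_ne hz)
    (fun _ => Or.inl hx) hq₀.le (by linarith)
  have e := Poly3.eval_divQ largeW_divQ z.1 z.2 (100 / 41 * l)
  have d := deriv_toEvenC1 (p := largeW) (F := largeF) (G := largeG) (l := l) (D := 100)
    (s := 1) (q := 100 / 41 * l) (z := z) (hp := hp) (by
      simp only [largeF, one_mul, Poly3.eval_cons, Poly3.eval_nil, normalField]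
      push_cast
      ring) (by
      simp only [largeG, one_mul, Poly3.eval_cons, Poly3.eval_nil, normalField]
      push_cast
      ring)
  simp only [one_mul] at d
  rw [← d] at e
  have h := mul_pos hq₀ key
  rw [← e] at h
  linarith

/-- The planar determinant. -/
def det2 (v w : ℝ × ℝ) : ℝ := v.1 * w.2 - v.2 * w.1

lemma det2_normalField_neg {l : ℝ} (hl₀ : 0.4 ≤ l) (hl₁ : l ≤ 1.6) {z : ℝ × ℝ}
    (hx : |z.1| < 1) (hy : |z.2| < 1) (hz : z ≠ 0) : det2 z (normalField l z) < 0 := by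
  have key := Poly3.pos_of_checkA angN_check hx.le hy.le (fst_ne_or_snd_ne hz)
    (fun _ => Or.inl hx) (q := (5 * l - 2) / 6) (by linarith) (by linarith)
  simp only [angN, Poly3.eval_cons, Poly3.eval_nil] at key
  push_cast at key
  simp only [det2, normalField]
  linarith

/-- The first coordinate, times 20000, of a curve joining the saddles. -/
def barX : Poly3 :=
  [(-7791, 0, 0, 0), (5644, 0, 1, 0), (4436, 0, 2, 0), (11467, 0, 3, 0), (4097, 0, 4, 0), (6689,
  0, 5, 0), (-2436, 0, 6, 0), (-3800, 0, 7, 0), (1694, 0, 8, 0)]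

/-- The second coordinate, times 20000, of a curve joining the saddles. -/
def barY : Poly3 :=
  [(7791, 0, 0, 0), (14356, 0, 1, 0), (-4436, 0, 2, 0), (8533, 0, 3, 0), (-4097, 0, 4, 0),
  (-6689, 0, 5, 0), (2436, 0, 6, 0), (3800, 0, 7, 0), (-1694, 0, 8, 0)]

/-- The quotient of `barY - barX` by `2 (1 - u²)`. -/
def barGap : Poly3 :=
  [(7791, 0, 0, 0), (4356, 0, 1, 0), (3355, 0, 2, 0), (2889, 0, 3, 0), (-742, 0, 4, 0), (-3800,
  0, 5, 0), (1694, 0, 6, 0)]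

/-- The quotient of the crossing determinant of the curve by `1 - u²`. -/
def barCross : Poly3 :=
  [(18188278895249894024569500, 0, 0, 0), (8579443597172311843151000, 0, 1, 0),
  (-371922289768564755205134375, 0, 2, 0), (36457243858245613803057500, 0, 3, 0),
  (2528423248637344289710401250, 0, 4, 0), (-2056413450027570085491806625, 0, 5, 0),
  (1623211470461040528307402875, 0, 6, 0), (1013258141436757024620444875, 0, 7, 0),
  (-16549303372811680626817583750, 0, 8, 0), (9282537686805721733146935500, 0, 9, 0),
  (5436138739673625064300022500, 0, 10, 0), (-5388415786060742185580116750, 0, 11, 0),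
  (15155023812617689023277280500, 0, 12, 0), (-1671870358606999294716414500, 0, 13, 0),
  (-5768890034571621976320850125, 0, 14, 0), (-7306607747952523938754645500, 0, 15, 0),
  (9540887525389121870693754750, 0, 16, 0), (-922929786081170427824179375, 0, 17, 0),
  (-4392343567542147323562445750, 0, 18, 0), (7983008265307793231549823125, 0, 19, 0),
  (1010961541731038415114401250, 0, 20, 0), (-13427995771846572295092925125, 0, 21, 0),
  (8104654661473538361354367000, 0, 22, 0), (3181759989293299268474194375, 0, 23, 0),
  (-7462211953311836774583933000, 0, 24, 0), (4984390035988143514402186125, 0, 25, 0),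
  (2572950947130766893198298625, 0, 26, 0), (-6141271789194776292158391625, 0, 27, 0),
  (1888281852090559062852574500, 0, 28, 0), (2167275680510479145931944000, 0, 29, 0),
  (-2088413047404987624304282750, 0, 30, 0), (400689812574965648595000000, 0, 31, 0),
  (940063190854608934737685000, 0, 32, 0), (-980970763832873730323161000, 0, 33, 0),
  (10722534955316530083080000, 0, 34, 0), (491402943879755551183236000, 0, 35, 0),
  (-173083553464263550915850000, 0, 36, 0), (-134502895597355542795978000, 0, 37, 0),
  (98248327485526615747070000, 0, 38, 0), (5981695089764861737102000, 0, 39, 0),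
  (-22517582082129416724288000, 0, 40, 0), (4409641182811973919888000, 0, 41, 0),
  (2644055358866386432660000, 0, 42, 0), (-1537577334880144137888000, 0, 43, 0),
  (311428602940178600800000, 0, 44, 0), (-23630909445942331456000, 0, 45, 0)]

def Poly3.nmul (p r : Poly3) : Poly3 := spNorm (p.mul r)

def Poly3.npow (p : Poly3) : ℕ → Poly3
  | 0 => [(1, 0, 0, 0)]
  | n + 1 => p.nmul (p.npow n)

def Poly3.sub (p r : Poly3) : Poly3 := p ++ r.smul (-1)

/-- Positivity check for a polynomial in `y ∈ [-1, 1]`. -/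
def Poly3.segCheck (T : Cert) (p : Poly3) : Bool :=
  p.all (fun m => m.2.2.2 == 0) &&
    Poly2.boxCheck (.swap T) false 1 (spNorm (p.map fun m => (m.1, m.2.1, m.2.2.1)))

namespace Poly3
variable (x y q : ℝ)

lemma eval_nmul (p r : Poly3) : eval (p.nmul r) x y q = eval p x y q * eval r x y q := by
  rw [← eval_mul, nmul, eval, spEval_norm]; rfl

lemma eval_npow (p : Poly3) (n : ℕ) : eval (p.npow n) x y q = eval p x y q ^ n := by
  induction n with
  | zero => simp [npow, eval_cons, eval_nil]
  | succ n ih => rw [npow, eval_nmul, ih, pow_succ']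

lemma eval_sub (p r : Poly3) : eval (p.sub r) x y q = eval p x y q - eval r x y q := by
  rw [sub, eval_append, eval_smul]; push_cast; ring

lemma eq_zero_of_norm {p : Poly3} (h : (spNorm p).isEmpty = true) : eval p x y q = 0 := by
  rw [eval, ← spEval_norm, List.isEmpty_iff.1 h]; rfl

variable {y}

lemma pos_of_segCheck {T : Cert} {p : Poly3} (h : p.segCheck T = true) (hy₀ : -1 ≤ y)
    (hy₁ : y ≤ 1) : 0 < eval p 0 y 0 := by
  simp only [segCheck, Bool.and_eq_true, List.all_eq_true, beq_iff_eq] at h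
  have := Poly2.pos_of_boxCheck h.2 le_rfl zero_le_one (by simpa using hy₀) hy₁ (by simp)
  rw [spEval_norm] at this
  rw [eval, spEval_map _ (mono2 0 y) 1 (fun m => (m.1, m.2.1, m.2.2.1)) p, one_mul]
  · exact this
  · intro m hm
    simp [mono, mono2, h.1 m hm]

end Poly3

lemma barCross_eq : (spNorm (Poly3.sub
    (Poly3.sub (((barY.npow 3).sub (barX.npow 3)).nmul barY.dy |>.smul 67600000000)
      (((barY.npow 5).sub (barX.smul 160000000000000000)).nmul barX.dy |>.smul 125))
    (Poly3.mul [(1, 0, 0, 0), (-1, 0, 2, 0)] barCross))).isEmpty = true := by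
  decide +kernel

lemma barGap_eq : (spNorm (Poly3.sub (barY.sub barX)
    (Poly3.mul [(2, 0, 0, 0), (-2, 0, 2, 0)] barGap))).isEmpty = true := by
  decide +kernel

lemma barSum_eq : (spNorm (Poly3.sub (barY ++ barX) [(20000, 0, 1, 0), (20000, 0, 3, 0)])).isEmpty
    = true := by
  decide +kernel

lemma barCross_check : barCross.segCheck (.split (.split (.split .leaf .leaf) .leaf)
    (.split .leaf (.split .leaf .leaf))) = true := by
  decide +kernel

lemma barTurn_check : ((barY.nmul barX.dy).sub (barX.nmul barY.dy)).segCheck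
    (.split .leaf .leaf) = true := by
  decide +kernel

lemma barY_check : barY.dy.segCheck (.split .leaf .leaf) = true := by
  decide +kernel

lemma barX_check : (Poly3.sub [(20000, 0, 0, 0), (-10000, 0, 1, 0), (10000, 0, 2, 0)]
    (Poly3.nmul [(1, 0, 0, 0), (-1, 0, 1, 0)] barGap)).segCheck .leaf = true := by
  decide +kernel

lemma barGap_check : barGap.segCheck .leaf = true := by
  decide +kernel

lemma hasDerivAt_fst {c : ℝ → ℝ × ℝ} {c' : ℝ × ℝ} {t : ℝ} (h : HasDerivAt c c' t) :
    HasDerivAt (fun t => (c t).1) c'.1 t :=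
  (ContinuousLinearMap.fst ℝ ℝ ℝ).hasFDerivAt.comp_hasDerivAt t h

lemma hasDerivAt_snd {c : ℝ → ℝ × ℝ} {c' : ℝ × ℝ} {t : ℝ} (h : HasDerivAt c c' t) :
    HasDerivAt (fun t => (c t).2) c'.2 t :=
  (ContinuousLinearMap.snd ℝ ℝ ℝ).hasFDerivAt.comp_hasDerivAt t h

/-- A curve joining the saddles. -/
def barrier (u : ℝ) : ℝ × ℝ := (barX.eval 0 u 0 / 20000, barY.eval 0 u 0 / 20000)

def barrier' (u : ℝ) : ℝ × ℝ := (barX.dy.eval 0 u 0 / 20000, barY.dy.eval 0 u 0 / 20000)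

lemma hasDerivAt_barrier (u : ℝ) : HasDerivAt barrier (barrier' u) u := by
  have h : ∀ p : Poly3, HasDerivAt (fun u => p.eval 0 u 0) (p.dy.eval 0 u 0) u := by
    intro p
    have := (Poly3.hasFDerivAt_eval p 0 (0, u)).comp_hasDerivAt u
      ((hasDerivAt_const u (0 : ℝ)).prodMk (hasDerivAt_id u))
    simpa [Function.comp_def] using this
  exact ((h barX).div_const _).prodMk ((h barY).div_const _)

lemma continuous_barrier' : Continuous barrier' := by
  have h : ∀ p : Poly3, Continuous fun u : ℝ => p.eval 0 u 0 := fun p =>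
    (Poly3.continuous_eval p 0).comp (continuous_const.prodMk continuous_id)
  exact ((h _).div_const _).prodMk ((h _).div_const _)

lemma barrier_sub (u : ℝ) : (barrier u).2 - (barrier u).1
    = (1 - u ^ 2) * barGap.eval 0 u 0 / 10000 := by
  have h := Poly3.eq_zero_of_norm 0 u 0 barGap_eq
  rw [Poly3.eval_sub, Poly3.eval_sub, Poly3.eval_mul, Poly3.eval_cons _ _ _ (2, _),
    Poly3.eval_cons _ _ _ (-2, _), Poly3.eval_nil] at h
  simp only [barrier]
  push_cast at h
  linarith

lemma barrier_add (u : ℝ) : (barrier u).1 + (barrier u).2 = u + u ^ 3 := by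
  have h := Poly3.eq_zero_of_norm 0 u 0 barSum_eq
  rw [Poly3.eval_sub, Poly3.eval_append] at h
  simp only [barrier]
  rw [Poly3.eval_cons, Poly3.eval_cons, Poly3.eval_nil] at h
  push_cast at h
  linarith

lemma barrier_one : barrier 1 = (1, 1) := by
  have h₁ := barrier_sub 1
  have h₂ := barrier_add 1
  ext <;> simp <;> linarith

lemma barrier_neg_one : barrier (-1) = (-1, -1) := by
  have h₁ := barrier_sub (-1)
  have h₂ := barrier_add (-1)
  ext <;> simp <;> linarith

lemma barrier_ne_zero (u : ℝ) : barrier u ≠ 0 := by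
  intro h
  have h₁ := barrier_sub u
  have h₂ := barrier_add u
  rw [h] at h₁ h₂
  have hu : u = 0 := by
    have : u * (1 + u ^ 2) = 0 := by simp at h₂; linarith
    rcases mul_eq_zero.1 this with h | h
    · exact h
    · nlinarith
  have := Poly3.pos_of_segCheck barGap_check (y := u) (by linarith) (by linarith)
  rw [hu] at h₁ this
  simp at h₁
  linarith

section
variable {u : ℝ}

lemma barrier_mem_puncturedSquare (h₀ : -1 ≤ u) (h₁ : u ≤ 1) : barrier u ∈ puncturedSquare := by
  have hmono : MonotoneOn (fun u => (barrier u).2) (Icc (-1) 1) := by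
    refine monotoneOn_of_hasDerivWithinAt_nonneg (f' := fun u => (barrier' u).2)
      (convex_Icc _ _) ?_ ?_ ?_
    · exact fun u _ => (hasDerivAt_snd (hasDerivAt_barrier u)).continuousAt.continuousWithinAt
    · exact fun u _ => (hasDerivAt_snd (hasDerivAt_barrier u)).hasDerivWithinAt
    · intro u hu
      rw [interior_Icc] at hu
      have := Poly3.pos_of_segCheck barY_check hu.1.le hu.2.le
      simp only [barrier']
      positivity
  have hy₀ := hmono (left_mem_Icc.2 (by norm_num)) ⟨h₀, h₁⟩ h₀
  have hy₁ := hmono ⟨h₀, h₁⟩ (right_mem_Icc.2 (by norm_num)) h₁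
  have hG := Poly3.pos_of_segCheck barGap_check h₀ h₁
  have hX := Poly3.pos_of_segCheck barX_check h₀ h₁
  rw [Poly3.eval_sub, Poly3.eval_nmul, Poly3.eval_cons, Poly3.eval_cons, Poly3.eval_cons,
    Poly3.eval_cons, Poly3.eval_cons, Poly3.eval_nil] at hX
  have hs := barrier_sub u
  have ha := barrier_add u
  simp only [barrier_one, barrier_neg_one] at hy₀ hy₁
  push_cast at hX
  refine ⟨abs_le.2 ⟨?_, ?_⟩, abs_le.2 ⟨hy₀, hy₁⟩, barrier_ne_zero u⟩
  · nlinarith [mul_nonneg (by linarith : 0 ≤ 1 + u) hX.le]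
  · nlinarith [mul_nonneg (by nlinarith : 0 ≤ 1 - u ^ 2) hG.le]

lemma det2_barrier_neg (h₀ : -1 ≤ u) (h₁ : u ≤ 1) : det2 (barrier u) (barrier' u) < 0 := by
  have := Poly3.pos_of_segCheck barTurn_check h₀ h₁
  rw [Poly3.eval_sub, Poly3.eval_nmul, Poly3.eval_nmul] at this
  simp only [det2, barrier, barrier']
  linarith

lemma det2_normalField_barrier_pos {l : ℝ} (hl : 1.352 ≤ l) (h₀ : -1 < u) (h₁ : u < 1) :
    0 < det2 (normalField l (barrier u)) (barrier' u) := by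
  have hu : 0 < 1 - u ^ 2 := by nlinarith
  have h := Poly3.eq_zero_of_norm 0 u 0 barCross_eq
  rw [Poly3.eval_sub, Poly3.eval_mul, Poly3.eval_sub, Poly3.eval_smul, Poly3.eval_smul,
    Poly3.eval_nmul, Poly3.eval_nmul, Poly3.eval_sub, Poly3.eval_sub, Poly3.eval_smul,
    Poly3.eval_npow, Poly3.eval_npow, Poly3.eval_npow, Poly3.eval_cons _ _ _ (1, _),
    Poly3.eval_cons _ _ _ (-1, _), Poly3.eval_nil] at h
  have hC := mul_pos hu (Poly3.pos_of_segCheck barCross_check h₀.le h₁.le)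
  have hY := Poly3.pos_of_segCheck barY_check h₀.le h₁.le
  have hG := mul_pos hu (Poly3.pos_of_segCheck barGap_check h₀.le h₁.le)
  have hs := barrier_sub u
  simp only [barrier] at hs
  simp only [det2, normalField, barrier, barrier']
  push_cast at h
  generalize barX.eval 0 u 0 = X at *
  generalize barY.eval 0 u 0 = Y at *
  generalize barX.dy.eval 0 u 0 = X' at *
  generalize barY.dy.eval 0 u 0 = Y' at *
  generalize barCross.eval 0 u 0 = C at *
  have hXY : X < Y := by linarith
  have hcube : 0 ≤ Y ^ 3 - X ^ 3 := by
    have : 0 ≤ Y ^ 2 + X * Y + X ^ 2 := by nlinarith [sq_nonneg (X + Y), sq_nonneg X, sq_nonneg Y]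
    have := mul_nonneg (sub_nonneg.2 hXY.le) this
    linarith
  have hl' : 0 ≤ (l - 1.352) * ((Y ^ 3 - X ^ 3) * Y') :=
    mul_nonneg (by linarith) (mul_nonneg hcube hY.le)
  have e : (l * ((Y / 20000) ^ 3 - (X / 20000) ^ 3) * (Y' / 20000)
      - ((Y / 20000) ^ 5 - X / 20000) * (X' / 20000))
      = (l - 1.352) * ((Y ^ 3 - X ^ 3) * Y') / 20000 ^ 4
        + (1 - u ^ 2) * C / (125 * 20000 ^ 6) := by
    linear_combination h / (125 * 20000 ^ 6)
  rw [e]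
  positivity

end

/-- A global solution of the autonomous equation of the field `Z`. -/
def Solves (Z : ℝ × ℝ → ℝ × ℝ) (f : ℝ → ℝ × ℝ) : Prop := ∀ t, HasDerivAt f (Z (f t)) t

namespace Solves
variable {Z : ℝ × ℝ → ℝ × ℝ} {f g : ℝ → ℝ × ℝ}

lemma continuous (hf : Solves Z f) : Continuous f :=
  continuous_iff_continuousAt.2 fun t => (hf t).continuousAt

lemma comp_add_const (hf : Solves Z f) (s : ℝ) : Solves Z fun t => f (t + s) :=
  fun t => (hf (t + s)).comp_add_const t s

lemma neg (hf : Solves Z f) (hZ : ∀ z, Z (-z) = -Z z) : Solves Z (-f) := fun t => by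
  rw [Pi.neg_apply, hZ]; exact (hf t).neg

lemma eq_of_eq_at (hf : Solves Z f) (hg : Solves Z g) (hZ : ∀ t, ContDiffAt ℝ 1 Z (f t))
    {t₀ : ℝ} (h : f t₀ = g t₀) : f = g := by
  have hcl : IsClopen {t | f t = g t} := by
    refine ⟨isClosed_eq hf.continuous hg.continuous, isOpen_iff_mem_nhds.2 fun t ht => ?_⟩
    obtain ⟨K, s, hs, hK⟩ := (hZ t).exists_lipschitzOnWith
    refine ODE_solution_unique_of_eventually (v := fun _ => Z) (s := fun _ => s)
      (Eventually.of_forall fun _ => hK)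
      ((hf.continuous.continuousAt.eventually_mem hs).mono fun u hu => ⟨hf u, hu⟩)
      ((hg.continuous.continuousAt.eventually_mem ?_).mono fun u hu => ⟨hg u, hu⟩) ht
    rwa [← show f t = g t from ht]
  exact funext fun t => eq_univ_iff_forall.1 (hcl.eq_univ ⟨t₀, h⟩) t

end Solves

section
variable {l : ℝ} {f : ℝ → ℝ × ℝ}

lemma contDiff_normalField : ContDiff ℝ 1 (normalField l) := by
  unfold normalField; fun_prop

lemma normalField_neg (z : ℝ × ℝ) : normalField l (-z) = -normalField l z := by
  ext <;> simp [normalField] <;> ring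

lemma Solves.const_of_zero (hf : Solves (normalField l) f) {t₀ : ℝ}
    (h : normalField l (f t₀) = 0) (t : ℝ) : f t = f t₀ := by
  have hg : Solves (normalField l) fun _ => f t₀ := fun t => by
    rw [h]; exact hasDerivAt_const _ _
  exact congrFun (hf.eq_of_eq_at hg (fun t => contDiff_normalField.contDiffAt) rfl) t

/-- A continuous function exceeding all of its limits at infinity has a maximum. -/
def MaxOrLe (f : ℝ → ℝ) : Prop := (∃ t, ∀ s, f s ≤ f t) ∨ ∀ s, f s ≤ 1

lemma MaxOrLe.of_periodic {f : ℝ → ℝ} (hc : Continuous f) {T : ℝ} (hT : 0 < T)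
    (hf : Function.Periodic f T) : MaxOrLe f := by
  obtain ⟨t, -, ht⟩ := isCompact_Icc.exists_isMaxOn (nonempty_Icc.2 hT.le) hc.continuousOn
  refine Or.inl ⟨t, fun s => ?_⟩
  obtain ⟨u, hu, e⟩ := hf.exists_mem_Ico₀ hT s
  rw [e]
  exact ht (Ico_subset_Icc_self hu)

lemma MaxOrLe.of_tendsto {f : ℝ → ℝ} (hc : Continuous f) {a b : ℝ} (ha : a ≤ 1) (hb : b ≤ 1)
    (hfa : Tendsto f atBot (nhds a)) (hfb : Tendsto f atTop (nhds b)) : MaxOrLe f := by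
  refine or_iff_not_imp_right.2 fun h => ?_
  push Not at h
  obtain ⟨s, hs⟩ := h
  refine hc.exists_forall_ge' s ?_
  rw [cocompact_eq_atBot_atTop]
  exact eventually_sup.2 ⟨hfa.eventually_le_const (by linarith),
    hfb.eventually_le_const (by linarith)⟩

lemma derivative_eq_zero_of_max {f : ℝ → ℝ} {f' t : ℝ} (h : HasDerivAt f f' t)
    (ht : ∀ s, f s ≤ f t) : f' = 0 :=
  IsLocalMax.hasDerivAt_eq_zero (Eventually.of_forall ht) h

variable (hl : 0 < l) (hf : Solves (normalField l) f)
include hl hf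

lemma Solves.le_one (h₁ : MaxOrLe fun t => (f t).1) (h₂ : MaxOrLe fun t => (f t).2) :
    (∀ t, (f t).1 ≤ 1) ∧ ∀ t, (f t).2 ≤ 1 := by
  have key₂ : ∀ t, (∀ s, (f s).2 ≤ (f t).2) → (f t).1 = (f t).2 ^ 5 := fun t ht => by
    have := derivative_eq_zero_of_max (hasDerivAt_snd (hf t)) ht
    simp only [normalField] at this
    linarith
  have key₁ : ∀ t, (∀ s, (f s).1 ≤ (f t).1) → (f t).1 = (f t).2 := fun t ht => by
    have := derivative_eq_zero_of_max (hasDerivAt_fst (hf t)) ht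
    simp only [normalField, mul_eq_zero, hl.ne', false_or] at this
    exact ((Odd.strictMono_pow (by decide : Odd 3)).injective (sub_eq_zero.1 this)).symm
  have hy : ∀ t, (f t).2 ≤ 1 := by
    rcases h₂ with ⟨t, ht⟩ | h
    · by_contra! hlt
      obtain ⟨s, hs⟩ := hlt
      have h1 : 1 < (f t).2 := hs.trans_le (ht s)
      have hx := key₂ t ht
      have hpow : (f t).2 < (f t).2 ^ 5 := lt_self_pow₀ h1 (by norm_num)
      rcases h₁ with ⟨u, hu⟩ | h
      · have := key₁ u hu
        linarith [hu t, ht u]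
      · linarith [h t]
    · exact h
  refine ⟨?_, hy⟩
  rcases h₁ with ⟨t, ht⟩ | h
  · intro s
    exact (ht s).trans ((key₁ t ht).le.trans (hy t))
  · exact h

lemma Solves.lt_one (hc : ¬ ∃ c, ∀ t, f t = c) (h₁ : ∀ t, (f t).1 ≤ 1) (h₂ : ∀ t, (f t).2 ≤ 1) :
    (∀ t, (f t).1 < 1) ∧ ∀ t, (f t).2 < 1 := by
  have key : ∀ t, (f t).1 = 1 → (f t).2 = 1 → False := fun t hx hy =>
    hc ⟨f t, hf.const_of_zero (by simp [normalField, hx, hy])⟩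
  constructor
  · intro t
    refine lt_of_le_of_ne (h₁ t) fun e => key t e ?_
    have := derivative_eq_zero_of_max (hasDerivAt_fst (hf t)) (by rw [e]; exact h₁)
    simp only [normalField, mul_eq_zero, hl.ne', false_or, e] at this
    exact (Odd.strictMono_pow (by decide : Odd 3)).injective (by linarith)
  · intro t
    refine lt_of_le_of_ne (h₂ t) fun e => key t ?_ e
    have := derivative_eq_zero_of_max (hasDerivAt_snd (hf t)) (by rw [e]; exact h₂)
    simp only [normalField, e] at this
    linarith

/-- Solutions stay in the open square when their coordinates attain extrema outside it. -/
lemma Solves.mem_square (hc : ¬ ∃ c, ∀ t, f t = c) (h₁ : MaxOrLe fun t => (f t).1)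
    (h₂ : MaxOrLe fun t => (f t).2) (h₃ : MaxOrLe fun t => -(f t).1)
    (h₄ : MaxOrLe fun t => -(f t).2) (t : ℝ) : |(f t).1| < 1 ∧ |(f t).2| < 1 ∧ f t ≠ 0 := by
  have hg : Solves (normalField l) (-f) := hf.neg normalField_neg
  have hc' : ¬ ∃ c, ∀ t, (-f) t = c := fun ⟨c, h⟩ => hc ⟨-c, fun t => by simp [← h t]⟩
  obtain ⟨a₁, a₂⟩ := hf.le_one hl h₁ h₂
  obtain ⟨b₁, b₂⟩ := hg.le_one hl h₃ h₄
  obtain ⟨a₁, a₂⟩ := hf.lt_one hl hc a₁ a₂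
  obtain ⟨b₁, b₂⟩ := hg.lt_one hl hc' b₁ b₂
  refine ⟨abs_lt.2 ⟨neg_lt.1 (b₁ t), a₁ t⟩, abs_lt.2 ⟨neg_lt.1 (b₂ t), a₂ t⟩, fun h => hc ⟨f t,
    hf.const_of_zero (by simp [normalField, h])⟩⟩

lemma Solves.mem_square_of_periodic (hc : ¬ ∃ c, ∀ t, f t = c) {T : ℝ} (hT : 0 < T)
    (hp : Function.Periodic f T) (t : ℝ) : |(f t).1| < 1 ∧ |(f t).2| < 1 ∧ f t ≠ 0 := by
  have hcont := hf.continuous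
  refine hf.mem_square hl hc ?_ ?_ ?_ ?_ t <;>
    exact MaxOrLe.of_periodic (by fun_prop) hT (fun t => by simp [hp t])

lemma Solves.mem_square_of_tendsto (h₀ : Tendsto f atBot (nhds (-1, -1)))
    (h₁ : Tendsto f atTop (nhds (1, 1))) (t : ℝ) :
    |(f t).1| < 1 ∧ |(f t).2| < 1 ∧ f t ≠ 0 := by
  have hcont := hf.continuous
  have hc : ¬ ∃ c, ∀ t, f t = c := by
    rintro ⟨c, h⟩
    have e : f = fun _ => c := funext h
    rw [e] at h₀ h₁
    have := (tendsto_const_nhds_iff.1 h₀).symm.trans (tendsto_const_nhds_iff.1 h₁)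
    norm_num at this
  have a₀ := (continuous_fst.tendsto _).comp h₀
  have a₁ := (continuous_fst.tendsto _).comp h₁
  have b₀ := (continuous_snd.tendsto _).comp h₀
  have b₁ := (continuous_snd.tendsto _).comp h₁
  refine hf.mem_square hl hc ?_ ?_ ?_ ?_ t
  · exact MaxOrLe.of_tendsto (by fun_prop) (by norm_num) le_rfl a₀ a₁
  · exact MaxOrLe.of_tendsto (by fun_prop) (by norm_num) le_rfl b₀ b₁
  · exact MaxOrLe.of_tendsto (by fun_prop) (by norm_num) (by norm_num) a₀.neg a₁.neg
  · exact MaxOrLe.of_tendsto (by fun_prop) (by norm_num) (by norm_num) b₀.neg b₁.neg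

end

lemma not_periodic_of_deriv_pos {W W' : ℝ → ℝ} (h : ∀ t, HasDerivAt W (W' t) t)
    (hpos : ∀ t, 0 < W' t) {T : ℝ} (hT : 0 < T) : ¬ Function.Periodic W T := fun hp => by
  have := strictMono_of_hasDerivAt_pos h hpos hT
  have e := hp 0
  rw [zero_add] at e
  exact this.ne' e

section
open MeasureTheory Interval

lemma ContinuousOn.det2 {X : Type*} [TopologicalSpace X] {v w : X → ℝ × ℝ} {S : Set X}
    (hv : ContinuousOn v S) (hw : ContinuousOn w S) :
    ContinuousOn (fun x => det2 (v x) (w x)) S :=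
  (hv.fst.mul hw.snd).sub (hv.snd.mul hw.fst)

lemma HasDerivAt.det2 {v w : ℝ → ℝ × ℝ} {v' w' : ℝ × ℝ} {t : ℝ} (hv : HasDerivAt v v' t)
    (hw : HasDerivAt w w' t) :
    HasDerivAt (fun t => det2 (v t) (w t)) (det2 v' (w t) + det2 (v t) w') t := by
  convert! ((hasDerivAt_fst hv).mul (hasDerivAt_snd hw)).sub
    ((hasDerivAt_snd hv).mul (hasDerivAt_fst hw)) using 1
  simp only [_root_.det2]
  ring

/-- The divergence of a planar field. -/
def planarDiv (Y : ℝ × ℝ → ℝ × ℝ) (z : ℝ × ℝ) : ℝ :=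
  (fderiv ℝ Y z (1, 0)).1 + (fderiv ℝ Y z (0, 1)).2

/-- The flux of the field `Y` across the segment from `a` to `b`. -/
def flux (Y : ℝ × ℝ → ℝ × ℝ) (a b : ℝ × ℝ) : ℝ :=
  ∫ s in (0 : ℝ)..1, det2 (Y (a + s • (b - a))) (b - a)

section
variable {X : Type*} [TopologicalSpace X] {F : X → ℝ → ℝ} {W : Set (X × ℝ)} {x₀ : X}

lemma eventually_mem_and_bounded (hW : IsOpen W) (hF : ContinuousOn (fun p => F p.1 p.2) W)
    (h : ∀ s ∈ Icc (0 : ℝ) 1, (x₀, s) ∈ W) :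
    ∃ C, ∀ᶠ x in nhds x₀, ∀ s ∈ Icc (0 : ℝ) 1, (x, s) ∈ W ∧ |F x s| ≤ C := by
  obtain ⟨C, hC⟩ := (isCompact_Icc (a := (0 : ℝ)) (b := 1)).exists_bound_of_continuousOn
    (f := fun s => F x₀ s) (hF.comp (f := fun s : ℝ => (x₀, s)) (by fun_prop) h)
  refine ⟨C + 1, isCompact_Icc.eventually_forall_of_forall_eventually fun s hs => ?_⟩
  have hc := (hF.continuousAt (hW.mem_nhds (h s hs))).abs
  filter_upwards [hW.mem_nhds (h s hs), hc.eventually_le_const (u := C + 1)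
    (by have := hC s hs; rw [Real.norm_eq_abs] at this; simp only; linarith)] with z h₁ h₂
  exact ⟨h₁, h₂⟩

lemma continuousOn_slice (hF : ContinuousOn (fun p => F p.1 p.2) W)
    (h : ∀ s ∈ Icc (0 : ℝ) 1, (x₀, s) ∈ W) : ContinuousOn (F x₀) (Icc 0 1) :=
  hF.comp (f := fun s : ℝ => (x₀, s)) (by fun_prop) h

lemma uIoc_subset_Icc : Ι (0 : ℝ) 1 ⊆ Icc 0 1 := by
  rw [uIoc_of_le zero_le_one]; exact Ioc_subset_Icc_self

lemma aestronglyMeasurable_slice (hF : ContinuousOn (fun p => F p.1 p.2) W)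
    (h : ∀ s ∈ Icc (0 : ℝ) 1, (x₀, s) ∈ W) :
    AEStronglyMeasurable (F x₀) (volume.restrict (Ι (0 : ℝ) 1)) :=
  ((continuousOn_slice hF h).mono uIoc_subset_Icc).aestronglyMeasurable measurableSet_uIoc

lemma intervalIntegrable_slice (hF : ContinuousOn (fun p => F p.1 p.2) W)
    (h : ∀ s ∈ Icc (0 : ℝ) 1, (x₀, s) ∈ W) : IntervalIntegrable (F x₀) volume 0 1 := by
  refine ContinuousOn.intervalIntegrable ?_
  rw [uIcc_of_le zero_le_one]
  exact continuousOn_slice hF h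

lemma continuousAt_integral [FirstCountableTopology X] (hW : IsOpen W)
    (hF : ContinuousOn (fun p => F p.1 p.2) W)
    (h : ∀ s ∈ Icc (0 : ℝ) 1, (x₀, s) ∈ W) :
    ContinuousAt (fun x => ∫ s in (0 : ℝ)..1, F x s) x₀ := by
  obtain ⟨C, hC⟩ := eventually_mem_and_bounded hW hF h
  refine intervalIntegral.continuousAt_of_dominated_interval (bound := fun _ => C)
    (hC.mono fun x hx => aestronglyMeasurable_slice hF fun s hs => (hx s hs).1)
    (hC.mono fun x hx => Eventually.of_forall fun s hs => (hx s (uIoc_subset_Icc hs)).2)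
    (by simp) (Eventually.of_forall fun s hs => ?_)
  exact (hF.continuousAt (hW.mem_nhds (h s (uIoc_subset_Icc hs)))).comp
    (f := fun x => (x, s)) (by fun_prop)

end

lemma hasDerivAt_integral {F F' : ℝ → ℝ → ℝ} {W : Set (ℝ × ℝ)} {u : ℝ} (hW : IsOpen W)
    (hF : ContinuousOn (fun p => F p.1 p.2) W) (hF' : ContinuousOn (fun p => F' p.1 p.2) W)
    (hd : ∀ p ∈ W, HasDerivAt (fun x => F x p.2) (F' p.1 p.2) p.1)
    (h : ∀ s ∈ Icc (0 : ℝ) 1, (u, s) ∈ W) :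
    HasDerivAt (fun x => ∫ s in (0 : ℝ)..1, F x s) (∫ s in (0 : ℝ)..1, F' u s) u := by
  obtain ⟨C, hC⟩ := eventually_mem_and_bounded hW hF' h
  exact (intervalIntegral.hasDerivAt_integral_of_dominated_loc_of_deriv_le
    (bound := fun _ => C) hC
    (hC.mono fun x hx => aestronglyMeasurable_slice hF fun s hs => (hx s hs).1)
    (intervalIntegrable_slice hF h) (aestronglyMeasurable_slice hF' h)
    (Eventually.of_forall fun s hs x hx => (hx s (uIoc_subset_Icc hs)).2) (by simp)
    (Eventually.of_forall fun s hs x hx => hd (x, s) (hx s (uIoc_subset_Icc hs)).1)).2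

section
variable {Y : ℝ × ℝ → ℝ × ℝ} {U : Set (ℝ × ℝ)} (hU : IsOpen U) (hY : ContDiffOn ℝ 1 Y U)
include hU hY

lemma continuousAt_flux {p : (ℝ × ℝ) × ℝ × ℝ}
    (h : ∀ s ∈ Icc (0 : ℝ) 1, p.1 + s • (p.2 - p.1) ∈ U) :
    ContinuousAt (fun p : (ℝ × ℝ) × ℝ × ℝ => flux Y p.1 p.2) p := by
  have hq : Continuous fun r : ((ℝ × ℝ) × ℝ × ℝ) × ℝ => r.1.1 + r.2 • (r.1.2 - r.1.1) := by
    fun_prop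
  refine continuousAt_integral (hU.preimage hq) ?_ h
  exact (hY.continuousOn.comp hq.continuousOn (mapsTo_preimage _ U)).det2
    (Continuous.continuousOn (by fun_prop))

lemma hasDerivAt_flux {a b a' b' : ℝ → ℝ × ℝ} (ha : ∀ u, HasDerivAt a (a' u) u)
    (hb : ∀ u, HasDerivAt b (b' u) u) (hca : Continuous a') (hcb : Continuous b') {u : ℝ}
    (h : ∀ s ∈ Icc (0 : ℝ) 1, a u + s • (b u - a u) ∈ U)
    (hpos : ∀ s ∈ Ioo (0 : ℝ) 1, 0 < planarDiv Y (a u + s • (b u - a u))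
      * det2 (a' u + s • (b' u - a' u)) (b u - a u)) :
    ∃ d, det2 (Y (b u)) (b' u) - det2 (Y (a u)) (a' u) < d ∧
      HasDerivAt (fun u => flux Y (a u) (b u)) d u := by
  have hac : Continuous a := continuous_iff_continuousAt.2 fun t => (ha t).continuousAt
  have hbc : Continuous b := continuous_iff_continuousAt.2 fun t => (hb t).continuousAt
  set q : ℝ × ℝ → ℝ × ℝ := fun r => a r.1 + r.2 • (b r.1 - a r.1) with hq
  have hqc : Continuous q := by fun_prop
  have hYc := hY.continuousOn.comp hqc.continuousOn (mapsTo_preimage q U)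
  have hY' := hY.continuousOn_fderiv_of_isOpen hU le_rfl
  have hYc' := hY'.comp hqc.continuousOn (mapsTo_preimage q U)
  have hYd : ∀ z ∈ U, HasFDerivAt Y (fderiv ℝ Y z) z := fun z hz =>
    ((hY.differentiableOn one_ne_zero).differentiableAt (hU.mem_nhds hz)).hasFDerivAt
  simp only [Function.comp_def] at hYc hYc'
  set F' : ℝ → ℝ → ℝ := fun x s =>
    det2 (fderiv ℝ Y (q (x, s)) (a' x + s • (b' x - a' x))) (b x - a x)
      + det2 (Y (q (x, s))) (b' x - a' x) with hF'
  have hw : Continuous fun p : ℝ × ℝ => b p.1 - a p.1 := by fun_prop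
  have hw' : Continuous fun p : ℝ × ℝ => b' p.1 - a' p.1 := by fun_prop
  have hq' : Continuous fun p : ℝ × ℝ => a' p.1 + p.2 • (b' p.1 - a' p.1) := by fun_prop
  have hFc' : ContinuousOn (fun p : ℝ × ℝ => F' p.1 p.2) (q ⁻¹' U) :=
    ((hYc'.clm_apply hq'.continuousOn).det2 hw.continuousOn).add
      (hYc.det2 hw'.continuousOn)
  have key := hasDerivAt_integral (F := fun x s => det2 (Y (q (x, s))) (b x - a x)) (F' := F')
    (hU.preimage hqc) (u := u) (hYc.det2 hw.continuousOn) hFc' ?_ h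
  · refine ⟨_, ?_, key⟩
    set G : ℝ → ℝ := fun s => det2 (Y (q (u, s))) (a' u + s • (b' u - a' u)) with hG
    set G' : ℝ → ℝ := fun s => det2 (fderiv ℝ Y (q (u, s)) (b u - a u))
      (a' u + s • (b' u - a' u)) + det2 (Y (q (u, s))) (b' u - a' u) with hG'
    have hslice : ∀ s ∈ Icc (0 : ℝ) 1, (u, s) ∈ q ⁻¹' U := h
    have hYs := hYc.comp (f := fun s : ℝ => (u, s)) (s := Icc 0 1) (by fun_prop) hslice
    have hYs' := hYc'.comp (f := fun s : ℝ => (u, s)) (s := Icc 0 1) (by fun_prop) hslice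
    simp only [Function.comp_def] at hYs hYs'
    have hGint : IntervalIntegrable G' volume 0 1 := by
      refine ContinuousOn.intervalIntegrable ?_
      rw [uIcc_of_le zero_le_one]
      exact ((hYs'.clm_apply continuousOn_const).det2 (by fun_prop)).add
        (hYs.det2 continuousOn_const)
    have hGd : ∀ s ∈ uIcc (0 : ℝ) 1, HasDerivAt G (G' s) s := by
      rw [uIcc_of_le zero_le_one]
      intro s hs
      have aux : ∀ v w : ℝ × ℝ, HasDerivAt (fun s : ℝ => v + s • w) w s := fun v w => by
        simpa using ((hasDerivAt_id s).smul_const w).const_add v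
      have h₂ := (hYd _ (h s hs)).comp_hasDerivAt s (aux (a u) (b u - a u))
      exact h₂.det2 (aux _ _)
    have hFTC := intervalIntegral.integral_eq_sub_of_hasDerivAt hGd hGint
    have hF'int : IntervalIntegrable (F' u) volume 0 1 :=
      intervalIntegrable_slice (W := q ⁻¹' U) hFc' h
    have hG10 : G 1 - G 0 = det2 (Y (b u)) (b' u) - det2 (Y (a u)) (a' u) := by
      simp [hG, hq]
    rw [← hG10, ← hFTC, ← sub_pos, ← intervalIntegral.integral_sub hF'int hGint]
    refine intervalIntegral.intervalIntegral_pos_of_pos_on (hF'int.sub hGint) (fun s hs => ?_)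
      one_pos
    convert! hpos s hs using 1
    simp only [hF', hG', planarDiv, hq]
    have e : ∀ (A : ℝ × ℝ →L[ℝ] ℝ × ℝ) (v : ℝ × ℝ), A v = v.1 • A (1, 0) + v.2 • A (0, 1) := by
      intro A v
      rw [← map_smul, ← map_smul, ← map_add]
      simp
    generalize fderiv ℝ Y (a u + s • (b u - a u)) = A
    rw [e A (_ + _), e A (b u - a u)]
    simp only [det2, Prod.fst_add, Prod.snd_add, Prod.smul_fst, Prod.smul_snd, smul_eq_mul]
    ring
  · rintro ⟨x, s⟩ hx
    have h₁ : HasDerivAt (fun x => q (x, s)) (a' x + s • (b' x - a' x)) x :=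
      (ha x).add (((hb x).sub (ha x)).const_smul s)
    have h₂ := (hYd _ hx).comp_hasDerivAt x h₁
    exact h₂.det2 ((hb x).sub (ha x))

end
end

lemma flux_neg {Y : ℝ × ℝ → ℝ × ℝ} (hY : ∀ z, Y (-z) = -Y z) (a b : ℝ × ℝ) :
    flux Y (-a) (-b) = flux Y a b := by
  unfold flux
  refine intervalIntegral.integral_congr fun s _ => ?_
  have : -a + s • (-b - -a) = -(a + s • (b - a)) := by module
  simp only [this, hY, det2, Prod.fst_neg, Prod.snd_neg, Prod.fst_sub, Prod.snd_sub]
  ring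

/-- The unit vector at clockwise angle `θ`. -/
def ray (θ : ℝ) : ℝ × ℝ := (cos θ, -sin θ)

lemma continuous_ray : Continuous ray := by unfold ray; fun_prop

lemma ray_add_pi (θ : ℝ) : ray (θ + π) = -ray θ := by simp [ray]

lemma det2_smul_left (r : ℝ) (v w : ℝ × ℝ) : det2 (r • v) w = r * det2 v w := by
  simp [det2]; ring

lemma det2_smul_right (r : ℝ) (v w : ℝ × ℝ) : det2 v (r • w) = r * det2 v w := by
  simp [det2]; ring

lemma det2_self (v : ℝ × ℝ) : det2 v v = 0 := by simp [det2]; ring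

lemma sq_add_sq_pos {z : ℝ × ℝ} (hz : z ≠ 0) : 0 < z.1 ^ 2 + z.2 ^ 2 := by
  rcases fst_ne_or_snd_ne hz with h | h <;> positivity

lemma eq_of_smul_ray_eq {r s α β : ℝ} (hr : 0 < r) (hs : 0 < s) (h : r • ray α = s • ray β) :
    r = s ∧ ∃ n : ℤ, α = β + n * (2 * π) := by
  simp only [ray, Prod.smul_mk, smul_eq_mul, Prod.mk.injEq] at h
  obtain ⟨h₁, h₂⟩ := h
  have e : r = s := by
    refine (pow_left_inj₀ hr.le hs.le two_ne_zero).1 ?_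
    have hα := sin_sq_add_cos_sq α
    have hβ := sin_sq_add_cos_sq β
    calc r ^ 2 = (r * cos α) ^ 2 + (r * -sin α) ^ 2 := by linear_combination -r ^ 2 * hα
      _ = s ^ 2 := by rw [h₁, h₂]; linear_combination s ^ 2 * hβ
  subst e
  refine ⟨rfl, ?_⟩
  have hcos := mul_left_cancel₀ hr.ne' h₁
  have hsin := neg_injective (mul_left_cancel₀ hr.ne' h₂)
  obtain ⟨k, hk⟩ := Real.Angle.angle_eq_iff_two_pi_dvd_sub.1 (Real.Angle.cos_sin_inj hcos hsin)
  exact ⟨k, by linarith⟩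

lemma eq_of_smul_ray_eq_neg {r s α β : ℝ} (hr : 0 < r) (hs : 0 < s)
    (h : r • ray α = -(s • ray β)) : ∃ n : ℤ, α = β + π + n * (2 * π) := by
  rw [← smul_neg, ← ray_add_pi] at h
  exact (eq_of_smul_ray_eq hr hs h).2

/-- The radial coordinate of `z` along the ray at angle `θ`. -/
def radial (θ : ℝ) (z : ℝ × ℝ) : ℝ := z.1 * cos θ - z.2 * sin θ

lemma Continuous.radial {θ : ℝ → ℝ} {w : ℝ → ℝ × ℝ} (hθ : Continuous θ) (hw : Continuous w) :
    Continuous fun t => radial (θ t) (w t) := by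
  unfold _root_.radial; fun_prop

lemma continuous_angularVelocity {c c' : ℝ → ℝ × ℝ} (hc : Continuous c) (hc' : Continuous c')
    (h₀ : ∀ t, c t ≠ 0) :
    Continuous fun t => -det2 (c t) (c' t) / ((c t).1 ^ 2 + (c t).2 ^ 2) := by
  unfold det2
  exact Continuous.div (by fun_prop) (by fun_prop) fun t => (sq_add_sq_pos (h₀ t)).ne'

/-- A nonvanishing curve has a differentiable clockwise angle. -/
lemma exists_angle {c c' : ℝ → ℝ × ℝ} (hc : ∀ t, HasDerivAt c (c' t) t) (hc' : Continuous c')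
    (h₀ : ∀ t, c t ≠ 0) : ∃ Φ : ℝ → ℝ,
      (∀ t, HasDerivAt Φ (-det2 (c t) (c' t) / ((c t).1 ^ 2 + (c t).2 ^ 2)) t) ∧
      ∀ t, 0 < radial (Φ t) (c t) ∧ c t = radial (Φ t) (c t) • ray (Φ t) := by
  have hcc : Continuous c := continuous_iff_continuousAt.2 fun t => (hc t).continuousAt
  have hN : ∀ t, 0 < (c t).1 ^ 2 + (c t).2 ^ 2 := fun t => sq_add_sq_pos (h₀ t)
  set ω : ℝ → ℝ := fun t => -det2 (c t) (c' t) / ((c t).1 ^ 2 + (c t).2 ^ 2) with hω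
  have hωc : Continuous ω := continuous_angularVelocity hcc hc' h₀
  obtain ⟨θ₀, r, hr, h₁, h₂⟩ : ∃ θ₀ r : ℝ, 0 < r ∧ (c 0).1 = r * cos θ₀ ∧
      (c 0).2 = -(r * sin θ₀) := by
    refine ⟨Complex.arg ⟨(c 0).1, -(c 0).2⟩, ‖(⟨(c 0).1, -(c 0).2⟩ : ℂ)‖, ?_, ?_, ?_⟩
    · refine norm_pos_iff.2 fun h => h₀ 0 ?_
      rw [Complex.ext_iff] at h
      exact Prod.ext h.1 (neg_eq_zero.1 h.2)
    · rw [Complex.norm_mul_cos_arg]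
    · rw [Complex.norm_mul_sin_arg, neg_neg]
  set Φ : ℝ → ℝ := fun t => θ₀ + ∫ s in (0 : ℝ)..t, ω s with hΦ
  have hΦd : ∀ t, HasDerivAt Φ (ω t) t := fun t =>
    (intervalIntegral.integral_hasDerivAt_right (hωc.intervalIntegrable _ _)
      (hωc.stronglyMeasurableAtFilter _ _) hωc.continuousAt).const_add θ₀
  have hΦ0 : Φ 0 = θ₀ := by simp [hΦ]
  set n : ℝ → ℝ := fun t => (c t).1 * sin (Φ t) + (c t).2 * cos (Φ t) with hn
  have hconst : ∀ t, n t ^ 2 / ((c t).1 ^ 2 + (c t).2 ^ 2) = 0 := by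
    have hd : ∀ t, HasDerivAt (fun t => n t ^ 2 / ((c t).1 ^ 2 + (c t).2 ^ 2)) 0 t := by
      intro t
      have d₁ := hasDerivAt_fst (hc t)
      have d₂ := hasDerivAt_snd (hc t)
      have d := (((d₁.mul (hΦd t).sin).add (d₂.mul (hΦd t).cos)).pow 2).div
        ((d₁.pow 2).add (d₂.pow 2)) (hN t).ne'
      convert! d using 1
      symm
      rw [div_eq_zero_iff]
      left
      have hω' : ω t * ((c t).1 ^ 2 + (c t).2 ^ 2)
          = -((c t).1 * (c' t).2 - (c t).2 * (c' t).1) := by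
        simp only [hω, det2]
        field_simp [(hN t).ne']
      simp only [Pi.add_apply, Pi.mul_apply, Pi.pow_apply]
      push_cast
      linear_combination 2 * ((c t).1 * sin (Φ t) + (c t).2 * cos (Φ t))
        * ((c t).1 * cos (Φ t) - (c t).2 * sin (Φ t)) * hω'
    intro t
    rw [is_const_of_deriv_eq_zero (fun t => (hd t).differentiableAt) (fun t => (hd t).deriv) t 0]
    simp only [hn, hΦ0, h₁, h₂]
    rw [show r * cos θ₀ * sin θ₀ + -(r * sin θ₀) * cos θ₀ = 0 by ring]
    simp
  have hn0 : ∀ t, n t = 0 := fun t => by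
    have := hconst t
    rw [div_eq_zero_iff, or_iff_left (hN t).ne'] at this
    exact pow_eq_zero_iff two_ne_zero |>.1 this
  have heq : ∀ t, c t = radial (Φ t) (c t) • ray (Φ t) := by
    intro t
    have e := hn0 t
    simp only [hn] at e
    have hsc := sin_sq_add_cos_sq (Φ t)
    refine Prod.ext ?_ ?_ <;> simp only [radial, ray, Prod.smul_mk, smul_eq_mul]
    · linear_combination sin (Φ t) * e - (c t).1 * hsc
    · linear_combination cos (Φ t) * e - (c t).2 * hsc
  refine ⟨Φ, hΦd, fun t => ⟨?_, heq t⟩⟩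
  have hΦc : Continuous Φ := continuous_iff_continuousAt.2 fun t => (hΦd t).continuousAt
  have hcont : Continuous fun t => radial (Φ t) (c t) := hΦc.radial hcc
  by_contra! hle
  have h0 : 0 < radial (Φ 0) (c 0) := by
    simp only [radial, hΦ0, h₁, h₂]
    have := sin_sq_add_cos_sq θ₀
    nlinarith
  obtain ⟨s, hs⟩ := mem_range_of_exists_le_of_exists_ge hcont ⟨t, hle⟩ ⟨0, h0.le⟩
  refine h₀ s ?_
  rw [heq s, show radial (Φ s) (c s) = 0 from hs, zero_smul]

/-- The field parametrized by clockwise angle. -/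
def polarField (l : ℝ) (z : ℝ × ℝ) : ℝ × ℝ :=
  (-(z.1 ^ 2 + z.2 ^ 2) / det2 z (normalField l z)) • normalField l z

/-- The open square `(-1, 1)²` without its centre. -/
def openSquare : Set (ℝ × ℝ) := {z | |z.1| < 1 ∧ |z.2| < 1 ∧ z ≠ 0}

lemma openSquare_subset : openSquare ⊆ puncturedSquare := fun _ h => ⟨h.1.le, h.2.1.le, h.2.2⟩

lemma neg_mem_openSquare {z : ℝ × ℝ} (h : z ∈ openSquare) : -z ∈ openSquare := by
  obtain ⟨h₁, h₂, h₃⟩ := h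
  exact ⟨by simpa using h₁, by simpa using h₂, neg_ne_zero.2 h₃⟩

lemma det2_neg_neg (v w : ℝ × ℝ) : det2 (-v) (-w) = det2 v w := by simp [det2]

lemma polarField_neg (l : ℝ) (z : ℝ × ℝ) : polarField l (-z) = -polarField l z := by
  simp only [polarField, normalField_neg, det2_neg_neg, Prod.fst_neg, Prod.snd_neg, neg_sq,
    smul_neg]

section
variable {l : ℝ} (hl₀ : 0.4 ≤ l) (hl₁ : l ≤ 1.6) {z : ℝ × ℝ} (hz : z ∈ openSquare)
include hl₀ hl₁ hz

lemma contDiffAt_polarField : ContDiffAt ℝ 1 (polarField l) z := by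
  have h : ContDiff ℝ 1 (normalField l) := contDiff_normalField
  have h₁ : ContDiff ℝ 1 fun z => det2 z (normalField l z) := by unfold det2; fun_prop
  have := det2_normalField_neg hl₀ hl₁ hz.1 hz.2.1 hz.2.2
  refine ContDiffAt.smul (ContDiffAt.div ?_ h₁.contDiffAt this.ne) h.contDiffAt
  fun_prop

lemma det2_polarField : det2 z (polarField l z) = -(z.1 ^ 2 + z.2 ^ 2) := by
  rw [polarField, det2_smul_right, div_mul_cancel₀]
  exact (det2_normalField_neg hl₀ hl₁ hz.1 hz.2.1 hz.2.2).ne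

end

/-- A closed orbit in the open square parametrized by clockwise angle. -/
structure PolarOrbit (l : ℝ) (P : ℝ → ℝ × ℝ) : Prop where
  solves : Solves (polarField l) P
  mem : ∀ θ, P θ ∈ openSquare
  radial_pos : ∀ θ, 0 < radial θ (P θ)
  eq_smul : ∀ θ, P θ = radial θ (P θ) • ray θ
  periodic : ∃ k : ℕ, 0 < k ∧ Function.Periodic P (k * (2 * π))

lemma exists_polarOrbit {l : ℝ} (hl₀ : 0.4 ≤ l) (hl₁ : l ≤ 1.6) {f : ℝ → ℝ × ℝ}
    (hf : Solves (normalField l) f) (hmem : ∀ t, f t ∈ openSquare) {T : ℝ} (hT : 0 < T)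
    (hp : Function.Periodic f T) : ∃ P, PolarOrbit l P ∧ range P = range f := by
  have hX : Continuous (normalField l) := contDiff_normalField.continuous
  obtain ⟨Φ, hΦ, hr⟩ := exists_angle hf (hX.comp hf.continuous) fun t => (hmem t).2.2
  have hdet : ∀ t, det2 (f t) (normalField l (f t)) < 0 := fun t =>
    det2_normalField_neg hl₀ hl₁ (hmem t).1 (hmem t).2.1 (hmem t).2.2
  have hpos : ∀ t, 0 < -det2 (f t) (normalField l (f t)) / ((f t).1 ^ 2 + (f t).2 ^ 2) :=
    fun t => div_pos (neg_pos.2 (hdet t)) (sq_add_sq_pos (hmem t).2.2)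
  have hmono : StrictMono Φ := strictMono_of_hasDerivAt_pos hΦ hpos
  have hΦc : Continuous Φ := continuous_iff_continuousAt.2 fun t => (hΦ t).continuousAt
  set D := Φ T - Φ 0 with hD
  have hD₀ : 0 < D := sub_pos.2 (hmono hT)
  have hshift : ∀ t, Φ (t + T) = Φ t + D := by
    have hd : ∀ t, HasDerivAt (fun t => Φ (t + T) - Φ t) 0 t := fun t => by
      have := ((hΦ (t + T)).comp_add_const t T).sub (hΦ t)
      rwa [hp t, sub_self] at this
    intro t
    have := is_const_of_deriv_eq_zero (fun t => (hd t).differentiableAt)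
      (fun t => (hd t).deriv) t 0
    simp only [zero_add] at this
    linarith
  have hshiftn : ∀ (n : ℤ) t, Φ (t + n * T) = Φ t + n * D := by
    intro n t
    have : Function.Periodic (fun t => Φ t - t / T * D) T := fun t => by
      simp only [hshift]; field_simp; ring
    have := this.int_mul n t
    field_simp at this
    refine mul_left_cancel₀ hT.ne' ?_
    linarith
  obtain ⟨n, hn⟩ : ∃ n : ℤ, D = n * (2 * π) := by
    have h : f T = f 0 := by simpa using hp 0
    obtain ⟨-, n, hn⟩ := eq_of_smul_ray_eq (hr T).1 (hr 0).1
      ((hr T).2.symm.trans (h.trans (hr 0).2))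
    exact ⟨n, by linarith⟩
  have hn₀ : 0 < n := by
    by_contra! h
    have : (n : ℝ) ≤ 0 := by exact_mod_cast h
    nlinarith [pi_pos]
  have hsurj : Function.Surjective Φ := by
    intro y
    refine mem_range_of_exists_le_of_exists_ge hΦc ?_ ?_
    · obtain ⟨j, hj⟩ := exists_int_lt ((y - Φ 0) / D)
      refine ⟨0 + j * T, ?_⟩
      rw [hshiftn]
      have := (lt_div_iff₀ hD₀).1 hj
      linarith
    · obtain ⟨j, hj⟩ := exists_int_gt ((y - Φ 0) / D)
      refine ⟨0 + j * T, ?_⟩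
      rw [hshiftn]
      have := (div_lt_iff₀ hD₀).1 hj
      linarith
  let e := hmono.orderIsoOfSurjective Φ hsurj
  have he : ∀ θ, Φ (e.symm θ) = θ := fun θ => e.apply_symm_apply θ
  have hσ : ∀ θ, HasDerivAt e.symm (-det2 (f (e.symm θ)) (normalField l (f (e.symm θ)))
      / ((f (e.symm θ)).1 ^ 2 + (f (e.symm θ)).2 ^ 2))⁻¹ θ := fun θ =>
    (hΦ (e.symm θ)).of_local_left_inverse e.symm.continuous.continuousAt (hpos _).ne'
      (Eventually.of_forall he)
  refine ⟨f ∘ e.symm, ⟨fun θ => ?_, fun θ => hmem _, fun θ => ?_, fun θ => ?_, n.toNat, ?_,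
    fun θ => ?_⟩, e.symm.surjective.range_comp f⟩
  · have := (hf (e.symm θ)).scomp θ (hσ θ)
    convert! this using 1
    simp only [polarField, Function.comp_apply]
    congr 1
    rw [inv_div, div_neg, neg_div]
  · have := (hr (e.symm θ)).1
    rwa [he] at this
  · have := (hr (e.symm θ)).2
    rwa [he] at this
  · omega
  · have hcast : ((n.toNat : ℕ) : ℝ) = n := by
      exact_mod_cast Int.toNat_of_nonneg hn₀.le
    have : e.symm (θ + D) = e.symm θ + T := by
      refine hmono.injective ?_
      rw [he, hshift, he]
    simp only [Function.comp_apply]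
    rw [hcast, ← hn, this, hp]

namespace PolarOrbit
variable {l : ℝ} {P Q : ℝ → ℝ × ℝ}

lemma antipodal (hP : PolarOrbit l P) : PolarOrbit l fun θ => -P (θ + π) where
  solves θ := by
    rw [polarField_neg]
    exact ((hP.solves (θ + π)).comp_add_const θ π).neg
  mem θ := neg_mem_openSquare (hP.mem _)
  radial_pos θ := by
    have := hP.radial_pos (θ + π)
    simpa [radial, cos_add_pi, sin_add_pi, sub_eq_add_neg, add_comm] using this
  eq_smul θ := by
    have h := hP.eq_smul (θ + π)
    rw [ray_add_pi] at h
    nth_rewrite 1 [h]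
    rw [smul_neg, neg_neg]
    congr 1
    simp [radial, cos_add_pi, sin_add_pi, sub_eq_add_neg]
  periodic := by
    obtain ⟨k, hk, h⟩ := hP.periodic
    refine ⟨k, hk, fun θ => ?_⟩
    simp only [add_right_comm θ _ π, h (θ + π)]

lemma continuous_radial (hP : PolarOrbit l P) : Continuous fun θ => radial θ (P θ) := by
  have := hP.solves.continuous
  unfold radial
  fun_prop

end PolarOrbit

lemma EvenC1.contDiff (V : EvenC1) : ContDiff ℝ 1 V.toFun :=
  contDiff_one_iff_hasFDerivAt.2 ⟨V.deriv, V.continuous_deriv, V.hasFDerivAt⟩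

lemma EvenC1.hasDerivAt_comp (V : EvenC1) {l : ℝ} {f : ℝ → ℝ × ℝ}
    (hf : Solves (normalField l) f) (t : ℝ) :
    HasDerivAt (fun t => V.toFun (f t)) (V.deriv (f t) (normalField l (f t))) t :=
  (V.hasFDerivAt (f t)).comp_hasDerivAt t (hf t)

lemma hasFDerivAt_normalField (l : ℝ) (z : ℝ × ℝ) : HasFDerivAt (normalField l)
    (((l * 3 * z.2 ^ 2) • ContinuousLinearMap.snd ℝ ℝ ℝ
      - (l * 3 * z.1 ^ 2) • ContinuousLinearMap.fst ℝ ℝ ℝ).prod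
    ((5 * z.2 ^ 4) • ContinuousLinearMap.snd ℝ ℝ ℝ - ContinuousLinearMap.fst ℝ ℝ ℝ)) z := by
  have h₁ : HasFDerivAt (fun z : ℝ × ℝ => z.1) (ContinuousLinearMap.fst ℝ ℝ ℝ) z :=
    hasFDerivAt_fst
  have h₂ : HasFDerivAt (fun z : ℝ × ℝ => z.2) (ContinuousLinearMap.snd ℝ ℝ ℝ) z :=
    hasFDerivAt_snd
  refine ((((h₂.pow 3).sub (h₁.pow 3)).const_mul l).prodMk ((h₂.pow 5).sub h₁)).congr_fderiv ?_
  ext <;> simp <;> ring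

lemma planarDiv_smul_normalField {l : ℝ} {g : ℝ × ℝ → ℝ} {g' : ℝ × ℝ →L[ℝ] ℝ} {z : ℝ × ℝ}
    (hg : HasFDerivAt g g' z) : planarDiv (fun z => g z • normalField l z) z
      = g z * normalDiv l z + g' (normalField l z) := by
  have e : g' (normalField l z)
      = (normalField l z).1 * g' (1, 0) + (normalField l z).2 * g' (0, 1) := by
    rw [← smul_eq_mul, ← smul_eq_mul, ← map_smul, ← map_smul, ← map_add]
    simp
  have h := (hg.smul (hasFDerivAt_normalField l z)).fderiv
  rw [planarDiv, show fderiv ℝ (fun z => g z • normalField l z) z = _ from h, e]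
  simp [normalDiv]
  ring

/-- A positive multiple of the field with positive divergence on the punctured square. -/
structure DulacField (l : ℝ) where
  toFun : ℝ × ℝ → ℝ × ℝ
  domain : Set (ℝ × ℝ)
  isOpen : IsOpen domain
  contDiffOn : ContDiffOn ℝ 1 toFun domain
  subset : puncturedSquare ⊆ domain
  div_pos : ∀ z ∈ puncturedSquare, 0 < planarDiv toFun z
  factor : ℝ × ℝ → ℝ
  eq_smul : ∀ z, toFun z = factor z • normalField l z
  factor_pos : ∀ z ∈ puncturedSquare, 0 < factor z
  neg : ∀ z, toFun (-z) = -toFun z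

lemma nonempty_dulacField {l m : ℝ} (hl : 0 < l) (hlm : l ^ 2 * m = 1) (h₀ : 0.4 ≤ m)
    (h₁ : m ≤ 0.6) : Nonempty (DulacField l) := by
  obtain ⟨V, hV⟩ := exists_dulac_sq hl hlm h₀ h₁
  refine ⟨⟨fun z => (V.toFun z ^ 2)⁻¹ • normalField l z, {z | 0 < V.toFun z},
    isOpen_lt continuous_const V.contDiff.continuous, ?_, fun z hz => (hV z hz).1,
    fun z hz => ?_, fun z => (V.toFun z ^ 2)⁻¹, fun _ => rfl, fun z hz => ?_, fun z => ?_⟩⟩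
  · refine ContDiffOn.smul (ContDiffOn.inv (V.contDiff.pow 2).contDiffOn fun z hz => ?_)
      contDiff_normalField.contDiffOn
    exact pow_ne_zero 2 (ne_of_gt hz)
  · obtain ⟨h₁, h₂⟩ := hV z hz
    have d := (hasDerivAt_inv (pow_ne_zero 2 h₁.ne')).comp_hasFDerivAt z
      ((V.hasFDerivAt z).pow 2)
    have e := planarDiv_smul_normalField (l := l) d
    rw [show planarDiv (fun z => (V.toFun z ^ 2)⁻¹ • normalField l z) z = _ from e]
    have : 0 < (V.toFun z * normalDiv l z - 2 * V.deriv z (normalField l z))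
      / V.toFun z ^ 3 := by positivity
    convert this using 1
    simp
    field_simp
    ring
  · have := (hV z hz).1
    positivity
  · simp only [V.neg, normalField_neg, smul_neg]

lemma segment_mem_puncturedSquare {a b : ℝ × ℝ} {κ s : ℝ} (ha : a ∈ puncturedSquare)
    (hb : b ∈ puncturedSquare) (hκ : 0 < κ) (hab : b = κ • a) (hs : s ∈ Icc (0 : ℝ) 1) :
    a + s • (b - a) ∈ puncturedSquare := by
  have e : a + s • (b - a) = (1 - s) • a + s • b := by module
  obtain ⟨a₁, a₂, a₃⟩ := ha
  obtain ⟨b₁, b₂, -⟩ := hb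
  have hs' : 0 ≤ 1 - s := sub_nonneg.2 hs.2
  have key : ∀ x y : ℝ, |x| ≤ 1 → |y| ≤ 1 → |(1 - s) * x + s * y| ≤ 1 := fun x y hx hy => by
    rw [abs_le] at *
    constructor <;> nlinarith [mul_nonneg hs' (sub_nonneg.2 hx.1),
      mul_nonneg hs' (sub_nonneg.2 hx.2), mul_nonneg hs.1 (sub_nonneg.2 hy.1),
      mul_nonneg hs.1 (sub_nonneg.2 hy.2)]
  refine ⟨?_, ?_, ?_⟩
  · rw [e]; exact key _ _ a₁ b₁
  · rw [e]; exact key _ _ a₂ b₂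
  · rw [e, hab, smul_smul, ← add_smul]
    refine smul_ne_zero ?_ a₃
    rcases hs.1.eq_or_lt with h | h
    · simp [← h]
    · have := mul_pos h hκ; linarith

namespace DulacField
variable {l : ℝ} (D : DulacField l)

lemma hasDerivAt_flux {a b a' b' : ℝ → ℝ × ℝ} (ha : ∀ u, HasDerivAt a (a' u) u)
    (hb : ∀ u, HasDerivAt b (b' u) u) (hca : Continuous a') (hcb : Continuous b') {u κ : ℝ}
    (hau : a u ∈ puncturedSquare) (hbu : b u ∈ puncturedSquare) (hκ : 1 < κ)
    (hab : b u = κ • a u) (hda : det2 (a u) (a' u) < 0) (hdb : det2 (b u) (b' u) < 0) :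
    ∃ d, det2 (D.toFun (b u)) (b' u) - det2 (D.toFun (a u)) (a' u) < d ∧
      HasDerivAt (fun u => flux D.toFun (a u) (b u)) d u := by
  have hκ₀ : 0 < κ := by linarith
  refine _root_.hasDerivAt_flux D.isOpen D.contDiffOn ha hb hca hcb
    (fun s hs => D.subset (segment_mem_puncturedSquare hau hbu hκ₀ hab hs)) fun s hs => ?_
  refine mul_pos (D.div_pos _ (segment_mem_puncturedSquare hau hbu hκ₀ hab
    (Ioo_subset_Icc_self hs))) ?_
  have hdb' : det2 (a u) (b' u) < 0 := by
    rw [hab, det2_smul_left] at hdb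
    exact neg_of_mul_neg_right hdb hκ₀.le
  have e : det2 (a' u + s • (b' u - a' u)) (b u - a u)
      = (κ - 1) * ((1 - s) * -det2 (a u) (a' u) + s * -det2 (a u) (b' u)) := by
    rw [hab]
    simp only [det2, Prod.fst_add, Prod.snd_add, Prod.fst_sub, Prod.snd_sub, Prod.smul_fst,
      Prod.smul_snd, smul_eq_mul]
    ring
  rw [e]
  exact mul_pos (by linarith) (add_pos (mul_pos (by linarith [hs.2]) (by linarith))
    (mul_pos hs.1 (by linarith)))

lemma det2_smul_polarField (z : ℝ × ℝ) (r : ℝ) : det2 (D.toFun z) (r • polarField l z) = 0 := by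
  rw [D.eq_smul, polarField, smul_smul, det2_smul_left, det2_smul_right, det2_self]
  simp

lemma det2_normalField (z : ℝ × ℝ) : det2 (D.toFun z) (normalField l z) = 0 := by
  rw [D.eq_smul, det2_smul_left, det2_self, mul_zero]

end DulacField

lemma pos_or_neg_of_continuous {f : ℝ → ℝ} (hf : Continuous f) (h : ∀ t, f t ≠ 0) :
    (∀ t, 0 < f t) ∨ ∀ t, f t < 0 := by
  by_contra! hc
  obtain ⟨⟨s, hs⟩, t, ht⟩ := hc
  obtain ⟨u, hu⟩ := mem_range_of_exists_le_of_exists_ge hf ⟨s, hs⟩ ⟨t, ht⟩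
  exact h u hu

lemma eq_smul_of_radial {θ : ℝ} {a b : ℝ × ℝ} (ha : 0 < radial θ a)
    (hae : a = radial θ a • ray θ) (hbe : b = radial θ b • ray θ) :
    b = (radial θ b / radial θ a) • a := by
  generalize radial θ a = r at *
  rw [hae, smul_smul, div_mul_cancel₀ _ ha.ne']
  exact hbe

section
variable {l : ℝ} (hl₀ : 0.4 ≤ l) (hl₁ : l ≤ 1.6) {P Q : ℝ → ℝ × ℝ}
include hl₀ hl₁

lemma PolarOrbit.continuous_deriv (hP : PolarOrbit l P) :
    Continuous fun θ => polarField l (P θ) :=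
  continuous_iff_continuousAt.2 fun θ =>
    (contDiffAt_polarField hl₀ hl₁ (hP.mem θ)).continuousAt.comp hP.solves.continuous.continuousAt

lemma PolarOrbit.not_lt (D : DulacField l) (hP : PolarOrbit l P) (hQ : PolarOrbit l Q) :
    ¬ ∀ θ, radial θ (P θ) < radial θ (Q θ) := by
  intro h
  have hd : ∀ θ, ∃ d, 0 < d ∧ HasDerivAt (fun u => flux D.toFun (P u) (Q u)) d θ := by
    intro θ
    have hneg : ∀ z ∈ openSquare, det2 z (polarField l z) < 0 := fun z hz => by
      rw [det2_polarField hl₀ hl₁ hz]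
      linarith [sq_add_sq_pos hz.2.2]
    obtain ⟨d, hd, hd'⟩ := D.hasDerivAt_flux hP.solves hQ.solves (hP.continuous_deriv hl₀ hl₁)
      (hQ.continuous_deriv hl₀ hl₁) (openSquare_subset (hP.mem θ))
      (openSquare_subset (hQ.mem θ)) ((one_lt_div (hP.radial_pos θ)).2 (h θ))
      (eq_smul_of_radial (hP.radial_pos θ) (hP.eq_smul θ) (hQ.eq_smul θ))
      (hneg _ (hP.mem θ)) (hneg _ (hQ.mem θ))
    refine ⟨d, ?_, hd'⟩
    have h₁ := D.det2_smul_polarField (P θ) 1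
    have h₂ := D.det2_smul_polarField (Q θ) 1
    rw [one_smul] at h₁ h₂
    linarith
  choose d hd hd' using hd
  obtain ⟨j, hj, hj'⟩ := hP.periodic
  obtain ⟨k, hk, hk'⟩ := hQ.periodic
  refine not_periodic_of_deriv_pos hd' hd (T := (j * k : ℕ) * (2 * π)) (by positivity)
    fun θ => ?_
  have e₁ := hj'.nat_mul k θ
  have e₂ := hk'.nat_mul j θ
  simp only
  rw [show ((j * k : ℕ) : ℝ) * (2 * π) = k * (j * (2 * π)) by push_cast; ring, e₁,
    show (k : ℝ) * (j * (2 * π)) = j * (k * (2 * π)) by ring, e₂]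

lemma PolarOrbit.unique (D : DulacField l) (hP : PolarOrbit l P) (hQ : PolarOrbit l Q) :
    P = Q := by
  by_contra hne
  have hr : ∀ θ, radial θ (Q θ) - radial θ (P θ) ≠ 0 := fun θ h => by
    refine hne (hP.solves.eq_of_eq_at hQ.solves
      (fun t => contDiffAt_polarField hl₀ hl₁ (hP.mem t)) (t₀ := θ) ?_)
    rw [hP.eq_smul θ, hQ.eq_smul θ, sub_eq_zero.1 h]
  rcases pos_or_neg_of_continuous (hQ.continuous_radial.sub hP.continuous_radial) hr with h | h
  · exact hP.not_lt hl₀ hl₁ D hQ fun θ => sub_pos.1 (h θ)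
  · exact hQ.not_lt hl₀ hl₁ D hP fun θ => sub_neg.1 (h θ)

lemma PolarOrbit.add_pi (D : DulacField l) (hP : PolarOrbit l P) (θ : ℝ) :
    P (θ + π) = -P θ := by
  have := congrFun (hP.unique hl₀ hl₁ D hP.antipodal) θ
  rw [this, neg_neg]

lemma PolarOrbit.add_pi_add (D : DulacField l) (hP : PolarOrbit l P) (θ : ℝ) (n : ℤ) :
    P (θ + π + n * (2 * π)) = -P θ := by
  have h : Function.Periodic P (2 * π) := fun θ => by
    rw [show θ + 2 * π = θ + π + π by ring, hP.add_pi hl₀ hl₁ D, hP.add_pi hl₀ hl₁ D, neg_neg]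
  rw [h.int_mul n, hP.add_pi hl₀ hl₁ D]

end

lemma exists_tendsto_of_sin_ne_zero {Φ : ℝ → ℝ} (hm : Monotone Φ) (hc : Continuous Φ)
    (h : ∀ᶠ t in atTop, sin (Φ t) ≠ 0) : ∃ L, Tendsto Φ atTop (nhds L) := by
  refine (tendsto_atTop_of_monotone hm).resolve_left fun hT => ?_
  obtain ⟨t₀, ht₀⟩ := eventually_atTop.1 h
  obtain ⟨n, hn⟩ := exists_nat_gt (Φ t₀ / π)
  obtain ⟨t₁, h₁, h₂⟩ := ((eventually_ge_atTop t₀).and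
    (hT.eventually_ge_atTop (n * π))).exists
  obtain ⟨t, ht, e⟩ := intermediate_value_Icc h₁ hc.continuousOn
    ⟨((div_lt_iff₀ pi_pos).1 hn).le, h₂⟩
  exact ht₀ t ht.1 (by rw [e, sin_nat_mul_pi])

lemma radial_of_tendsto {F : Filter ℝ} [F.NeBot] {Φ : ℝ → ℝ} {g : ℝ → ℝ × ℝ} {L : ℝ}
    {p : ℝ × ℝ} (hΦ : Tendsto Φ F (nhds L)) (hg : Tendsto g F (nhds p)) (hp : p ≠ 0)
    (h : ∀ t, 0 < radial (Φ t) (g t) ∧ g t = radial (Φ t) (g t) • ray (Φ t)) :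
    0 < radial L p ∧ p = radial L p • ray L := by
  have hr : Tendsto (fun t => radial (Φ t) (g t)) F (nhds (radial L p)) :=
    (hg.fst_nhds.mul ((continuous_cos.tendsto L).comp hΦ)).sub
      (hg.snd_nhds.mul ((continuous_sin.tendsto L).comp hΦ))
  have e : p = radial L p • ray L := by
    refine tendsto_nhds_unique hg ?_
    have := hr.smul ((continuous_ray.tendsto L).comp hΦ)
    exact this.congr fun t => (h t).2.symm
  refine ⟨lt_of_le_of_ne (ge_of_tendsto' hr fun t => (h t).1.le) fun h₀ => hp ?_, e⟩
  rw [e, ← h₀, zero_smul]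

lemma DulacField.tendsto_flux {l : ℝ} (D : DulacField l) {F : Filter ℝ} {a b : ℝ → ℝ × ℝ}
    {p q : ℝ × ℝ} {k : ℝ} (hp : p ∈ puncturedSquare) (hq : q ∈ puncturedSquare) (hk : 0 < k)
    (hpq : q = k • p) (ha : Tendsto a F (nhds p)) (hb : Tendsto b F (nhds q)) :
    Tendsto (fun u => flux D.toFun (a u) (b u)) F (nhds (flux D.toFun p q)) := by
  have h := continuousAt_flux D.isOpen D.contDiffOn (p := (p, q)) fun s hs =>
    D.subset (segment_mem_puncturedSquare hp hq hk hpq hs)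
  exact Tendsto.comp (g := fun r : (ℝ × ℝ) × ℝ × ℝ => flux D.toFun r.1 r.2)
    (f := fun u => (a u, b u)) h (ha.prodMk_nhds hb)

lemma DulacField.not_tendsto {l : ℝ} (D : DulacField l) {a b a' b' : ℝ → ℝ × ℝ}
    (ha : ∀ u, HasDerivAt a (a' u) u) (hb : ∀ u, HasDerivAt b (b' u) u) (hca : Continuous a')
    (hcb : Continuous b') {κ : ℝ → ℝ} (hau : ∀ u, a u ∈ puncturedSquare)
    (hbu : ∀ u, b u ∈ puncturedSquare) (hκ : ∀ u, 1 < κ u) (hab : ∀ u, b u = κ u • a u)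
    (hda : ∀ u, det2 (a u) (a' u) < 0) (hdb : ∀ u, det2 (b u) (b' u) < 0)
    (hDa : ∀ u, det2 (D.toFun (a u)) (a' u) = 0) (hDb : ∀ u, det2 (D.toFun (b u)) (b' u) = 0)
    {p q : ℝ × ℝ} {k : ℝ} (hp : p ∈ puncturedSquare) (hq : q ∈ puncturedSquare) (hk : 0 < k)
    (hpq : q = k • p) (ha₀ : Tendsto a atBot (nhds (-p))) (ha₁ : Tendsto a atTop (nhds p))
    (hb₀ : Tendsto b atBot (nhds (-q))) (hb₁ : Tendsto b atTop (nhds q)) : False := by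
  have hneg : ∀ z ∈ puncturedSquare, -z ∈ puncturedSquare := fun z ⟨h₁, h₂, h₃⟩ =>
    ⟨by simpa using h₁, by simpa using h₂, neg_ne_zero.2 h₃⟩
  have hd : ∀ u, ∃ d, 0 < d ∧ HasDerivAt (fun u => flux D.toFun (a u) (b u)) d u := fun u => by
    obtain ⟨d, h, h'⟩ := D.hasDerivAt_flux ha hb hca hcb (hau u) (hbu u) (hκ u) (hab u) (hda u)
      (hdb u)
    rw [hDa, hDb, sub_zero] at h
    exact ⟨d, h, h'⟩
  choose d hd hd' using hd
  have hmono := strictMono_of_hasDerivAt_pos hd' hd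
  have h₁ := D.tendsto_flux hp hq hk hpq ha₁ hb₁
  have h₀ := D.tendsto_flux (hneg p hp) (hneg q hq) hk (by rw [hpq, smul_neg]) ha₀ hb₀
  rw [flux_neg D.neg] at h₀
  have e₀ := hmono.monotone.le_of_tendsto h₀ 0
  have e₁ := hmono.monotone.ge_of_tendsto h₁ 1
  exact absurd (hmono zero_lt_one) (not_lt.2 (e₁.trans e₀))

lemma one_one_mem : ((1, 1) : ℝ × ℝ) ∈ puncturedSquare := by
  refine ⟨by simp, by simp, fun h => ?_⟩
  simpa using congrArg Prod.fst h

section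
variable {l : ℝ} (hl₀ : 0.4 ≤ l) (hl₁ : l ≤ 1.6) (D : DulacField l) {f g : ℝ → ℝ × ℝ}
include hl₀ hl₁ D

/-- A closed orbit excludes a connection between the saddles. -/
lemma not_tendsto_of_periodic (hf : Solves (normalField l) f) (hmem : ∀ t, f t ∈ openSquare)
    {T : ℝ} (hT : 0 < T) (hper : Function.Periodic f T) (hg : Solves (normalField l) g)
    (hg₀ : Tendsto g atBot (nhds (-(1, 1)))) (hg₁ : Tendsto g atTop (nhds (1, 1))) : False := by
  obtain ⟨P, hP, hrange⟩ := exists_polarOrbit hl₀ hl₁ hf hmem hT hper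
  have hgmem : ∀ t, g t ∈ openSquare :=
    hg.mem_square_of_tendsto (by linarith) (by simpa using hg₀) hg₁
  have hX : Continuous (normalField l) := contDiff_normalField.continuous
  obtain ⟨Φ, hΦ, hr⟩ := exists_angle hg (hX.comp hg.continuous) fun t => (hgmem t).2.2
  set ω : ℝ → ℝ := fun t =>
    -det2 (g t) (normalField l (g t)) / ((g t).1 ^ 2 + (g t).2 ^ 2) with hω
  have hdet : ∀ t, det2 (g t) (normalField l (g t)) < 0 := fun t =>
    det2_normalField_neg hl₀ hl₁ (hgmem t).1 (hgmem t).2.1 (hgmem t).2.2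
  have hpos : ∀ t, 0 < ω t := fun t =>
    div_pos (neg_pos.2 (hdet t)) (sq_add_sq_pos (hgmem t).2.2)
  have hgc := hg.continuous
  have hωc : Continuous ω :=
    continuous_angularVelocity hgc (hX.comp hgc) fun t => (hgmem t).2.2
  have hmono := (strictMono_of_hasDerivAt_pos hΦ hpos).monotone
  have hΦc : Continuous Φ := continuous_iff_continuousAt.2 fun t => (hΦ t).continuousAt
  have hsin : ∀ t, (g t).2 ≠ 0 → sin (Φ t) ≠ 0 := fun t h h' => h (by
    rw [(hr t).2]; simp [ray, h'])
  obtain ⟨L₁, hL₁⟩ := exists_tendsto_of_sin_ne_zero hmono hΦc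
    ((hg₁.snd_nhds.eventually_ne one_ne_zero).mono hsin)
  obtain ⟨L₀, hL₀⟩ : ∃ L, Tendsto Φ atBot (nhds L) := by
    obtain ⟨L, hL⟩ := exists_tendsto_of_sin_ne_zero (Φ := fun t => -Φ (-t))
      (fun s t h => neg_le_neg (hmono (neg_le_neg h))) (by fun_prop) (by
        have := (hg₀.snd_nhds.eventually_ne (by simp : (-(1, 1) : ℝ × ℝ).2 ≠ 0)).mono hsin
        simpa using tendsto_neg_atTop_atBot.eventually this)
    refine ⟨-L, ?_⟩
    simpa [Function.comp_def] using (hL.comp tendsto_neg_atBot_atTop).neg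
  have hne : (-(1, 1) : ℝ × ℝ) ≠ 0 := neg_ne_zero.2 one_one_mem.2.2
  obtain ⟨r₁, e₁⟩ := radial_of_tendsto hL₁ hg₁ one_one_mem.2.2 hr
  obtain ⟨r₀, e₀⟩ := radial_of_tendsto hL₀ hg₀ hne hr
  obtain ⟨n, hn⟩ := eq_of_smul_ray_eq_neg r₁ r₀ (by rw [← e₁, ← e₀, neg_neg])
  have hPL : P L₀ = -P L₁ := by
    rw [hn, hP.add_pi_add hl₀ hl₁ D, neg_neg]
  have hPc := hP.solves.continuous
  set a : ℝ → ℝ × ℝ := fun t => P (Φ t) with ha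
  have had : ∀ t, HasDerivAt a (ω t • polarField l (a t)) t := fun t =>
    (hP.solves (Φ t)).scomp t (hΦ t)
  have hac : Continuous fun t => ω t • polarField l (a t) :=
    hωc.smul ((hP.continuous_deriv hl₀ hl₁).comp hΦc)
  have ha₁ : Tendsto a atTop (nhds (P L₁)) := (hPc.tendsto _).comp hL₁
  have ha₀ : Tendsto a atBot (nhds (-P L₁)) := hPL ▸ (hPc.tendsto _).comp hL₀
  have hdeta : ∀ t, det2 (a t) (ω t • polarField l (a t)) < 0 := fun t => by
    rw [det2_smul_right, det2_polarField hl₀ hl₁ (hP.mem _)]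
    exact mul_neg_of_pos_of_neg (hpos t) (neg_neg_of_pos (sq_add_sq_pos (hP.mem _).2.2))
  have hrne : ∀ t, radial (Φ t) (g t) - radial (Φ t) (a t) ≠ 0 := fun t h => by
    obtain ⟨s, hs⟩ : a t ∈ range f := hrange ▸ mem_range_self _
    have hat : a t = radial (Φ t) (a t) • ray (Φ t) := hP.eq_smul (Φ t)
    have e : g t = f s := by
      refine (hr t).2.trans ?_
      rw [sub_eq_zero.1 h, hs]
      exact hat.symm
    have hgf := hg.eq_of_eq_at (hf.comp_add_const (s - t))
      (fun t => contDiff_normalField.contDiffAt) (t₀ := t) (by simp [e])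
    have hper' : Function.Periodic g T := fun u => by
      rw [hgf]; simp only [add_right_comm u T, hper (u + (s - t))]
    have hlim : Tendsto (fun n : ℕ => g (0 + n * T)) atTop (nhds (1, 1)) :=
      hg₁.comp (tendsto_atTop_add_const_left _ _ (tendsto_natCast_atTop_atTop.atTop_mul_const hT))
    simp only [fun n : ℕ => hper'.nat_mul n 0] at hlim
    have := (hgmem 0).1
    rw [tendsto_const_nhds_iff.1 hlim] at this
    simp at this
  have hcr : Continuous fun t => radial (Φ t) (g t) - radial (Φ t) (a t) :=
    (hΦc.radial hgc).sub (hΦc.radial (hPc.comp hΦc))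
  have hgd : Continuous fun t => normalField l (g t) := hX.comp hgc
  rcases pos_or_neg_of_continuous hcr hrne with h | h
  · exact D.not_tendsto had hg hac hgd (fun t => openSquare_subset (hP.mem _))
      (fun t => openSquare_subset (hgmem t))
      (fun t => (one_lt_div (hP.radial_pos _)).2 (sub_pos.1 (h t)))
      (fun t => eq_smul_of_radial (hP.radial_pos _) (hP.eq_smul _) (hr t).2) hdeta hdet
      (fun t => D.det2_smul_polarField _ _) (fun t => D.det2_normalField _)
      (openSquare_subset (hP.mem _)) one_one_mem (div_pos r₁ (hP.radial_pos _))
      (eq_smul_of_radial (hP.radial_pos _) (hP.eq_smul _) e₁) ha₀ ha₁ hg₀ hg₁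
  · exact D.not_tendsto hg had hgd hac (fun t => openSquare_subset (hgmem t))
      (fun t => openSquare_subset (hP.mem _))
      (fun t => (one_lt_div (hr t).1).2 (sub_neg.1 (h t)))
      (fun t => eq_smul_of_radial (hr t).1 (hr t).2 (hP.eq_smul _)) hdet hdeta
      (fun t => D.det2_normalField _) (fun t => D.det2_smul_polarField _ _)
      one_one_mem (openSquare_subset (hP.mem _)) (div_pos (hP.radial_pos _) r₁)
      (eq_smul_of_radial r₁ e₁ (hP.eq_smul _)) hg₀ hg₁ ha₀ ha₁

end

lemma pos_of_pos_deriv_at_zeros {f : ℝ → ℝ} {a b : ℝ} (hf : ContinuousOn f (Icc a b))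
    (ha : 0 < f a) (hb : 0 < f b)
    (h : ∀ u ∈ Ioo a b, f u = 0 → ∃ d, 0 < d ∧ HasDerivAt f d u) : ∀ u ∈ Icc a b, 0 < f u := by
  by_contra! hc
  obtain ⟨u₀, hu₀, hfu₀⟩ := hc
  have hK : IsCompact (Icc a b ∩ f ⁻¹' Iic 0) :=
    isCompact_Icc.of_isClosed_subset (hf.preimage_isClosed_of_isClosed isClosed_Icc isClosed_Iic)
      inter_subset_left
  obtain ⟨u, ⟨⟨hau, hub⟩, hu⟩, hmin⟩ := hK.exists_isLeast ⟨u₀, hu₀, hfu₀⟩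
  have hu : f u ≤ 0 := hu
  have hau' : a < u := lt_of_le_of_ne hau fun e => by rw [← e] at hu; linarith
  have hub' : u < b := lt_of_le_of_ne hub fun e => by rw [e] at hu; linarith
  have hlt : ∀ v ∈ Ioo a u, 0 < f v := fun v hv => by
    by_contra! h'
    exact absurd (hmin ⟨⟨hv.1.le, (hv.2.trans hub').le⟩, h'⟩) (not_le.2 hv.2)
  obtain ⟨v, ⟨hav, hvu⟩, hv⟩ := intermediate_value_Icc' hau
    (hf.mono (Icc_subset_Icc_right hub)) ⟨hu, ha.le⟩
  have huv : u = v := le_antisymm (hmin ⟨⟨hav, hvu.trans hub⟩, hv.le⟩) hvu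
  obtain ⟨d, hd, hd'⟩ := h u ⟨hau', hub'⟩ (by rw [huv]; exact hv)
  have h0 : f u = 0 := by rw [huv]; exact hv
  have hev := ((hasDerivAt_iff_tendsto_slope.1 hd').mono_left
    (nhdsLT_le_nhdsNE u)).eventually (lt_mem_nhds hd)
  obtain ⟨w, hw, hw₁⟩ := (hev.and (Ioo_mem_nhdsLT hau')).exists
  rw [slope_def_field, h0, sub_zero] at hw
  have h₂ := hlt w hw₁
  have : f w / (w - u) < 0 := div_neg_of_pos_of_neg h₂ (sub_neg.2 hw₁.2)
  linarith

lemma radial_lt_of_abs_fst_eq_one {θ : ℝ} {z w : ℝ × ℝ} (hz : z ∈ openSquare)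
    (hze : z = radial θ z • ray θ) (hw : |w.1| = 1) (hw₀ : 0 < radial θ w)
    (hwe : w = radial θ w • ray θ) : radial θ z < radial θ w := by
  have h₁ : z.1 = radial θ z * cos θ := congrArg Prod.fst hze
  have h₂ : w.1 = radial θ w * cos θ := congrArg Prod.fst hwe
  have h := hz.1
  rw [← hw, h₁, h₂, abs_mul, abs_mul, abs_of_pos hw₀] at h
  exact (le_abs_self _).trans_lt (lt_of_mul_lt_mul_right h (abs_nonneg _))

lemma radial_sub (θ : ℝ) (z w : ℝ × ℝ) : radial θ (z - w) = radial θ z - radial θ w := by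
  simp only [radial, Prod.fst_sub, Prod.snd_sub]; ring

lemma hasDerivAt_radial {Φ : ℝ → ℝ} {w : ℝ → ℝ × ℝ} {φ u : ℝ} {w' : ℝ × ℝ}
    (hΦ : HasDerivAt Φ φ u) (hw : HasDerivAt w w' u) (h₀ : w u = 0) :
    HasDerivAt (fun u => radial (Φ u) (w u)) (radial (Φ u) w') u := by
  convert! ((hasDerivAt_fst hw).mul hΦ.cos).sub ((hasDerivAt_snd hw).mul hΦ.sin) using 1
  simp [h₀, radial]

/-- Two curves through a common point with the same angular velocity. -/
lemma radial_sub_pos {θ r ω : ℝ} {v w : ℝ × ℝ} (hr : 0 < r) (hω : 0 < ω)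
    (hv : det2 (r • ray θ) v = -ω) (hw : det2 (r • ray θ) w = -ω) (h : 0 < det2 v w) :
    0 < radial θ (w - v) := by
  rw [det2_smul_left] at hv hw
  have e₁ : det2 (ray θ) (w - v) = 0 := by
    have : r * det2 (ray θ) (w - v) = 0 := by
      have : det2 (ray θ) (w - v) = det2 (ray θ) w - det2 (ray θ) v := by
        simp only [det2, Prod.fst_sub, Prod.snd_sub]; ring
      rw [this, mul_sub, hv, hw, sub_self]
    exact (mul_eq_zero.1 this).resolve_left hr.ne'
  have e₂ : r * det2 v w = radial θ (w - v) * ω := by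
    simp only [det2, ray, radial, Prod.fst_sub, Prod.snd_sub] at *
    linear_combination (-((w.1 - v.1) * cos θ - (w.2 - v.2) * sin θ)) * hv
      + r * (v.1 * cos θ - v.2 * sin θ) * e₁
      - r * (v.1 * w.2 - v.2 * w.1) * sin_sq_add_cos_sq θ
  have := mul_pos hr h
  rw [e₂] at this
  exact pos_of_mul_pos_left this hω.le

/-- The barrier between the saddles excludes closed orbits. -/
lemma not_polarOrbit {l : ℝ} (hl₀ : 1.352 ≤ l) (hl₁ : l ≤ 1.6) (D : DulacField l)
    {P : ℝ → ℝ × ℝ} : ¬ PolarOrbit l P := by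
  intro hP
  have hl : 0.4 ≤ l := by linarith
  have hX : Continuous (normalField l) := contDiff_normalField.continuous
  obtain ⟨Φ, hΦ, hr⟩ := exists_angle hasDerivAt_barrier continuous_barrier' barrier_ne_zero
  have hbc : Continuous barrier :=
    continuous_iff_continuousAt.2 fun u => (hasDerivAt_barrier u).continuousAt
  have hbc' := continuous_barrier'
  set ω : ℝ → ℝ := fun u =>
    -det2 (barrier u) (barrier' u) / ((barrier u).1 ^ 2 + (barrier u).2 ^ 2) with hω
  have hωc : Continuous ω := continuous_angularVelocity hbc hbc' barrier_ne_zero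
  have hdet : ∀ u ∈ Icc (-1 : ℝ) 1, det2 (barrier u) (barrier' u) < 0 := fun u hu =>
    det2_barrier_neg hu.1 hu.2
  have hpos : ∀ u ∈ Icc (-1 : ℝ) 1, 0 < ω u := fun u hu =>
    div_pos (neg_pos.2 (hdet u hu)) (sq_add_sq_pos (barrier_ne_zero u))
  have hωdet : ∀ u, det2 (barrier u) (barrier' u)
      = -(ω u * ((barrier u).1 ^ 2 + (barrier u).2 ^ 2)) := fun u => by
    rw [hω, div_mul_cancel₀ _ (sq_add_sq_pos (barrier_ne_zero u)).ne', neg_neg]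
  have hΦc : Continuous Φ := continuous_iff_continuousAt.2 fun u => (hΦ u).continuousAt
  have hPc := hP.solves.continuous
  set a : ℝ → ℝ × ℝ := fun u => P (Φ u) with ha
  have had : ∀ u, HasDerivAt a (ω u • polarField l (a u)) u := fun u =>
    (hP.solves (Φ u)).scomp u (hΦ u)
  have hac : Continuous fun u => ω u • polarField l (a u) :=
    hωc.smul ((hP.continuous_deriv hl hl₁).comp hΦc)
  have hmem : ∀ u, a u ∈ openSquare := fun u => hP.mem _
  have hae : ∀ u, a u = radial (Φ u) (a u) • ray (Φ u) := fun u => hP.eq_smul _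
  have har : ∀ u, 0 < radial (Φ u) (a u) := fun u => hP.radial_pos _
  have hdeta : ∀ u, det2 (a u) (ω u • polarField l (a u))
      = -(ω u * ((a u).1 ^ 2 + (a u).2 ^ 2)) := fun u => by
    rw [det2_smul_right, det2_polarField hl hl₁ (hmem u), mul_neg]
  have hend : ∀ u, |(barrier u).1| = 1 → 0 < radial (Φ u) (barrier u - a u) := fun u h => by
    rw [radial_sub, sub_pos]
    exact radial_lt_of_abs_fst_eq_one (hmem u) (hae u) h (hr u).1 (hr u).2
  have hgc : Continuous fun u => radial (Φ u) (barrier u - a u) :=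
    hΦc.radial (hbc.sub (hPc.comp hΦc))
  have hlt : ∀ u ∈ Icc (-1 : ℝ) 1, 0 < radial (Φ u) (barrier u - a u) := by
    refine pos_of_pos_deriv_at_zeros hgc.continuousOn (hend _ (by simp [barrier_neg_one]))
      (hend _ (by simp [barrier_one])) fun u hu h => ?_
    rw [radial_sub, sub_eq_zero] at h
    have e : a u = barrier u := by
      refine (hae u).trans ?_
      rw [← h]
      exact (hr u).2.symm
    have hu' := Ioo_subset_Icc_self hu
    refine ⟨_, ?_, hasDerivAt_radial (hΦ u) ((hasDerivAt_barrier u).sub (had u))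
      (by rw [e, sub_self])⟩
    refine radial_sub_pos (ω := ω u * ((barrier u).1 ^ 2 + (barrier u).2 ^ 2)) (hr u).1
      (mul_pos (hpos u hu') (sq_add_sq_pos (barrier_ne_zero u))) ?_ ?_ ?_
    · rw [← (hr u).2, ← e]
      exact hdeta u
    · rw [← (hr u).2]
      exact hωdet u
    · have hm := hmem u
      rw [e] at hm ⊢
      have h₁ := det2_normalField_neg hl hl₁ hm.1 hm.2.1 hm.2.2
      rw [det2_smul_left, polarField, det2_smul_left]
      exact mul_pos (hpos u hu') (mul_pos
        (div_pos_of_neg_of_neg (neg_neg_of_pos (sq_add_sq_pos hm.2.2)) h₁)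
        (det2_normalField_barrier_pos hl₀ hu.1 hu.2))
  have hd : ∀ u ∈ Icc (-1 : ℝ) 1, ∃ d, det2 (D.toFun (barrier u)) (barrier' u) < d ∧
      HasDerivAt (fun u => flux D.toFun (a u) (barrier u)) d u := fun u hu => by
    have hab := hlt u hu
    rw [radial_sub, sub_pos] at hab
    obtain ⟨d, h, h'⟩ := D.hasDerivAt_flux had hasDerivAt_barrier hac hbc'
      (openSquare_subset (hmem u)) (barrier_mem_puncturedSquare hu.1 hu.2)
      ((one_lt_div (har u)).2 hab) (eq_smul_of_radial (har u) (hae u) (hr u).2)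
      (by
        rw [hdeta]
        exact neg_neg_of_pos (mul_pos (hpos u hu) (sq_add_sq_pos (hmem u).2.2)))
      (hdet u hu)
    rw [D.det2_smul_polarField, sub_zero] at h
    exact ⟨d, h, h'⟩
  have hsymm : flux D.toFun (a (-1)) (barrier (-1)) = flux D.toFun (a 1) (barrier 1) := by
    have hb : barrier (-1) = -barrier 1 := by simp [barrier_one, barrier_neg_one]
    obtain ⟨n, hn⟩ := eq_of_smul_ray_eq_neg (hr (-1)).1 (hr 1).1
      (by rw [← (hr (-1)).2, ← (hr 1).2, hb])
    have : a (-1) = -a 1 := by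
      change P (Φ (-1)) = -P (Φ 1)
      rw [hn, hP.add_pi_add hl hl₁ D]
    rw [this, hb, flux_neg D.neg]
  choose! d hd hd' using hd
  obtain ⟨u, hu, h₀⟩ := exists_hasDerivAt_eq_zero (by norm_num : (-1 : ℝ) < 1)
    (fun u hu => (hd' u hu).continuousAt.continuousWithinAt) hsymm
    fun u hu => hd' u (Ioo_subset_Icc_self hu)
  have hu' := Ioo_subset_Icc_self hu
  have h := hd u hu'
  rw [h₀, D.eq_smul, det2_smul_left] at h
  exact absurd h (not_lt.2 (mul_pos (D.factor_pos _ (barrier_mem_puncturedSquare hu'.1 hu'.2))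
    (det2_normalField_barrier_pos hl₀ hu.1 hu.2)).le)

/-- A closed orbit of the normalized field in the open square. -/
structure ClosedOrbit (l : ℝ) (f : ℝ → ℝ × ℝ) (T : ℝ) : Prop where
  solves : Solves (normalField l) f
  mem : ∀ t, f t ∈ openSquare
  pos : 0 < T
  periodic : Function.Periodic f T

namespace ClosedOrbit
variable {l : ℝ} {f : ℝ → ℝ × ℝ} {T : ℝ}

lemma lt_of_le (h : ClosedOrbit l f T) : l < 1.58 := by
  by_contra! hl
  obtain ⟨W, hW⟩ := exists_lyapunov_of_ge hl
  refine not_periodic_of_deriv_pos (fun t => (W.hasDerivAt_comp h.solves t).neg)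
    (fun t => neg_pos.2 (hW _ (h.mem t).1 (h.mem t).2.1 (h.mem t).2.2)) h.pos fun t => ?_
  simp [h.periodic t]

lemma lt_scale (h : ClosedOrbit l f T) (hl : 0 < l) : 0.41 < l := by
  by_contra! hl'
  obtain ⟨W, hW⟩ := exists_lyapunov_of_le hl hl'
  refine not_periodic_of_deriv_pos (W.hasDerivAt_comp h.solves)
    (fun t => hW _ (h.mem t).1 (h.mem t).2.1 (h.mem t).2.2) h.pos fun t => ?_
  simp [h.periodic t]

lemma lt_of_sq_mul_eq_one {m : ℝ} (h : ClosedOrbit l f T) (hl₀ : 0.4 ≤ l) (hl₁ : l ≤ 1.6)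
    (hlm : l ^ 2 * m = 1) (hm : m ≤ 6) : m < 0.6 := by
  by_contra! hm'
  have hl : 0 < l := by linarith
  obtain ⟨B, hB⟩ := exists_dulac hl hlm hm' hm
  set Y : ℝ × ℝ → ℝ × ℝ := fun z => B.toFun z • normalField l z with hY
  have hYc : ContDiff ℝ 1 Y := B.contDiff.smul contDiff_normalField
  have hX : Continuous fun t => normalField l (f t) :=
    contDiff_normalField.continuous.comp h.solves.continuous
  have hd : ∀ t, ∃ d, 0 < d ∧ HasDerivAt (fun u => flux Y 0 (f u)) d t := fun t => by
    have hmem := h.mem t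
    have hdet := det2_normalField_neg hl₀ hl₁ hmem.1 hmem.2.1 hmem.2.2
    obtain ⟨d, hd, hd'⟩ := hasDerivAt_flux isOpen_univ hYc.contDiffOn
      (a := fun _ => 0) (a' := fun _ => 0) (fun u => hasDerivAt_const u _) h.solves
      continuous_const hX (u := t) (fun _ _ => mem_univ _) fun s hs => by
        have hs' : |s| ≤ 1 := by rw [abs_of_pos hs.1]; exact hs.2.le
        have hz : s • f t ∈ puncturedSquare := by
          refine ⟨?_, ?_, smul_ne_zero hs.1.ne' hmem.2.2⟩
          · rw [Prod.smul_fst, smul_eq_mul, abs_mul]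
            exact mul_le_one₀ hs' (abs_nonneg _) hmem.1.le
          · rw [Prod.smul_snd, smul_eq_mul, abs_mul]
            exact mul_le_one₀ hs' (abs_nonneg _) hmem.2.1.le
        simp only [sub_zero, zero_add]
        refine mul_pos ?_ ?_
        · rw [hY, planarDiv_smul_normalField (B.hasFDerivAt _)]
          exact hB _ hz
        · rw [det2_smul_left]
          refine mul_pos hs.1 ?_
          simp only [det2] at hdet ⊢
          linarith
    refine ⟨d, ?_, hd'⟩
    have h₁ : det2 (Y (f t)) (normalField l (f t)) = 0 := by
      rw [hY, det2_smul_left, det2_self, mul_zero]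
    have h₂ : det2 (Y 0) 0 = 0 := by simp [det2]
    rwa [h₁, h₂, sub_zero] at hd
  choose d hd hd' using hd
  exact not_periodic_of_deriv_pos hd' hd h.pos fun t => by simp only [h.periodic t]

lemma integral_normalDiv_pos {m : ℝ} (h : ClosedOrbit l f T) (hl : 0 < l)
    (hlm : l ^ 2 * m = 1) (h₀ : 0.4 ≤ m) (h₁ : m ≤ 0.6) :
    0 < ∫ t in (0 : ℝ)..T, normalDiv l (f t) := by
  obtain ⟨V, hV⟩ := exists_dulac_sq hl hlm h₀ h₁
  have hV' := fun t => hV _ (openSquare_subset (h.mem t))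
  have hfc := h.solves.continuous
  have hX : Continuous fun t => normalField l (f t) :=
    contDiff_normalField.continuous.comp hfc
  have hVc : Continuous fun t => V.toFun (f t) := V.contDiff.continuous.comp hfc
  have hc₁ : Continuous fun t => V.deriv (f t) (normalField l (f t)) / V.toFun (f t) :=
    ((V.continuous_deriv.comp hfc).clm_apply hX).div hVc fun t => (hV' t).1.ne'
  have hc₂ : Continuous fun t => normalDiv l (f t) := by unfold normalDiv; fun_prop
  have hlog := intervalIntegral.integral_eq_sub_of_hasDerivAt
    (fun t _ => (V.hasDerivAt_comp h.solves t).log (hV' t).1.ne')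
    (hc₁.intervalIntegrable 0 T)
  have hper : f T = f 0 := by simpa using h.periodic 0
  rw [hper, sub_self] at hlog
  have hpos := intervalIntegral.intervalIntegral_pos_of_pos_on
    ((hc₂.sub (hc₁.const_mul 2)).intervalIntegrable 0 T) (fun t _ => ?_) h.pos
  · simp only [Pi.sub_apply] at hpos
    rw [intervalIntegral.integral_sub (hc₂.intervalIntegrable 0 T)
      ((hc₁.const_mul 2).intervalIntegrable 0 T), intervalIntegral.integral_const_mul,
      hlog, mul_zero, sub_zero] at hpos
    exact hpos
  · obtain ⟨hv, hv'⟩ := hV' t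
    have := div_pos hv' hv
    rw [sub_div, mul_div_cancel_left₀ _ hv.ne', mul_div_assoc] at this
    exact this

end ClosedOrbit

lemma le_of_sq_mul_le {l m k : ℝ} (hl : 0 < l) (hlm : l ^ 2 * m = 1) (hk : k ^ 2 * m ≤ 1) :
    k ≤ l := by
  have hm : 0 < m := pos_of_mul_pos_right (hlm ▸ one_pos) (sq_nonneg l)
  rw [← hlm] at hk
  exact le_of_abs_le (abs_le_of_sq_le_sq (le_of_mul_le_mul_right hk hm) hl.le)

lemma le_of_le_sq_mul {l m k : ℝ} (hk₀ : 0 ≤ k) (hlm : l ^ 2 * m = 1) (hk : 1 ≤ k ^ 2 * m) :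
    l ≤ k := by
  have hm : 0 < m := pos_of_mul_pos_right (hlm ▸ one_pos) (sq_nonneg l)
  rw [← hlm] at hk
  exact le_of_abs_le (abs_le_of_sq_le_sq (le_of_mul_le_mul_right hk hm) hk₀)

lemma IsPeriodicOrbit.pos {m T : ℝ} {γ : ℝ → ℝ × ℝ} (h : IsPeriodicOrbit m γ T) : 0 < m := by
  obtain ⟨hs, hne, hT, hp⟩ := h
  by_contra! hm
  set H : ℝ → ℝ := fun t => (γ t).1 ^ 2 / 2 + (γ t).2 ^ 4 / 4 with hH
  have hd : ∀ t, HasDerivAt H (-(γ t).1 ^ 4 + m * (γ t).2 ^ 8) t := fun t => by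
    convert! (((hasDerivAt_fst (hs t)).pow 2).div_const 2).add
      (((hasDerivAt_snd (hs t)).pow 4).div_const 4) using 1
    simp only [bacciotti]
    push_cast
    ring
  have hle : ∀ t, -(γ t).1 ^ 4 + m * (γ t).2 ^ 8 ≤ 0 := fun t => by
    have h₁ : 0 ≤ (γ t).1 ^ 4 := by positivity
    have h₂ : 0 ≤ (γ t).2 ^ 8 := by positivity
    nlinarith [mul_nonneg (neg_nonneg.2 hm) h₂]
  have hanti : Antitone H := antitone_of_hasDerivAt_nonpos hd hle
  have hHp : Function.Periodic H T := fun t => by simp only [hH, hp t]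
  have hconst : ∀ t, H t = H 0 := by
    have key : ∀ s t, H s ≤ H t := fun s t => by
      obtain ⟨n, hn⟩ := exists_nat_ge ((t - s) / T)
      rw [div_le_iff₀ hT] at hn
      rw [← hHp.nat_mul n s]
      exact hanti (by linarith)
    exact fun t => le_antisymm (key t 0) (key 0 t)
  have hx : ∀ t, (γ t).1 = 0 := fun t => by
    have h₀ : HasDerivAt H 0 t := by
      rw [show H = fun _ => H 0 from funext hconst]
      exact hasDerivAt_const t _
    have e := (hd t).unique h₀
    have h₁ : 0 ≤ (γ t).1 ^ 4 := by positivity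
    have h₂ : 0 ≤ (γ t).2 ^ 8 := by positivity
    have h₃ := mul_nonneg (neg_nonneg.2 hm) h₂
    exact pow_eq_zero_iff four_ne_zero |>.1 (by linarith)
  refine hne ⟨0, fun t => Prod.ext (hx t) ?_⟩
  have h₀ : HasDerivAt (fun t => (γ t).1) 0 t := by
    rw [show (fun t => (γ t).1) = fun _ => 0 from funext hx]
    exact hasDerivAt_const t _
  have e := (hasDerivAt_fst (hs t)).unique h₀
  simp only [bacciotti, hx t] at e
  exact pow_eq_zero_iff three_ne_zero |>.1 (by linarith)

section
variable {m c l : ℝ} (hm : c ^ 4 = m) (hl : l * c ^ 2 = 1)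
include hm hl

lemma IsSolution.smul {γ : ℝ → ℝ × ℝ} (h : IsSolution m γ) :
    Solves (normalField l) fun t => c • γ t := fun t => by
  convert! (h t).const_smul c using 1
  ext
  · simp only [normalField, bacciotti, Prod.smul_fst, Prod.smul_snd, smul_eq_mul]
    linear_combination (c * ((γ t).2 ^ 3 - (γ t).1 ^ 3)) * hl
  · simp only [normalField, bacciotti, Prod.smul_fst, Prod.smul_snd, smul_eq_mul]
    linear_combination c * (γ t).2 ^ 5 * hm

lemma IsPeriodicOrbit.smul {γ : ℝ → ℝ × ℝ} {T : ℝ} (hc : 0 < c)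
    (h : IsPeriodicOrbit m γ T) :
    ClosedOrbit l (fun t => c • γ t) T := by
  obtain ⟨hs, hne, hT, hp⟩ := h
  have hs' := hs.smul hm hl
  have hp' : Function.Periodic (fun t => c • γ t) T := fun t => by simp only [hp t]
  have hl₀ : 0 < l := pos_of_mul_pos_left (hl ▸ one_pos) (sq_nonneg c)
  refine ⟨hs', fun t => hs'.mem_square_of_periodic hl₀ ?_ hT hp' t, hT, hp'⟩
  rintro ⟨k, hk⟩
  exact hne ⟨c⁻¹ • k, fun t => by rw [← hk t, inv_smul_smul₀ hc.ne']⟩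

lemma divBacciotti_eq_normalDiv (z : ℝ × ℝ) : divBacciotti m z = normalDiv l (c • z) := by
  simp only [divBacciotti, normalDiv, Prod.smul_fst, Prod.smul_snd, smul_eq_mul]
  linear_combination 3 * z.1 ^ 2 * hl - 5 * z.2 ^ 4 * hm

end

lemma exists_scale {m : ℝ} (hm : 0 < m) : ∃ c l : ℝ, 0 < c ∧ c ^ 4 = m ∧ l * c ^ 2 = 1 ∧
    0 < l ∧ l ^ 2 * m = 1 ∧ c * m ^ (-(1 : ℝ) / 4) = 1 := by
  have hc : 0 < m ^ ((1 : ℝ) / 4) := rpow_pos_of_pos hm _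
  have h₄ : (m ^ ((1 : ℝ) / 4)) ^ 4 = m := by
    rw [← rpow_natCast, ← rpow_mul hm.le]
    norm_num
  refine ⟨_, _, hc, h₄, inv_mul_cancel₀ (by positivity), by positivity, ?_, ?_⟩
  · nth_rewrite 2 [← h₄]
    field_simp
  · rw [← rpow_add hm]
    norm_num

lemma IsPeriodicOrbit.bounds {m T : ℝ} {γ : ℝ → ℝ × ℝ} (h : IsPeriodicOrbit m γ T) :
    0.547 < m ∧ m < 0.6 := by
  obtain ⟨c, l, hc, hcm, hlc, hl, hlm, -⟩ := exists_scale h.pos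
  have hf := h.smul hcm hlc hc
  have h₁ : 0.4 < m := by
    by_contra! hm
    exact absurd hf.lt_of_le (not_lt.2 (le_of_sq_mul_le hl hlm (by linarith)))
  have h₂ : m < 6 := by
    by_contra! hm
    exact absurd (hf.lt_scale hl) (not_lt.2 (le_of_le_sq_mul (by norm_num) hlm (by linarith)))
  have hl₁ : l ≤ 1.6 := le_of_le_sq_mul (by norm_num) hlm (by linarith)
  have h₃ := hf.lt_of_sq_mul_eq_one (le_of_sq_mul_le hl hlm (by linarith)) hl₁ hlm h₂.le
  refine ⟨?_, h₃⟩
  by_contra! hm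
  have hl₀ : 1.352 ≤ l := le_of_sq_mul_le hl hlm (by linarith)
  obtain ⟨D⟩ := nonempty_dulacField hl hlm h₁.le h₃.le
  obtain ⟨P, hP, -⟩ := exists_polarOrbit (by linarith) hl₁ hf.solves hf.mem hf.pos hf.periodic
  exact not_polarOrbit hl₀ hl₁ D hP

theorem bacciotti_limit_cycles (m : ℝ) :
    ((m ≤ 0.547 ∨ 0.6 ≤ m) → ¬ ∃ (γ : ℝ → ℝ × ℝ) (T : ℝ), IsPeriodicOrbit m γ T) ∧
    (0.547 < m → m < 0.6 →
      (∀ (γ₁ : ℝ → ℝ × ℝ) (T₁ : ℝ) (γ₂ : ℝ → ℝ × ℝ) (T₂ : ℝ),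
          IsPeriodicOrbit m γ₁ T₁ → IsPeriodicOrbit m γ₂ T₂ →
          Set.range γ₁ = Set.range γ₂) ∧
      ¬ ((∃ (γ : ℝ → ℝ × ℝ) (T : ℝ), IsPeriodicOrbit m γ T) ∧
          (∃ γ : ℝ → ℝ × ℝ, IsHeteroclinic m γ)) ∧
      (∀ (γ : ℝ → ℝ × ℝ) (T : ℝ), IsPeriodicOrbit m γ T → IsMinimalPeriod γ T →
          0 < ∫ t in (0:ℝ)..T, divBacciotti m (γ t))) := by
  refine ⟨fun hm ⟨γ, T, h⟩ => ?_, fun h₀ h₁ => ?_⟩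
  · obtain ⟨h₀, h₁⟩ := h.bounds
    rcases hm with hm | hm <;> linarith
  obtain ⟨c, l, hc, hcm, hlc, hl, hlm, hcp⟩ := exists_scale (by linarith : 0 < m)
  have hl₀ : 0.4 ≤ l := le_of_sq_mul_le hl hlm (by linarith)
  have hl₁ : l ≤ 1.6 := le_of_le_sq_mul (by norm_num) hlm (by linarith)
  obtain ⟨D⟩ := nonempty_dulacField hl hlm (by linarith) h₁.le
  refine ⟨fun γ₁ T₁ γ₂ T₂ hγ₁ hγ₂ => ?_, ?_, fun γ T h _ => ?_⟩
  · have hf := hγ₁.smul hcm hlc hc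
    have hg := hγ₂.smul hcm hlc hc
    obtain ⟨P, hP, eP⟩ := exists_polarOrbit hl₀ hl₁ hf.solves hf.mem hf.pos hf.periodic
    obtain ⟨Q, hQ, eQ⟩ := exists_polarOrbit hl₀ hl₁ hg.solves hg.mem hg.pos hg.periodic
    rw [hP.unique hl₀ hl₁ D hQ, eQ] at eP
    refine (smul_right_injective (ℝ × ℝ) hc.ne').image_injective ?_
    rw [← range_comp, ← range_comp]
    exact eP.symm
  · rintro ⟨⟨γ, T, h⟩, δ, hδ, hδ₀, hδ₁⟩
    have hf := h.smul hcm hlc hc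
    refine not_tendsto_of_periodic hl₀ hl₁ D hf.solves hf.mem hf.pos hf.periodic
      (hδ.smul hcm hlc) ?_ ?_
    · convert hδ₀.const_smul c using 2
      simp [pMinus, hcp]
    · convert hδ₁.const_smul c using 2
      simp [pPlus, hcp]
  · simp only [divBacciotti_eq_normalDiv hcm hlc]
    exact (h.smul hcm hlc hc).integral_normalDiv_pos hl hlm (by linarith) h₁.le

end
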